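/- arXiv:2010.09877 — 8 statements merged into one kernel-verified Lean document; each statement's English description precedes it below -/
import Mathlib

section
/- Let m ≥ 1 be an integer, let (E_1,‖·‖_1), …, (E_m,‖·‖_m) be real normed vector spaces, let Z_1, …, Z_m be random vectors defined on a common probability space with Z_i valued in E_i (no independence between the Z_i is assumed), let Z̃_i ∈ E_i be deterministic vectors, and let C ≥ 1, c > 0, σ > 0, q > 0. Assume that for every i ∈ {1,…,m}, every continuous linear form f : E_i → ℝ of operator norm at most 1, and every t > 0, P(|f(Z_i) − f(Z̃_i)| ≥ t) ≤ C·exp(−(t/(c·σ))^q). Then there exist constants C′ ≥ 1 and c′ > 0 depending only on C, c and q (and not on m or on the spaces E_i) such that for every continuous linear form φ on the product E_1 × ⋯ × E_m of operator norm at most 1 with respect to the norm ‖(z_1,…,z_m)‖ = max_{1≤i≤m} ‖z_i‖_i, and every t > 0, P(|φ(Z_1,…,Z_m) − φ(Z̃_1,…,Z̃_m)| ≥ t) ≤ C′·exp(−(t/(c′·σ))^q). -/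
open MeasureTheory ProbabilityTheory ENNReal

universe u v

/-- The norms of the coordinate restrictions of a continuous linear form on a finite product
with the sup norm add up to at most the norm of the form. -/
theorem sum_norm_comp_single_le {ι : Type*} [Fintype ι] [DecidableEq ι] {E : ι → Type*}
    [∀ i, NormedAddCommGroup (E i)] [∀ i, NormedSpace ℝ (E i)] (φ : (∀ i, E i) →L[ℝ] ℝ) :
    ∑ i, ‖φ.comp (ContinuousLinearMap.single ℝ E i)‖ ≤ ‖φ‖ := by
  set ψ : ∀ i, E i →L[ℝ] ℝ := fun i => φ.comp (ContinuousLinearMap.single ℝ E i)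
  have almost_attained : ∀ ε : ℝ, 0 < ε → ∀ i, ∃ x : E i, ‖x‖ ≤ 1 ∧ ‖ψ i‖ - ε ≤ ψ i x := by
    intro ε hε i
    rcases lt_or_ge (‖ψ i‖ - ε) 0 with h | h
    · exact ⟨0, by simp, by simpa using h.le⟩
    obtain ⟨x, hx, hr⟩ := (ψ i).exists_lt_apply_of_lt_opNorm (sub_lt_self _ hε)
    rw [Real.norm_eq_abs] at hr
    rcases abs_choice (ψ i x) with h' | h'
    · exact ⟨x, hx.le, by linarith⟩
    · exact ⟨-x, by simpa using hx.le, by rw [map_neg]; linarith⟩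
  have approx : ∀ ε : ℝ, 0 < ε → ∑ i, ‖ψ i‖ ≤ ‖φ‖ + Fintype.card ι * ε := by
    intro ε hε
    choose x hx hψ using almost_attained ε hε
    have norm_le : ‖x‖ ≤ 1 := (pi_norm_le_iff_of_nonneg zero_le_one).2 hx
    have apply_eq : φ x = ∑ i, ψ i (x i) := by
      conv_lhs => rw [← Finset.univ_sum_single x]
      simp [ψ]
    have sum_le := Finset.sum_le_sum fun i (_ : i ∈ Finset.univ) => hψ i
    have := (le_abs_self _).trans (φ.unit_le_opNorm x norm_le)
    simp only [Finset.sum_sub_distrib, Finset.sum_const, Finset.card_univ, nsmul_eq_mul]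
      at sum_le
    linarith
  refine le_of_forall_pos_le_add fun δ hδ => ?_
  have hpos : (0 : ℝ) < Fintype.card ι + 1 := by positivity
  refine (approx (δ / (Fintype.card ι + 1)) (by positivity)).trans ?_
  gcongr
  rw [mul_div_assoc', div_le_iff₀ hpos]
  nlinarith

/-- A tail bound for subconvex combinations of functions with a common tail bound; no
measurability or independence is needed. -/
theorem measure_le_weighted_sum_le_tsum {Ω ι : Type*} [MeasurableSpace Ω] [Fintype ι]
    (μ : Measure Ω) {w : ι → ℝ} (hw : ∀ i, 0 ≤ w i) (hw1 : ∑ i, w i ≤ 1)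
    {x : ι → Ω → ℝ} (hx : ∀ i ω, 0 ≤ x i ω) {s : ℝ} (hs : 0 < s) {B : ℕ → ℝ≥0∞}
    (hB : ∀ i (k : ℕ), μ {ω | (k + 1 : ℝ) * s ≤ x i ω} ≤ B k) :
    μ {ω | 2 * s ≤ ∑ i, w i * x i ω} ≤ ∑' k, B k := by
  set A : ι → ℕ → Set Ω := fun i k => toMeasurable μ {ω | (k + 1 : ℝ) * s ≤ x i ω}
  have hA : ∀ i k, MeasurableSet (A i k) := fun i k => measurableSet_toMeasurable _ _
  set G : Ω → ℝ≥0∞ := fun ω => ∑ i, ENNReal.ofReal (w i) * ∑' k, (A i k).indicator 1 ω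
  have measurable_tsum : ∀ i, Measurable fun ω => ∑' k, (A i k).indicator (1 : Ω → ℝ≥0∞) ω :=
    fun i => Measurable.tsum fun k => measurable_one.indicator (hA i k)
  have hG : Measurable G :=
    Finset.measurable_sum _ fun i _ => (measurable_tsum i).const_mul _
  have floor_le : ∀ i ω, (⌊x i ω / s⌋₊ : ℝ≥0∞) ≤ ∑' k, (A i k).indicator 1 ω := by
    intro i ω
    refine le_trans (le_of_eq ?_) (ENNReal.sum_le_tsum (Finset.range ⌊x i ω / s⌋₊))
    rw [Finset.sum_congr rfl (g := fun _ => 1)]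
    · simp
    intro k hk
    have hle : ((k + 1 : ℕ) : ℝ) ≤ x i ω / s :=
      (Nat.le_floor_iff (div_nonneg (hx i ω) hs.le)).1 (Finset.mem_range.1 hk)
    rw [le_div_iff₀ hs] at hle
    have hmem : ω ∈ A i k := subset_toMeasurable _ _ (by simpa using hle)
    simp [hmem]
  have one_le : {ω | 2 * s ≤ ∑ i, w i * x i ω} ⊆ {ω | 1 ≤ G ω} := by
    intro ω hω
    have hω : 2 * s ≤ ∑ i, w i * x i ω := hω
    have term_le : ∀ i, w i * x i ω ≤ s * (w i * ⌊x i ω / s⌋₊) + s * w i := by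
      intro i
      have := (div_lt_iff₀ hs).1 (Nat.lt_floor_add_one (x i ω / s))
      nlinarith [mul_le_mul_of_nonneg_left this.le (hw i)]
    have sum_le := Finset.sum_le_sum fun i (_ : i ∈ Finset.univ) => term_le i
    rw [Finset.sum_add_distrib, ← Finset.mul_sum, ← Finset.mul_sum] at sum_le
    have one_le_sum : 1 ≤ ∑ i, w i * (⌊x i ω / s⌋₊ : ℝ) := by
      have := mul_le_mul_of_nonneg_left hw1 hs.le
      refine le_of_mul_le_mul_left ?_ hs
      linarith
    calc (1 : ℝ≥0∞) = ENNReal.ofReal 1 := by simp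
      _ ≤ ENNReal.ofReal (∑ i, w i * (⌊x i ω / s⌋₊ : ℝ)) := ENNReal.ofReal_le_ofReal one_le_sum
      _ = ∑ i, ENNReal.ofReal (w i) * (⌊x i ω / s⌋₊ : ℝ≥0∞) := by
        rw [ENNReal.ofReal_sum_of_nonneg fun i _ => mul_nonneg (hw i) (Nat.cast_nonneg _)]
        simp [ENNReal.ofReal_mul, hw]
      _ ≤ G ω := Finset.sum_le_sum fun i _ => by gcongr; exact floor_le i ω
  calc μ {ω | 2 * s ≤ ∑ i, w i * x i ω} ≤ μ {ω | 1 ≤ G ω} := measure_mono one_le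
    _ ≤ ∫⁻ ω, G ω ∂μ := by
      simpa using mul_meas_ge_le_lintegral (μ := μ) hG 1
    _ = ∑ i, ENNReal.ofReal (w i) * ∑' k, μ (A i k) := by
      simp only [G]
      rw [lintegral_finsetSum _ fun i _ => (measurable_tsum i).const_mul _]
      refine Finset.sum_congr rfl fun i _ => ?_
      rw [lintegral_const_mul _ (measurable_tsum i),
        lintegral_tsum fun k => (measurable_one.indicator (hA i k)).aemeasurable]
      simp [hA]
    _ ≤ ∑ i, ENNReal.ofReal (w i) * ∑' k, B k := by
      gcongr with i _ k
      simpa only [A, measure_toMeasurable] using hB i k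
    _ ≤ ∑' k, B k := by
      rw [← Finset.sum_mul, ← ENNReal.ofReal_sum_of_nonneg fun i _ => hw i]
      exact mul_le_of_le_one_left' (by simpa using hw1)

theorem summable_exp_neg_rpow_div_two {q : ℝ} (hq : 0 < q) :
    Summable fun k : ℕ => Real.exp (-((k + 1 : ℝ) ^ q / 2)) := by
  have tendsto : Filter.Tendsto (fun k : ℕ => (k + 1 : ℝ) ^ q) Filter.atTop Filter.atTop :=
    (tendsto_rpow_atTop hq).comp
      (Filter.tendsto_atTop_add_const_right _ 1 tendsto_natCast_atTop_atTop)
  have isBigO := ((isLittleO_exp_neg_mul_rpow_atTop (a := 1 / 2) (by norm_num)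
    (-2 / q)).comp_tendsto tendsto).isBigO
  have summable_sq : Summable fun k : ℕ => ((k + 1 : ℝ) ^ q) ^ (-2 / q) := by
    have := (summable_nat_add_iff 1).2 (Real.summable_nat_rpow.2 (show (-2 : ℝ) < -1 by norm_num))
    refine this.congr fun k => ?_
    rw [← Real.rpow_mul (by positivity), mul_div_cancel₀ _ hq.ne']
    push_cast
    rfl
  refine (summable_of_isBigO_nat summable_sq isBigO).congr fun k => ?_
  simp only [Function.comp_apply]
  ring_nf

theorem tsum_exp_neg_mul_rpow_le {q : ℝ} (hq : 0 < q) {u : ℝ} (hu : 1 ≤ u) :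
    ∑' k : ℕ, ENNReal.ofReal (Real.exp (-((k + 1 : ℝ) * u) ^ q)) ≤
      ENNReal.ofReal
        ((∑' k : ℕ, Real.exp (-((k + 1 : ℝ) ^ q / 2))) * Real.exp (-(u ^ q / 2))) := by
  have hsum := summable_exp_neg_rpow_div_two hq
  rw [← tsum_mul_right, ENNReal.ofReal_tsum_of_nonneg (fun k => by positivity)
    (hsum.mul_right _)]
  refine ENNReal.tsum_le_tsum fun k => ENNReal.ofReal_le_ofReal ?_
  rw [← Real.exp_add, Real.exp_le_exp, Real.mul_rpow (by positivity) (by positivity)]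
  have h1 : 1 ≤ u ^ q := Real.one_le_rpow hu hq.le
  have h2 : 1 ≤ (k + 1 : ℝ) ^ q := Real.one_le_rpow (by linarith [k.cast_nonneg (α := ℝ)]) hq.le
  nlinarith

/-- Linear concentration of possibly dependent random vectors is preserved (with constants
depending only on `C`, `c` and `q`) by concatenation, for the sup norm on the product. -/
theorem stmt3 (C c q : ℝ) (hC : 1 ≤ C) (hc : 0 < c) (hq : 0 < q) :
    ∃ C' c' : ℝ, 1 ≤ C' ∧ 0 < c' ∧
      ∀ (Ω : Type u) [MeasurableSpace Ω] (μ : Measure Ω) [IsProbabilityMeasure μ]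
        (m : ℕ), 1 ≤ m →
        ∀ (E : Fin m → Type v) [∀ i, NormedAddCommGroup (E i)] [∀ i, NormedSpace ℝ (E i)]
          (Z : Ω → ∀ i, E i) (Zt : ∀ i, E i) (σ : ℝ), 0 < σ →
          (∀ (i : Fin m) (f : E i →L[ℝ] ℝ), ‖f‖ ≤ 1 → ∀ t : ℝ, 0 < t →
            μ {ω | t ≤ |f (Z ω i) - f (Zt i)|} ≤
              ENNReal.ofReal (C * Real.exp (-(t / (c * σ)) ^ q))) →
          ∀ φ : (∀ i, E i) →L[ℝ] ℝ, ‖φ‖ ≤ 1 → ∀ t : ℝ, 0 < t →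
            μ {ω | t ≤ |φ (Z ω) - φ Zt|} ≤
              ENNReal.ofReal (C' * Real.exp (-(t / (c' * σ)) ^ q)) := by
  set S : ℝ := ∑' k : ℕ, Real.exp (-((k + 1 : ℝ) ^ q / 2))
  have hS : 0 ≤ S := tsum_nonneg fun k => (Real.exp_pos _).le
  refine ⟨C * S + Real.exp (1 / 2), 2 * c * 2 ^ (1 / q), ?_, by positivity, ?_⟩
  · have := Real.one_le_exp (show (0 : ℝ) ≤ 1 / 2 by norm_num)
    nlinarith [mul_nonneg (zero_le_one.trans hC) hS]
  intro Ω _ μ _ m _ E _ _ Z Zt σ hσ hZ φ hφ t ht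
  set u : ℝ := t / (2 * c * σ) with hu
  have hu0 : 0 < u := by positivity
  have rescale : (t / (2 * c * 2 ^ (1 / q) * σ)) ^ q = u ^ q / 2 := by
    rw [show t / (2 * c * 2 ^ (1 / q) * σ) = u / 2 ^ (1 / q) by rw [hu]; field_simp,
      Real.div_rpow hu0.le (by positivity), ← Real.rpow_mul (by norm_num),
      one_div_mul_cancel hq.ne', Real.rpow_one]
  rw [rescale]
  rcases lt_or_ge u 1 with hu1 | hu1
  · refine prob_le_one.trans ?_
    rw [ENNReal.one_le_ofReal, add_mul, ← Real.exp_add]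
    have h1 : u ^ q ≤ 1 := Real.rpow_le_one hu0.le hu1.le hq.le
    have h2 : 1 ≤ Real.exp (1 / 2 + -(u ^ q / 2)) := Real.one_le_exp (by linarith)
    have : 0 ≤ C * S * Real.exp (-(u ^ q / 2)) := by positivity
    linarith
  set ψ : ∀ i, E i →L[ℝ] ℝ := fun i => φ.comp (ContinuousLinearMap.single ℝ E i)
  set f : ∀ i, E i →L[ℝ] ℝ := fun i => ‖ψ i‖⁻¹ • ψ i
  have hf : ∀ i, ‖f i‖ ≤ 1 := fun i => by
    rw [norm_smul, norm_inv, norm_norm]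
    exact inv_mul_le_one
  have smul_f : ∀ i, ‖ψ i‖ • f i = ψ i := fun i => by
    by_cases h : ψ i = 0
    · simp [h]
    · exact smul_inv_smul₀ (norm_ne_zero_iff.2 h) _
  have abs_le : ∀ ω, |φ (Z ω) - φ Zt| ≤ ∑ i, ‖ψ i‖ * |f i (Z ω i) - f i (Zt i)| := fun ω => by
    have apply_eq : φ (Z ω) - φ Zt = ∑ i, ‖ψ i‖ * (f i (Z ω i) - f i (Zt i)) := by
      rw [← map_sub]
      conv_lhs => rw [← Finset.univ_sum_single (Z ω - Zt), map_sum]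
      refine Finset.sum_congr rfl fun i _ => ?_
      rw [← map_sub, ← smul_eq_mul, ← _root_.smul_apply, smul_f]
      rfl
    rw [apply_eq]
    refine (Finset.abs_sum_le_sum_abs _ _).trans_eq (Finset.sum_congr rfl fun i _ => ?_)
    rw [abs_mul, abs_norm]
  have tail : ∀ i (k : ℕ), μ {ω | (k + 1 : ℝ) * (t / 2) ≤ |f i (Z ω i) - f i (Zt i)|} ≤
      ENNReal.ofReal C * ENNReal.ofReal (Real.exp (-((k + 1 : ℝ) * u) ^ q)) := fun i k => by
    refine (hZ i (f i) (hf i) _ (by positivity)).trans_eq ?_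
    rw [← ENNReal.ofReal_mul (by linarith),
      show (k + 1 : ℝ) * (t / 2) / (c * σ) = (k + 1 : ℝ) * u by rw [hu]; field_simp]
  calc μ {ω | t ≤ |φ (Z ω) - φ Zt|}
      ≤ μ {ω | 2 * (t / 2) ≤ ∑ i, ‖ψ i‖ * |f i (Z ω i) - f i (Zt i)|} := by
        refine measure_mono fun ω hω => ?_
        have hω : t ≤ |φ (Z ω) - φ Zt| := hω
        show 2 * (t / 2) ≤ _
        linarith [abs_le ω]
    _ ≤ ∑' k : ℕ, ENNReal.ofReal C * ENNReal.ofReal (Real.exp (-((k + 1 : ℝ) * u) ^ q)) :=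
        measure_le_weighted_sum_le_tsum μ (fun i => norm_nonneg _)
          ((sum_norm_comp_single_le φ).trans hφ) (fun i ω => abs_nonneg _) (by positivity) tail
    _ ≤ ENNReal.ofReal C * ENNReal.ofReal (S * Real.exp (-(u ^ q / 2))) := by
        rw [ENNReal.tsum_mul_left]
        gcongr
        exact tsum_exp_neg_mul_rpow_le hq hu1
    _ ≤ ENNReal.ofReal ((C * S + Real.exp (1 / 2)) * Real.exp (-(u ^ q / 2))) := by
        rw [← ENNReal.ofReal_mul (by linarith), ← mul_assoc]
        gcongr
        exact le_add_of_nonneg_right (Real.exp_pos _).le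
end

section
/- Let E be a separable Banach space, (Z_n) a sequence of E-valued random vectors and Z an E-valued random vector such that the laws of the Z_n converge weakly to the law of Z. Let C ≥ 1, c > 0, q > 0, and let (σ_n) be positive reals converging to σ > 0. Assume that for every n, every 1-Lipschitz function f : E → ℝ and every t > 0, P(|f(Z_n) − f(Z_n′)| ≥ t) ≤ C·exp(−(t/(c·σ_n))^q), where Z_n′ is an independent copy of Z_n. Then for every 1-Lipschitz function f : E → ℝ and every t > 0, P(|f(Z) − f(Z′)| > t) ≤ C·exp(−(t/(c·σ))^q), where Z′ is an independent copy of Z. -/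
open MeasureTheory ProbabilityTheory ENNReal Filter

universe u v

/-- Weak convergence of the laws of `X n` to the law of `Y` passes to the laws of pairs of independent
copies. -/
theorem tendsto_law_pair_of_indep_copies {Ω : Type u} {E : Type v} [MeasurableSpace Ω]
    [TopologicalSpace E] [TopologicalSpace.PseudoMetrizableSpace E] [SecondCountableTopology E]
    [MeasurableSpace E] [BorelSpace E]
    (μ : ProbabilityMeasure Ω) {X X' : ℕ → Ω → E} {Y Y' : Ω → E}
    (hweak : ∀ f : BoundedContinuousFunction E ℝ,
      Tendsto (fun n => ∫ ω, f (X n ω) ∂μ) atTop (nhds (∫ ω, f (Y ω) ∂μ)))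
    (hX : ∀ n, IndepFun (X n) (X' n) μ) (hXX' : ∀ n, IdentDistrib (X n) (X' n) μ μ)
    (hY : IndepFun Y Y' μ) (hYY' : IdentDistrib Y Y' μ μ) :
    Tendsto (fun n => μ.map ((hXX' n).aemeasurable_fst.prodMk (hXX' n).aemeasurable_snd)) atTop
      (nhds (μ.map (hYY'.aemeasurable_fst.prodMk hYY'.aemeasurable_snd))) := by
  have map_pair {X X' : Ω → E} (hind : IndepFun X X' μ) (hid : IdentDistrib X X' μ μ) :
      μ.map (hid.aemeasurable_fst.prodMk hid.aemeasurable_snd) =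
        (μ.map hid.aemeasurable_fst).prod (μ.map hid.aemeasurable_fst) := by
    apply Subtype.ext
    change Measure.map _ _ = (Measure.map _ _).prod (Measure.map _ _)
    rw [(indepFun_iff_map_prod_eq_prod_map_map hid.aemeasurable_fst hid.aemeasurable_snd).1 hind,
      ← hid.map_eq]
  have law : Tendsto (fun n => μ.map (hXX' n).aemeasurable_fst) atTop
      (nhds (μ.map hYY'.aemeasurable_fst)) := by
    rw [ProbabilityMeasure.tendsto_iff_forall_integral_tendsto]
    intro f
    have hmap {X : Ω → E} (hX : AEMeasurable X μ) :
        ∫ x, f x ∂(μ.map hX : Measure E) = ∫ ω, f (X ω) ∂μ :=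
      integral_map hX f.continuous.measurable.aestronglyMeasurable
    simpa only [hmap] using hweak f
  simp only [map_pair (hX _) (hXX' _), map_pair hY hYY']
  exact (ProbabilityMeasure.continuous_prod.tendsto _).comp (law.prodMk_nhds law)

/-- The observable diameter of a limit in law of Lipschitz-concentrated random vectors is the
limit of the observable diameters. -/
theorem stmt4 {Ω : Type u} {E : Type v} [MeasurableSpace Ω]
    [NormedAddCommGroup E] [NormedSpace ℝ E] [CompleteSpace E]
    [TopologicalSpace.SeparableSpace E] [MeasurableSpace E] [BorelSpace E]
    (μ : Measure Ω) [IsProbabilityMeasure μ]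
    (Z : ℕ → Ω → E) (Zlim : Ω → E) (Z' : ℕ → Ω → E) (Zlim' : Ω → E)
    (C c q : ℝ) (hC : 1 ≤ C) (hc : 0 < c) (hq : 0 < q)
    (σ : ℕ → ℝ) (σlim : ℝ) (hσ : ∀ n, 0 < σ n) (hσlim : 0 < σlim)
    (hσtends : Tendsto σ atTop (nhds σlim))
    (hweak : ∀ f : BoundedContinuousFunction E ℝ,
      Tendsto (fun n => ∫ ω, f (Z n ω) ∂μ) atTop (nhds (∫ ω, f (Zlim ω) ∂μ)))
    (hind : ∀ n, IndepFun (Z n) (Z' n) μ)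
    (hid : ∀ n, IdentDistrib (Z n) (Z' n) μ μ)
    (hconc : ∀ n, ∀ f : E → ℝ, LipschitzWith 1 f → ∀ t : ℝ, 0 < t →
      μ {ω | t ≤ |f (Z n ω) - f (Z' n ω)|} ≤
        ENNReal.ofReal (C * Real.exp (-(t / (c * σ n)) ^ q)))
    (hind' : IndepFun Zlim Zlim' μ) (hid' : IdentDistrib Zlim Zlim' μ μ) :
    ∀ f : E → ℝ, LipschitzWith 1 f → ∀ t : ℝ, 0 < t →
      μ {ω | t < |f (Zlim ω) - f (Zlim' ω)|} ≤
        ENNReal.ofReal (C * Real.exp (-(t / (c * σlim)) ^ q)) := by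
  intro f hf t ht
  have hZ n := (hid n).aemeasurable_fst.prodMk (hid n).aemeasurable_snd
  have hZlim := hid'.aemeasurable_fst.prodMk hid'.aemeasurable_snd
  set G : Set (E × E) := {p | t < |f p.1 - f p.2|}
  have hG : IsOpen G :=
    isOpen_lt continuous_const
      ((hf.continuous.comp continuous_fst).sub (hf.continuous.comp continuous_snd)).abs
  have hbound : Tendsto (fun n => ENNReal.ofReal (C * Real.exp (-(t / (c * σ n)) ^ q))) atTop
      (nhds (ENNReal.ofReal (C * Real.exp (-(t / (c * σlim)) ^ q)))) := by
    have hdiv : Tendsto (fun n => t / (c * σ n)) atTop (nhds (t / (c * σlim))) :=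
      tendsto_const_nhds.div (hσtends.const_mul c) (mul_pos hc hσlim).ne'
    exact ENNReal.tendsto_ofReal
      ((hdiv.rpow_const (Or.inr hq.le)).neg.rexp.const_mul C)
  have hopen := ProbabilityMeasure.le_liminf_measure_open_of_tendsto
    (tendsto_law_pair_of_indep_copies ⟨μ, inferInstance⟩ hweak hind hid hind' hid') hG
  calc
    μ {ω | t < |f (Zlim ω) - f (Zlim' ω)|} = μ.map (fun ω => (Zlim ω, Zlim' ω)) G :=
      (Measure.map_apply_of_aemeasurable hZlim hG.measurableSet).symm
    _ ≤ liminf (fun n => μ.map (fun ω => (Z n ω, Z' n ω)) G) atTop := hopen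
    _ ≤ liminf (fun n => ENNReal.ofReal (C * Real.exp (-(t / (c * σ n)) ^ q))) atTop := by
      refine liminf_le_liminf (Eventually.of_forall fun n => ?_)
      rw [Measure.map_apply_of_aemeasurable (hZ n) hG.measurableSet]
      exact (measure_mono fun ω (hω : t < _) => hω.le).trans (hconc n f hf t ht)
    _ = _ := hbound.liminf_eq
end

section
/- Let p ≥ 2, let A be a nonzero real p×p matrix, let C ≥ 1, c > 0, K > 0, and let Z, W be random vectors in ℝ^p with ‖E[Z]‖ ≤ K·√(log p) and ‖E[W]‖ ≤ K·√(log p) (Euclidean norms). Assume the pair (Z,W) is convexly concentrated with exponent 2: for every quasi-convex function f : ℝ^p × ℝ^p → ℝ that is 1-Lipschitz for the norm ‖(z,w)‖ = max(‖z‖,‖w‖), and every t > 0, P(|f(Z,W) − E[f(Z,W)]| ≥ t) ≤ C·exp(−(t/c)²). Then there exist constants C′ ≥ 1 and c′ > 0 depending only on C, c and K such that for every t > 0, P(|ZᵀAW − E[ZᵀAW]| ≥ t) ≤ C′·exp(−t²/(c′·‖A‖_F²·log p)) + C′·exp(−t/(c′·‖A‖_F)). -/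
open MeasureTheory ProbabilityTheory ENNReal

universe u

section Tails

variable {Ω : Type*} [MeasurableSpace Ω] {μ : Measure Ω}

/-- The sum of a Gaussian tail of scale `N` and an exponential tail of scale `F`. -/
noncomputable def mixedTail (b N F t : ℝ) : ℝ :=
  Real.exp (-(t ^ 2 / (b * N ^ 2))) + Real.exp (-(t / (b * F)))

lemma mixedTail_nonneg (b N F t : ℝ) : 0 ≤ mixedTail b N F t := by
  unfold mixedTail; positivity

lemma mixedTail_anti {b N F s t : ℝ} (hb : 0 ≤ b) (hF : 0 ≤ F) (hs : 0 ≤ s) (hst : s ≤ t) :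
    mixedTail b N F t ≤ mixedTail b N F s := by
  unfold mixedTail; gcongr

lemma integrable_and_integral_le_of_exp_tail [IsFiniteMeasure μ] {X : Ω → ℝ} {C β : ℝ}
    (hC : 0 ≤ C) (hβ : 0 < β) (hX : AEMeasurable X μ) (h0 : ∀ ω, 0 ≤ X ω)
    (h : ∀ t, 0 < t → μ.real {ω | t ≤ X ω} ≤ C * Real.exp (-(t / β))) :
    Integrable X μ ∧ ∫ ω, X ω ∂μ ≤ C * β := by
  have hexp : ∀ t : ℝ, C * Real.exp (-(t / β)) = C * Real.exp ((-β⁻¹) * t) := fun t => by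
    congr 2; field_simp
  have hneg : -β⁻¹ < 0 := by simpa using hβ
  have hlin : ∫⁻ ω, ENNReal.ofReal (X ω) ∂μ ≤ ENNReal.ofReal (C * β) := by
    rw [lintegral_eq_lintegral_meas_le μ (.of_forall h0) hX]
    calc ∫⁻ t in Set.Ioi 0, μ {ω | t ≤ X ω}
        ≤ ∫⁻ t in Set.Ioi (0 : ℝ), ENNReal.ofReal (C * Real.exp ((-β⁻¹) * t)) := by
          refine setLIntegral_mono (by fun_prop) fun t ht => ?_
          rw [← ofReal_measureReal, ← hexp]
          exact ENNReal.ofReal_le_ofReal (h t ht)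
      _ = ENNReal.ofReal (C * β) := by
          rw [← ofReal_integral_eq_lintegral_ofReal
            ((integrableOn_exp_mul_Ioi hneg 0).const_mul C) (.of_forall fun t => by positivity),
            integral_const_mul, integral_exp_mul_Ioi hneg]
          simp
  have hint : Integrable X μ := by
    refine ⟨hX.aestronglyMeasurable, ?_⟩
    rw [hasFiniteIntegral_iff_ofReal (.of_forall h0)]
    exact hlin.trans_lt ENNReal.ofReal_lt_top
  refine ⟨hint, ?_⟩
  rw [integral_eq_lintegral_of_nonneg_ae (.of_forall h0) hX.aestronglyMeasurable]
  exact ENNReal.toReal_le_of_le_ofReal (by positivity) hlin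

lemma exists_forall_of_measureReal_compl_lt [IsProbabilityMeasure μ] {s t : Set Ω}
    (h : μ.real s + μ.real t < 1) : ∃ ω, ω ∉ s ∧ ω ∉ t := by
  by_contra! hcon
  have : s ∪ t = Set.univ := by
    ext ω; by_cases hω : ω ∈ s <;> simp [hω, hcon ω]
  have h1 := measureReal_union_le (μ := μ) s t
  rw [this, probReal_univ] at h1
  linarith

lemma one_le_three_mul_exp {C x : ℝ} (hC : 1 ≤ C) (hx : x ≤ 1) : 1 ≤ 3 * C * Real.exp (-x) := by
  have h1 : Real.exp (-1) ≤ Real.exp (-x) := Real.exp_le_exp.2 (by linarith)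
  have h2 : (0.3678794411 : ℝ) < Real.exp (-1) := by
    have := Real.exp_neg_one_gt_d9; norm_num at this ⊢; linarith
  nlinarith

/-- If `X` has mixed tails around centers that may depend on the level, then it is integrable and
has mixed tails around its mean. -/
lemma mixedTail_center [IsProbabilityMeasure μ] {X : Ω → ℝ} {C b N F : ℝ}
    (hC : 1 ≤ C) (hb : 1 ≤ b) (hF : 0 < F) (hFN : F ≤ 2 * N) (hX : AEMeasurable X μ)
    (h : ∀ t, 0 < t → ∃ a, μ.real {ω | t ≤ |X ω - a|} ≤ C * mixedTail b N F t) :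
    Integrable X μ ∧ ∀ t, 0 < t → μ.real {ω | t ≤ |X ω - ∫ ω', X ω' ∂μ|} ≤
      3 * C * mixedTail ((36 * C * b * (2 * b * Real.log (8 * C))) ^ 2) N F t := by
  set τ := 2 * b * Real.log (8 * C) with hτ
  have hN : 0 < N := by linarith
  have hlog : 1 ≤ Real.log (8 * C) := by
    rw [Real.le_log_iff_exp_le (by positivity)]
    have := Real.exp_one_lt_d9; norm_num at this; linarith
  have hτ2 : 2 ≤ τ := by nlinarith
  have hlin : ∀ t, τ * N ≤ t → mixedTail b N F t ≤ 2 * Real.exp (-(t / (2 * b * N))) := by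
    intro t ht
    have ht' : N ≤ t := by nlinarith
    have ht0 : 0 < t := by linarith
    have h1 : t / (2 * b * N) ≤ t ^ 2 / (b * N ^ 2) := by
      rw [div_le_div_iff₀ (by positivity) (by positivity)]
      nlinarith [mul_pos (mul_pos ht0 hN) (by linarith : 0 < b),
        mul_le_mul_of_nonneg_left ht' (by positivity : 0 ≤ t * N * b)]
    have h2 : t / (2 * b * N) ≤ t / (b * F) := by
      apply div_le_div_of_nonneg_left ht0.le (by positivity)
      nlinarith
    unfold mixedTail
    have := Real.exp_le_exp.2 (neg_le_neg h1)
    have := Real.exp_le_exp.2 (neg_le_neg h2)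
    linarith
  have hquarter : C * mixedTail b N F (τ * N) ≤ 1 / 4 := by
    have h1 := hlin (τ * N) le_rfl
    have h2 : τ * N / (2 * b * N) = Real.log (8 * C) := by rw [hτ]; field_simp
    rw [h2, Real.exp_neg, Real.exp_log (by positivity)] at h1
    calc C * mixedTail b N F (τ * N) ≤ C * (2 * (8 * C)⁻¹) := by gcongr
      _ = 1 / 4 := by field_simp; norm_num
  have hτN : 0 < τ * N := by positivity
  obtain ⟨a, ha⟩ := h (τ * N) hτN
  have hclose : ∀ t, τ * N ≤ t → μ.real {ω | 3 * t ≤ |X ω - a|} ≤ C * mixedTail b N F t := by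
    intro t ht
    obtain ⟨a', ha'⟩ := h t (by linarith)
    have hle : C * mixedTail b N F t ≤ 1 / 4 :=
      (mul_le_mul_of_nonneg_left (mixedTail_anti (by linarith) hF.le hτN.le ht)
        (by linarith)).trans hquarter
    obtain ⟨ω₀, h1, h2⟩ := exists_forall_of_measureReal_compl_lt
      (μ := μ) (s := {ω | τ * N ≤ |X ω - a|}) (t := {ω | t ≤ |X ω - a'|}) (by linarith)
    refine (measureReal_mono fun ω (hω : 3 * t ≤ |X ω - a|) => ?_).trans ha'
    simp only [Set.mem_ofPred_eq, not_le, abs_lt] at h1 h2 ⊢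
    rw [le_abs] at hω ⊢
    rcases hω with hω | hω
    · left; linarith
    · right; linarith
  set β := 2 * b * τ * N with hβ
  have hβ0 : 0 < β := by positivity
  have hexp : ∀ t, 0 < t → μ.real {ω | t ≤ |X ω - a|} ≤ 3 * C * Real.exp (-(t / (3 * β))) := by
    intro t ht
    rcases lt_or_ge t (3 * (τ * N)) with hlt | hge
    · refine measureReal_le_one.trans (one_le_three_mul_exp hC ?_)
      rw [div_le_one (by positivity)]
      nlinarith
    · have h1 := hclose (t / 3) (by linarith)
      have h2 := hlin (t / 3) (by linarith)
      rw [mul_div_cancel₀ _ (by norm_num : (3 : ℝ) ≠ 0)] at h1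
      have h3 : t / (3 * β) ≤ t / 3 / (2 * b * N) := by
        rw [div_div]
        apply div_le_div_of_nonneg_left ht.le (by positivity)
        have : 2 * b * N * 1 ≤ 2 * b * N * τ := by gcongr; linarith
        linarith
      have h4 := Real.exp_le_exp.2 (neg_le_neg h3)
      calc _ ≤ C * mixedTail b N F (t / 3) := h1
        _ ≤ C * (3 * Real.exp (-(t / (3 * β)))) := by
          gcongr
          have := Real.exp_pos (-(t / (3 * β)))
          linarith
        _ = _ := by ring
  obtain ⟨hint, hmean⟩ := integrable_and_integral_le_of_exp_tail (by positivity) (by positivity)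
    (hX.sub_const a).abs (fun ω => abs_nonneg _) hexp
  have hint' : Integrable (fun ω => X ω - a) μ :=
    (integrable_norm_iff (hX.sub_const a).aestronglyMeasurable).1 hint
  have hXint : Integrable X μ := 
    (hint'.add (integrable_const a)).congr (.of_forall fun ω => by simp)
  refine ⟨hXint, fun t ht => ?_⟩
  set m := ∫ ω', X ω' ∂μ with hm
  have hma : |m - a| ≤ 18 * C * b * τ * N := by
    have h1 : m - a = ∫ ω, (X ω - a) ∂μ := by
      rw [integral_sub hXint (integrable_const a)]; simp [hm]
    rw [h1]
    refine (abs_integral_le_integral_abs).trans (hmean.trans (le_of_eq ?_))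
    rw [hβ]; ring
  rcases lt_or_ge t (36 * C * b * τ * N) with hlt | hge
  · refine measureReal_le_one.trans ?_
    have : t ^ 2 / ((36 * C * b * τ) ^ 2 * N ^ 2) ≤ 1 := by
      rw [div_le_one (by positivity), ← mul_pow]
      gcongr
    refine (one_le_three_mul_exp hC this).trans ?_
    unfold mixedTail
    gcongr
    have := Real.exp_pos (-(t / ((36 * C * b * τ) ^ 2 * F)))
    linarith
  · have hCb : 1 ≤ C * b := by nlinarith
    have hge' : 36 * (τ * N) ≤ t := by
      have : 36 * (τ * N) * 1 ≤ 36 * (τ * N) * (C * b) := by gcongr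
      linarith
    have h1 := hclose (t / 6) (by linarith)
    refine (measureReal_mono fun ω (hω : t ≤ |X ω - m|) => ?_).trans (h1.trans ?_)
    · have := abs_sub_le (X ω) a m
      rw [abs_sub_comm a m] at this
      simp only [Set.mem_ofPred_eq]
      linarith
    · have hD : 36 * b ≤ (36 * C * b * τ) ^ 2 := by
        have h2 : 1 ≤ C * τ := by nlinarith
        have h3 : 36 * b * 1 ≤ 36 * b * (C * τ) := by gcongr
        have h4 : 1 ≤ 36 * C * b * τ := by nlinarith
        nlinarith
      have e1 : t ^ 2 / ((36 * C * b * τ) ^ 2 * N ^ 2) ≤ (t / 6) ^ 2 / (b * N ^ 2) := by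
        have : (t / 6) ^ 2 / (b * N ^ 2) = t ^ 2 / (36 * b * N ^ 2) := by field_simp; norm_num
        rw [this]
        gcongr
      have e2 : t / ((36 * C * b * τ) ^ 2 * F) ≤ (t / 6) / (b * F) := by
        rw [div_div]
        apply div_le_div_of_nonneg_left ht.le (by positivity)
        nlinarith
      have e : mixedTail b N F (t / 6) ≤ mixedTail ((36 * C * b * τ) ^ 2) N F t := by
        unfold mixedTail; gcongr
      have := mixedTail_nonneg ((36 * C * b * τ) ^ 2) N F t
      nlinarith
end Tails

section Diagonal

variable {ι : Type*}

/-- The diagonal operator with entries `l`. -/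
noncomputable def diagMap (l : ι → ℝ) : EuclideanSpace ℝ ι →ₗ[ℝ] EuclideanSpace ℝ ι where
  toFun x := WithLp.toLp 2 fun k => l k * x k
  map_add' x y := by ext k; simp [mul_add]
  map_smul' r x := by ext k; simp; ring

@[simp]
lemma diagMap_apply (l : ι → ℝ) (x : EuclideanSpace ℝ ι) (k : ι) :
    diagMap l x k = l k * x k := rfl

variable [Fintype ι]

lemma norm_diagMap_sq (l : ι → ℝ) (x : EuclideanSpace ℝ ι) :
    ‖diagMap l x‖ ^ 2 = ∑ k, l k ^ 2 * x k ^ 2 := by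
  simp [EuclideanSpace.norm_sq_eq, mul_pow]

lemma inner_diagMap (l : ι → ℝ) (x y : EuclideanSpace ℝ ι) :
    inner ℝ (diagMap l x) y = ∑ k, l k * (x k * y k) := by
  simp only [PiLp.inner_apply, diagMap_apply, RCLike.inner_apply, conj_trivial]
  exact Finset.sum_congr rfl fun k _ => by ring

lemma norm_diagMap_le {l : ι → ℝ} {F : ℝ} (hF : 0 ≤ F) (hl : ∑ k, l k ^ 2 ≤ F ^ 2)
    (x : EuclideanSpace ℝ ι) : ‖diagMap l x‖ ≤ F * ‖x‖ := by
  refine abs_le_of_sq_le_sq' ?_ (by positivity) |>.2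
  rw [norm_diagMap_sq, mul_pow, EuclideanSpace.norm_sq_eq, Finset.mul_sum]
  refine Finset.sum_le_sum fun k _ => ?_
  rw [Real.norm_eq_abs, sq_abs]
  exact mul_le_mul_of_nonneg_right ((Finset.single_le_sum (f := fun k => l k ^ 2)
    (fun _ _ => sq_nonneg _) (Finset.mem_univ k)).trans hl) (sq_nonneg _)

lemma inner_diagMap_sub_nonneg {l : ι → ℝ} (hl : ∀ k, 0 ≤ l k) (x y : EuclideanSpace ℝ ι) :
    2 * inner ℝ (diagMap l y) x - inner ℝ (diagMap l y) y ≤ inner ℝ (diagMap l x) x := by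
  simp only [inner_diagMap, Finset.mul_sum, ← Finset.sum_sub_distrib]
  refine Finset.sum_le_sum fun k _ => ?_
  nlinarith [mul_nonneg (hl k) (sq_nonneg (x k - y k))]

/-- The quadratic form of a nonnegative diagonal operator agrees, where its gradient is small, with
a convex Lipschitz function. -/
lemma exists_convexOn_lipschitzWith_eq_inner_diagMap {l : ι → ℝ} (hl : ∀ k, 0 ≤ l k) {B : ℝ}
    (hB : 0 ≤ B) :
    ∃ ψ : EuclideanSpace ℝ ι → ℝ, ConvexOn ℝ Set.univ ψ ∧
      LipschitzWith (Real.toNNReal (2 * B)) ψ ∧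
      ∀ x, ‖diagMap l x‖ ≤ B → ψ x = inner ℝ (diagMap l x) x := by
  let S := {y : EuclideanSpace ℝ ι // ‖diagMap l y‖ ≤ B}
  let a : EuclideanSpace ℝ ι → S → ℝ := fun x y =>
    2 * inner ℝ (diagMap l y.1) x - inner ℝ (diagMap l y.1) y.1
  have : Nonempty S := ⟨⟨0, by simpa using hB⟩⟩
  have hbdd : ∀ x, BddAbove (Set.range (a x)) := fun x =>
    ⟨inner ℝ (diagMap l x) x, by rintro _ ⟨y, rfl⟩; exact inner_diagMap_sub_nonneg hl x y.1⟩
  refine ⟨fun x => ⨆ y, a x y, ⟨convex_univ, ?_⟩, ?_, ?_⟩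
  · intro x _ y _ r s hr hs hrs
    refine ciSup_le fun w => ?_
    have h1 := mul_le_mul_of_nonneg_left (le_ciSup (hbdd x) w) hr
    have h2 := mul_le_mul_of_nonneg_left (le_ciSup (hbdd y) w) hs
    have h3 : a (r • x + s • y) w = r * a x w + s * a y w := by
      simp only [a, inner_add_right, inner_smul_right]
      linear_combination (-(inner ℝ (diagMap l w.1) w.1)) * (-hrs)
    rw [h3]
    exact add_le_add h1 h2
  · refine LipschitzWith.of_le_add_mul _ fun x y => ciSup_le fun w => ?_
    have h1 := le_ciSup (hbdd y) w
    have h2 : a x w = a y w + 2 * inner ℝ (diagMap l w.1) (x - y) := by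
      simp only [a, inner_sub_right]; ring
    have h3 : inner ℝ (diagMap l w.1) (x - y) ≤ B * ‖x - y‖ :=
      (real_inner_le_norm _ _).trans (by gcongr; exact w.2)
    rw [Real.coe_toNNReal _ (by positivity), dist_eq_norm]
    linarith
  · intro x hx
    refine le_antisymm (ciSup_le fun w => inner_diagMap_sub_nonneg hl x w.1) ?_
    refine le_trans (le_of_eq ?_) (le_ciSup (hbdd x) ⟨x, hx⟩)
    simp only [a]; ring

lemma convexOn_norm_diagMap (l : ι → ℝ) : ConvexOn ℝ Set.univ fun x => ‖diagMap l x‖ :=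
  (convexOn_univ_norm (E := EuclideanSpace ℝ ι)).comp_linearMap (diagMap l)

lemma lipschitzWith_norm_diagMap {l : ι → ℝ} {F : ℝ} (hF : 0 ≤ F) (hl : ∑ k, l k ^ 2 ≤ F ^ 2) :
    LipschitzWith F.toNNReal fun x => ‖diagMap l x‖ := by
  refine LipschitzWith.of_le_add_mul _ fun x y => ?_
  have h1 := norm_diagMap_le hF hl (x - y)
  rw [map_sub] at h1
  have h2 := norm_sub_norm_le (diagMap l x) (diagMap l y)
  rw [Real.coe_toNNReal _ hF, dist_eq_norm]
  linarith

end Diagonal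

section Concentration

variable {Ω : Type*} [MeasurableSpace Ω] {μ : Measure Ω}

/-- Gaussian concentration of all convex `1`-Lipschitz functions of `Y`. -/
def ConvexlyConcentrated {E : Type*} [NormedAddCommGroup E] [NormedSpace ℝ E]
    (μ : Measure Ω) (Y : Ω → E) (C c : ℝ) : Prop :=
  ∀ f : E → ℝ, ConvexOn ℝ Set.univ f → LipschitzWith 1 f →
    Integrable (fun ω => f (Y ω)) μ ∧ ∀ t : ℝ, 0 < t →
      μ.real {ω | t ≤ |f (Y ω) - ∫ ω', f (Y ω') ∂μ|} ≤ C * Real.exp (-(t / c) ^ 2)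

namespace ConvexlyConcentrated

section

variable {E E' : Type*} [NormedAddCommGroup E] [NormedSpace ℝ E]
  [NormedAddCommGroup E'] [NormedSpace ℝ E'] {Y : Ω → E} {C c : ℝ}

lemma of_lipschitzWith (hY : ConvexlyConcentrated μ Y C c) {r : ℝ} (hr : 0 < r) {f : E → ℝ}
    (hf : ConvexOn ℝ Set.univ f) (hlip : LipschitzWith r.toNNReal f) :
    Integrable (fun ω => f (Y ω)) μ ∧ ∀ t : ℝ, 0 < t →
      μ.real {ω | t ≤ |f (Y ω) - ∫ ω', f (Y ω') ∂μ|} ≤ C * Real.exp (-(t / (c * r)) ^ 2) := by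
  have h1 : LipschitzWith 1 fun x => r⁻¹ * f x := by
    refine LipschitzWith.of_le_add_mul _ fun x y => ?_
    have h2 := hlip.le_add_mul x y
    rw [Real.coe_toNNReal _ hr.le] at h2
    have h3 := mul_le_mul_of_nonneg_left h2 (inv_pos.2 hr).le
    rw [mul_add, inv_mul_cancel_left₀ hr.ne'] at h3
    simpa using h3
  obtain ⟨hi, ht⟩ := hY _ (hf.smul (inv_pos.2 hr).le) h1
  refine ⟨(hi.const_mul r).congr (.of_forall fun ω => by simp [hr.ne']), fun t t0 => ?_⟩
  have h2 := ht (t / r) (by positivity)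
  have h3 : t / r / c = t / (c * r) := by rw [div_div, mul_comm]
  rw [h3] at h2
  convert h2 using 4 with ω
  have : ∫ ω', r⁻¹ • f (Y ω') ∂μ = r⁻¹ * ∫ ω', f (Y ω') ∂μ := integral_const_mul _ _
  rw [this, smul_eq_mul, ← mul_sub, abs_mul, abs_of_pos (inv_pos.2 hr), inv_mul_eq_div,
    div_le_div_iff_of_pos_right hr]

lemma comp_continuousLinearMap (hY : ConvexlyConcentrated μ Y C c) (T : E →L[ℝ] E') {r : ℝ}
    (hr : 0 < r) (hT : ∀ x, ‖T x‖ ≤ r * ‖x‖) :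
    ConvexlyConcentrated μ (fun ω => T (Y ω)) C (c * r) := by
  intro f hf hlip
  refine hY.of_lipschitzWith hr (f := fun x => f (T x)) (hf.comp_linearMap T.toLinearMap) ?_
  refine LipschitzWith.of_le_add_mul _ fun x y => ?_
  have h1 := hlip.le_add_mul (T x) (T y)
  have h2 := hT (x - y)
  rw [map_sub] at h2
  rw [dist_eq_norm] at h1 ⊢
  rw [Real.coe_toNNReal _ hr.le]
  simp only [NNReal.coe_one, one_mul] at h1
  linarith

end

variable {ι : Type*} [Fintype ι] {Y : Ω → EuclideanSpace ℝ ι} {C c : ℝ}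

lemma apply (hY : ConvexlyConcentrated μ Y C c) (k : ι) :
    Integrable (fun ω => Y ω k) μ ∧ ∀ t : ℝ, 0 < t →
      μ.real {ω | t ≤ |Y ω k - ∫ ω', Y ω' k ∂μ|} ≤ C * Real.exp (-(t / c) ^ 2) := by
  refine hY (fun x => x k) ((EuclideanSpace.proj k : _ →L[ℝ] ℝ).toLinearMap.convexOn convex_univ) ?_
  refine LipschitzWith.of_le_add_mul _ fun x y => ?_
  have h1 := PiLp.norm_apply_le (x - y) k
  rw [PiLp.sub_apply, Real.norm_eq_abs] at h1
  have h2 := le_abs_self (x k - y k)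
  simp only [NNReal.coe_one, one_mul, dist_eq_norm]
  linarith

lemma aemeasurable_inner_diagMap (hY : ConvexlyConcentrated μ Y C c) (l : ι → ℝ) :
    AEMeasurable (fun ω => inner ℝ (diagMap l (Y ω)) (Y ω)) μ := by
  simp_rw [inner_diagMap]
  refine Finset.aemeasurable_fun_sum _ fun k _ => ?_
  have := (hY.apply k).1.aemeasurable
  fun_prop

variable [IsProbabilityMeasure μ]

lemma sq_apply (hY : ConvexlyConcentrated μ Y C c) (hC : 0 ≤ C) (hc : 0 < c) (k : ι) :
    Integrable (fun ω => Y ω k ^ 2) μ ∧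
      ∫ ω, Y ω k ^ 2 ∂μ ≤ C * c ^ 2 + (∫ ω, Y ω k ∂μ) ^ 2 := by
  obtain ⟨hi, ht⟩ := hY.apply k
  set m := ∫ ω, Y ω k ∂μ with hm
  obtain ⟨h1, h2⟩ := integrable_and_integral_le_of_exp_tail (μ := μ) (C := C) (β := c ^ 2)
    (X := fun ω => (Y ω k - m) ^ 2) hC (by positivity)
    ((hi.aemeasurable.sub_const m).pow_const 2) (fun ω => sq_nonneg _) fun t t0 => by
      have h := ht (√t) (Real.sqrt_pos.2 t0)
      rw [div_pow, Real.sq_sqrt t0.le] at h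
      convert h using 4 with ω
      rw [Real.sqrt_le_left (abs_nonneg _), sq_abs]
  have h3 : ∀ ω, Y ω k ^ 2 = (Y ω k - m) ^ 2 + (2 * m * Y ω k - m ^ 2) := fun ω => by ring
  have h4 : Integrable (fun ω => 2 * m * Y ω k - m ^ 2) μ :=
    (hi.const_mul _).sub (integrable_const _)
  simp_rw [h3]
  refine ⟨h1.add h4, ?_⟩
  rw [integral_add h1 h4, integral_sub (hi.const_mul _) (integrable_const _), integral_const_mul,
    ← hm]
  simp only [integral_const, probReal_univ, one_smul]
  nlinarith

lemma integral_norm_diagMap_le (hY : ConvexlyConcentrated μ Y C c) (hC : 0 ≤ C) (hc : 0 < c)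
    {l : ι → ℝ} {F V M : ℝ} (hF : 0 < F) (hlF : ∑ k, l k ^ 2 ≤ F ^ 2)
    (hmean : ∑ k, (∫ ω, Y ω k ∂μ) ^ 2 ≤ V) (hM : 0 < M)
    (hMV : F ^ 2 * (C * c ^ 2 + V) ≤ M ^ 2) :
    ∫ ω, ‖diagMap l (Y ω)‖ ∂μ ≤ M := by
  have hg := (hY.of_lipschitzWith hF (convexOn_norm_diagMap l)
    (lipschitzWith_norm_diagMap hF.le hlF)).1
  have hint : ∀ k ∈ Finset.univ, Integrable (fun ω => l k ^ 2 * Y ω k ^ 2) μ := fun k _ =>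
    (hY.sq_apply hC hc k).1.const_mul _
  have hsq : ∫ ω, ‖diagMap l (Y ω)‖ ^ 2 ∂μ ≤ M ^ 2 := by
    simp_rw [norm_diagMap_sq]
    rw [integral_finsetSum _ hint]
    calc ∑ k, ∫ ω, l k ^ 2 * Y ω k ^ 2 ∂μ
        ≤ ∑ k, (l k ^ 2 * (C * c ^ 2) + F ^ 2 * (∫ ω, Y ω k ∂μ) ^ 2) := by
          refine Finset.sum_le_sum fun k _ => ?_
          rw [integral_const_mul]
          have h1 : l k ^ 2 ≤ F ^ 2 := (Finset.single_le_sum (f := fun k => l k ^ 2)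
            (fun _ _ => sq_nonneg _) (Finset.mem_univ k)).trans hlF
          have h2 := mul_le_mul_of_nonneg_left (hY.sq_apply hC hc k).2 (sq_nonneg (l k))
          have h3 := mul_le_mul_of_nonneg_right h1 (sq_nonneg (∫ ω, Y ω k ∂μ))
          linarith
      _ = (∑ k, l k ^ 2) * (C * c ^ 2) + F ^ 2 * ∑ k, (∫ ω, Y ω k ∂μ) ^ 2 := by
          rw [Finset.sum_add_distrib, Finset.sum_mul, Finset.mul_sum]
      _ ≤ F ^ 2 * (C * c ^ 2) + F ^ 2 * V := by gcongr
      _ ≤ M ^ 2 := by linarith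
  have hint2 : Integrable (fun ω => ‖diagMap l (Y ω)‖ ^ 2) μ := by
    simp_rw [norm_diagMap_sq]
    exact integrable_finsetSum _ hint
  have h1 : ∫ ω, 2 * M * ‖diagMap l (Y ω)‖ ∂μ ≤ ∫ ω, (‖diagMap l (Y ω)‖ ^ 2 + M ^ 2) ∂μ :=
    integral_mono (hg.const_mul _) (hint2.add (integrable_const _)) fun ω => by
      have := sq_nonneg (‖diagMap l (Y ω)‖ - M)
      simp only
      linarith
  rw [integral_const_mul, integral_add hint2 (integrable_const _)] at h1
  simp only [integral_const, probReal_univ, one_smul] at h1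
  nlinarith

/-- A nonnegative diagonal quadratic form of a convexly concentrated vector has mixed tails around
suitable centers. -/
lemma exists_mixedTail_inner_diagMap (hY : ConvexlyConcentrated μ Y C c) (hC : 0 ≤ C)
    (hc : 0 < c) {l : ι → ℝ} (hl : ∀ k, 0 ≤ l k) {F M N b : ℝ} (hF : 0 < F)
    (hlF : ∑ k, l k ^ 2 ≤ F ^ 2) (hM : 0 < M) (hgM : ∫ ω, ‖diagMap l (Y ω)‖ ∂μ ≤ M)
    (hN : 0 < N) (hb : 16 * c ^ 2 ≤ b) (hMN : 16 * c ^ 2 * M ^ 2 ≤ b * N ^ 2) {t : ℝ}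
    (ht : 0 < t) :
    ∃ a, μ.real {ω | t ≤ |inner ℝ (diagMap l (Y ω)) (Y ω) - a|} ≤
      2 * C * mixedTail b N F t := by
  have hb0 : 0 < b := lt_of_lt_of_le (by positivity) hb
  set s := √(t * F) with hs
  have hs0 : 0 < s := Real.sqrt_pos.2 (by positivity)
  have hs2 : s ^ 2 = t * F := Real.sq_sqrt (by positivity)
  set B := M + s with hB
  have hB0 : 0 < B := by positivity
  obtain ⟨ψ, hψc, hψl, hψ⟩ := exists_convexOn_lipschitzWith_eq_inner_diagMap hl hB0.le
  have hg := (hY.of_lipschitzWith hF (convexOn_norm_diagMap l)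
    (lipschitzWith_norm_diagMap hF.le hlF)).2 s hs0
  have hψt := (hY.of_lipschitzWith (by positivity) hψc hψl).2 t ht
  set a := ∫ ω, ψ (Y ω) ∂μ
  set m := ∫ ω, ‖diagMap l (Y ω)‖ ∂μ
  refine ⟨a, ?_⟩
  have hsub : {ω | t ≤ |inner ℝ (diagMap l (Y ω)) (Y ω) - a|} ⊆
      {ω | s ≤ |‖diagMap l (Y ω)‖ - m|} ∪ {ω | t ≤ |ψ (Y ω) - a|} := by
    intro ω hω
    by_cases h : s ≤ |‖diagMap l (Y ω)‖ - m|
    · exact Or.inl h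
    · refine Or.inr ?_
      have h1 := (abs_lt.1 (not_le.1 h)).2
      change t ≤ |ψ (Y ω) - a|
      rw [hψ _ (by linarith)]
      exact hω
  have e1 : Real.exp (-(s / (c * F)) ^ 2) ≤ mixedTail b N F t := by
    have h1 : (s / (c * F)) ^ 2 = t / (c ^ 2 * F) := by
      rw [div_pow, hs2]; field_simp
    have h2 : t / (b * F) ≤ t / (c ^ 2 * F) := by
      apply div_le_div_of_nonneg_left ht.le (by positivity)
      gcongr
      nlinarith [sq_nonneg c]
    rw [h1]
    have h3 := Real.exp_le_exp.2 (neg_le_neg h2)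
    have h4 := Real.exp_pos (-(t ^ 2 / (b * N ^ 2)))
    unfold mixedTail
    linarith
  have e2 : Real.exp (-(t / (c * (2 * B))) ^ 2) ≤ mixedTail b N F t := by
    have h1 : (t / (c * (2 * B))) ^ 2 = t ^ 2 / (4 * c ^ 2 * B ^ 2) := by
      rw [div_pow]; ring
    have hB2 : B ^ 2 ≤ 2 * M ^ 2 + 2 * (t * F) := by
      nlinarith [sq_nonneg (M - s)]
    rw [h1]
    have p1 := Real.exp_pos (-(t ^ 2 / (b * N ^ 2)))
    have p2 := Real.exp_pos (-(t / (b * F)))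
    unfold mixedTail
    rcases le_total (t * F) (M ^ 2) with h | h
    · have h2 : t ^ 2 / (b * N ^ 2) ≤ t ^ 2 / (4 * c ^ 2 * B ^ 2) := by
        apply div_le_div_of_nonneg_left (by positivity) (by positivity)
        nlinarith [sq_nonneg c]
      have h3 := Real.exp_le_exp.2 (neg_le_neg h2)
      linarith
    · have h2 : t / (b * F) ≤ t ^ 2 / (4 * c ^ 2 * B ^ 2) := by
        rw [div_le_div_iff₀ (by positivity) (by positivity)]
        have h3 : 4 * c ^ 2 * B ^ 2 ≤ 4 * c ^ 2 * (4 * (t * F)) := by gcongr; linarith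
        have h4 : 16 * c ^ 2 * (t * F) ≤ b * (t * F) := by gcongr
        nlinarith
      have h3 := Real.exp_le_exp.2 (neg_le_neg h2)
      linarith
  calc _ ≤ _ := measureReal_mono hsub
    _ ≤ _ := measureReal_union_le _ _
    _ ≤ C * Real.exp (-(s / (c * F)) ^ 2) + C * Real.exp (-(t / (c * (2 * B))) ^ 2) :=
      add_le_add hg hψt
    _ ≤ C * mixedTail b N F t + C * mixedTail b N F t := by gcongr
    _ = _ := by ring

end ConvexlyConcentrated

end Concentration

/-- Hanson–Wright inequality for nonnegative diagonal quadratic forms under convex concentration. -/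
lemma exists_mixedTail_diagonal (C c K : ℝ) (hC : 1 ≤ C) (hc : 0 < c) :
    ∃ C' b : ℝ, 1 ≤ C' ∧ 0 < b ∧
      ∀ {Ω : Type u} [MeasurableSpace Ω] {μ : Measure Ω} [IsProbabilityMeasure μ] {ι : Type}
        [Fintype ι] {Y : Ω → EuclideanSpace ℝ ι} {l : ι → ℝ} {F L : ℝ},
        ConvexlyConcentrated μ Y C c → (∀ k, 0 ≤ l k) → 0 < F → ∑ k, l k ^ 2 ≤ F ^ 2 →
        1 / 2 ≤ L → ∑ k, (∫ ω, Y ω k ∂μ) ^ 2 ≤ K ^ 2 * L →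
        Integrable (fun ω => inner ℝ (diagMap l (Y ω)) (Y ω)) μ ∧ ∀ t, 0 < t →
          μ.real {ω | t ≤ |inner ℝ (diagMap l (Y ω)) (Y ω) -
            ∫ ω', inner ℝ (diagMap l (Y ω')) (Y ω') ∂μ|} ≤ C' * mixedTail b (F * √L) F t := by
  set κ := 1 + 2 * C * c ^ 2 + K ^ 2 + 1 / c ^ 2 with hκ
  have hκ1 : 1 ≤ κ := by rw [hκ]; nlinarith [(by positivity : 0 ≤ 2 * C * c ^ 2 + K ^ 2 + 1 / c ^ 2)]
  have hκc : 1 ≤ c ^ 2 * κ := by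
    have h1 : c ^ 2 * κ = c ^ 2 * (1 + 2 * C * c ^ 2 + K ^ 2) + 1 := by rw [hκ]; field_simp
    rw [h1]
    have : 0 ≤ c ^ 2 * (1 + 2 * C * c ^ 2 + K ^ 2) := by positivity
    linarith
  set b := 16 * c ^ 2 * κ with hb
  have hb1 : 1 ≤ b := by linarith
  have hlog : 0 < Real.log (8 * (2 * C)) := Real.log_pos (by linarith)
  refine ⟨3 * (2 * C), (36 * (2 * C) * b * (2 * b * Real.log (8 * (2 * C)))) ^ 2, by linarith,
    by positivity, ?_⟩
  intro Ω _ μ _ ι _ Y l F L hY hl hF hlF hL hmean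
  have hL0 : 0 < L := by linarith
  have hsL : √L ^ 2 = L := Real.sq_sqrt hL0.le
  have hsL0 : 0 < √L := Real.sqrt_pos.2 hL0
  have hsκ : √κ ^ 2 = κ := Real.sq_sqrt (by linarith)
  have hsκ0 : 0 < √κ := Real.sqrt_pos.2 (by linarith)
  have hM2 : (√κ * F * √L) ^ 2 = F ^ 2 * (κ * L) := by rw [mul_pow, mul_pow, hsκ, hsL]; ring
  have hgM := hY.integral_norm_diagMap_le (by linarith) hc hF hlF hmean
    (M := √κ * F * √L) (by positivity) (by
      rw [hM2]
      gcongr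
      have : κ * L = C * c ^ 2 * (2 * L) + K ^ 2 * L + (1 + 1 / c ^ 2) * L := by rw [hκ]; ring
      have h1 : C * c ^ 2 * 1 ≤ C * c ^ 2 * (2 * L) := by gcongr; linarith
      have h2 : 0 ≤ (1 + 1 / c ^ 2) * L := by positivity
      linarith)
  refine mixedTail_center (by linarith) hb1 hF ?_ (hY.aemeasurable_inner_diagMap l) fun t ht =>
    hY.exists_mixedTail_inner_diagMap (by linarith) hc hl hF hlF (by positivity) hgM
      (by positivity) ?_ ?_ ht
  · have : 1 / 2 ≤ √L := Real.le_sqrt_of_sq_le (by linarith)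
    nlinarith
  · rw [hb]; nlinarith [sq_nonneg c]
  · rw [hM2, hb, mul_pow, hsL]; exact le_of_eq (by ring)

section BilinearForm

open Matrix in
/-- Orthogonal diagonalization of the quadratic form of a real symmetric matrix. -/
lemma exists_diagonalization {ι : Type*} [Fintype ι] {S : Matrix ι ι ℝ} (hS : S.IsHermitian) :
    ∃ (U : EuclideanSpace ℝ ι ≃ₗᵢ[ℝ] EuclideanSpace ℝ ι) (l : ι → ℝ),
      ∑ k, l k ^ 2 = ∑ i, ∑ j, S i j ^ 2 ∧
      ∀ x : EuclideanSpace ℝ ι, ∑ i, ∑ j, x i * S i j * x j = ∑ k, l k * U x k ^ 2 := by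
  classical
  set u := hS.eigenvectorBasis
  set l := hS.eigenvalues
  let r : ι → EuclideanSpace ℝ ι := fun i => WithLp.toLp 2 (S i)
  have hr : ∀ i (x : EuclideanSpace ℝ ι), inner ℝ (r i) x = ∑ j, S i j * x j := fun i x => by
    simp [r, PiLp.inner_apply, mul_comm]
  have hru : ∀ i k, inner ℝ (r i) (u k) = l k * u k i := fun i k => by
    rw [hr]
    exact congrFun (hS.mulVec_eigenvectorBasis k) i
  refine ⟨u.repr, l, ?_, fun x => ?_⟩
  · have hu : ∀ k, ∑ i, u k i ^ 2 = 1 := fun k => by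
      have h := EuclideanSpace.norm_sq_eq (u k)
      rw [u.norm_eq_one] at h
      simpa using h.symm
    calc ∑ k, l k ^ 2 = ∑ k, ∑ i, inner ℝ (r i) (u k) ^ 2 := by
          refine Finset.sum_congr rfl fun k _ => ?_
          simp_rw [hru, mul_pow]
          rw [← Finset.mul_sum, hu, mul_one]
      _ = ∑ i, ∑ k, inner ℝ (r i) (u k) ^ 2 := Finset.sum_comm
      _ = ∑ i, ∑ j, S i j ^ 2 := by
          refine Finset.sum_congr rfl fun i _ => ?_
          have h := u.sum_sq_norm_inner_left (r i)
          rw [EuclideanSpace.norm_sq_eq] at h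
          simpa [r] using h
  · have hx : ∀ k, u.repr x k = ∑ i, u k i * x i := fun k => by
      rw [u.repr_apply_apply, PiLp.inner_apply]
      simp [mul_comm]
    calc ∑ i, ∑ j, x i * S i j * x j = ∑ i, x i * inner ℝ (r i) x := by
          simp_rw [hr, Finset.mul_sum, mul_assoc]
      _ = ∑ i, ∑ k, l k * u.repr x k * (u k i * x i) := by
          refine Finset.sum_congr rfl fun i _ => ?_
          rw [← u.sum_inner_mul_inner, Finset.mul_sum]
          refine Finset.sum_congr rfl fun k _ => ?_
          rw [hru, u.repr_apply_apply]
          ring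
      _ = ∑ k, l k * u.repr x k ^ 2 := by
          rw [Finset.sum_comm]
          refine Finset.sum_congr rfl fun k _ => ?_
          rw [← Finset.mul_sum, ← hx]
          ring

/-- Concatenation of two Euclidean vectors. -/
noncomputable def euclideanConcat (m n : Type*) :
    EuclideanSpace ℝ m × EuclideanSpace ℝ n →ₗ[ℝ] EuclideanSpace ℝ (m ⊕ n) where
  toFun x := WithLp.toLp 2 (Sum.elim x.1 x.2)
  map_add' x y := by ext (i | i) <;> simp
  map_smul' r x := by ext (i | i) <;> simp

variable {m n : Type*}

@[simp]
lemma euclideanConcat_inl (x : EuclideanSpace ℝ m × EuclideanSpace ℝ n) (i : m) :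
    euclideanConcat m n x (Sum.inl i) = x.1 i := rfl

@[simp]
lemma euclideanConcat_inr (x : EuclideanSpace ℝ m × EuclideanSpace ℝ n) (j : n) :
    euclideanConcat m n x (Sum.inr j) = x.2 j := rfl

variable [Fintype m] [Fintype n]

lemma norm_euclideanConcat_le (x : EuclideanSpace ℝ m × EuclideanSpace ℝ n) :
    ‖euclideanConcat m n x‖ ≤ 2 * ‖x‖ := by
  refine abs_le_of_sq_le_sq' ?_ (by positivity) |>.2
  have h : ‖euclideanConcat m n x‖ ^ 2 = ‖x.1‖ ^ 2 + ‖x.2‖ ^ 2 := by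
    simp [EuclideanSpace.norm_sq_eq]
  have h1 : ‖x.1‖ ^ 2 ≤ ‖x‖ ^ 2 := by gcongr; exact norm_fst_le x
  have h2 : ‖x.2‖ ^ 2 ≤ ‖x‖ ^ 2 := by gcongr; exact norm_snd_le x
  rw [h]
  nlinarith [sq_nonneg ‖x‖]

/-- A bilinear form is a difference of two nonnegative diagonal quadratic forms in suitable
orthogonal coordinates. -/
lemma exists_bilin_eq_sub_inner_diagMap (A : Matrix m n ℝ) :
    ∃ (T : EuclideanSpace ℝ m × EuclideanSpace ℝ n →L[ℝ] EuclideanSpace ℝ (m ⊕ n))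
      (l l' : m ⊕ n → ℝ), (∀ x, ‖T x‖ ≤ 2 * ‖x‖) ∧ (∀ k, 0 ≤ l k) ∧ (∀ k, 0 ≤ l' k) ∧
        ∑ k, l k ^ 2 ≤ ∑ i, ∑ j, A i j ^ 2 ∧ ∑ k, l' k ^ 2 ≤ ∑ i, ∑ j, A i j ^ 2 ∧
        ∀ x, ∑ i, ∑ j, x.1 i * A i j * x.2 j =
          inner ℝ (diagMap l (T x)) (T x) - inner ℝ (diagMap l' (T x)) (T x) := by
  have hS : (Matrix.fromBlocks 0 A A.transpose 0).IsHermitian :=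
    Matrix.IsHermitian.fromBlocks (Matrix.isHermitian_zero) (by simp) (Matrix.isHermitian_zero)
  obtain ⟨U, l, hl, hU⟩ := exists_diagonalization hS
  have hcomm : ∑ j, ∑ i, A i j ^ 2 = ∑ i, ∑ j, A i j ^ 2 := Finset.sum_comm
  have hl2 : ∑ k, l k ^ 2 = 2 * ∑ i, ∑ j, A i j ^ 2 := by
    rw [hl]
    simp [hcomm]
    ring
  have hpart : ∀ f : m ⊕ n → ℝ, (∀ k, f k ^ 2 ≤ l k ^ 2 / 4) →
      ∑ k, f k ^ 2 ≤ ∑ i, ∑ j, A i j ^ 2 := fun f hf => by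
    have h1 := Finset.sum_le_sum fun k (_ : k ∈ Finset.univ) => hf k
    have h2 : (0 : ℝ) ≤ ∑ i, ∑ j, A i j ^ 2 := by positivity
    rw [← Finset.sum_div, hl2] at h1
    linarith
  refine ⟨(U.toLinearIsometry.toLinearMap ∘ₗ euclideanConcat m n).toContinuousLinearMap,
    fun k => max (l k) 0 / 2, fun k => max (-l k) 0 / 2, fun x => ?_, fun k => by positivity,
    fun k => by positivity, hpart _ fun k => ?_, hpart _ fun k => ?_, fun x => ?_⟩
  · simpa using norm_euclideanConcat_le x
  · rcases le_total (l k) 0 with h | h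
    · rw [max_eq_right h]; nlinarith [sq_nonneg (l k)]
    · rw [max_eq_left h]; linarith
  · rcases le_total (-l k) 0 with h | h
    · rw [max_eq_right h]; nlinarith [sq_nonneg (l k)]
    · rw [max_eq_left h]; linarith
  · have h1 := hU (euclideanConcat m n x)
    set q := ∑ k, l k * U (euclideanConcat m n x) k ^ 2 with hq
    have h2 : ∑ j, ∑ i, x.2 j * A i j * x.1 i = ∑ i, ∑ j, x.1 i * A i j * x.2 j := by
      rw [Finset.sum_comm]
      exact Finset.sum_congr rfl fun i _ => Finset.sum_congr rfl fun j _ => by ring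
    simp only [Fintype.sum_sum_type, euclideanConcat_inl, euclideanConcat_inr,
      Matrix.fromBlocks_apply₁₁, Matrix.fromBlocks_apply₁₂, Matrix.fromBlocks_apply₂₁,
      Matrix.fromBlocks_apply₂₂, Matrix.zero_apply, mul_zero, zero_mul, Finset.sum_const_zero,
      zero_add, add_zero, Matrix.transpose_apply, h2] at h1
    have h3 : ∑ i, ∑ j, x.1 i * A i j * x.2 j =
        ∑ k, l k / 2 * U (euclideanConcat m n x) k ^ 2 := by
      have : ∑ k, l k / 2 * U (euclideanConcat m n x) k ^ 2 = q / 2 := by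
        rw [hq, Finset.sum_div]
        exact Finset.sum_congr rfl fun k _ => by ring
      rw [this]
      linarith
    rw [h3, inner_diagMap, inner_diagMap, ← Finset.sum_sub_distrib]
    refine Finset.sum_congr rfl fun k _ => ?_
    have h4 : max (l k) 0 - max (-l k) 0 = l k := by
      rcases le_total (l k) 0 with h | h
      · rw [max_eq_right h, max_eq_left (by linarith)]; ring
      · rw [max_eq_left h, max_eq_right (by linarith)]; ring
    change l k / 2 * U (euclideanConcat m n x) k ^ 2 =
      max (l k) 0 / 2 * (U (euclideanConcat m n x) k * U (euclideanConcat m n x) k) -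
      max (-l k) 0 / 2 * (U (euclideanConcat m n x) k * U (euclideanConcat m n x) k)
    linear_combination (-(U (euclideanConcat m n x) k ^ 2) / 2) * h4

end BilinearForm

section QuasiConvex

variable {Ω : Type*} [MeasurableSpace Ω] {μ : Measure Ω} [IsProbabilityMeasure μ]

open Filter Topology in
/-- If all translates of `X` have Gaussian tails around their Bochner integrals, then `X` is
integrable: otherwise these integrals would all be zero. -/
lemma integrable_of_gaussian_tail_add_const {X : Ω → ℝ} {C c : ℝ} (hc : 0 < c)
    (h : ∀ a t : ℝ, 0 < t → μ {ω | t ≤ |X ω + a - ∫ ω', (X ω' + a) ∂μ|} ≤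
      ENNReal.ofReal (C * Real.exp (-(t / c) ^ 2))) :
    Integrable X μ := by
  by_contra hX
  have hzero : ∀ a : ℝ, ∫ ω', (X ω' + a) ∂μ = 0 := fun a =>
    integral_undef fun h' => hX ((h'.sub (integrable_const a)).congr (.of_forall fun ω => by simp))
  have hle : ∀ n : ℕ, μ {ω | |X ω| ≤ ((n + 1 : ℕ) : ℝ)} ≤
      ENNReal.ofReal (C * Real.exp (-(((n + 1 : ℕ) : ℝ) / c) ^ 2)) := fun n => by
    refine (measure_mono fun ω hω => ?_).trans (h (2 * ((n + 1 : ℕ) : ℝ)) _ (by positivity))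
    have h1 : |X ω| ≤ ((n + 1 : ℕ) : ℝ) := hω
    rw [Set.mem_ofPred_eq, hzero, sub_zero]
    have h2 := (abs_le.1 h1).1
    exact le_trans (by linarith) (le_abs_self _)
  have hmono : Monotone fun n : ℕ => {ω | |X ω| ≤ (n : ℝ)} := fun i j hij ω hω =>
    le_trans (b := (i : ℝ)) hω (by exact_mod_cast hij)
  have hlim := tendsto_measure_iUnion_atTop (μ := μ) hmono
  have huniv : ⋃ n : ℕ, {ω | |X ω| ≤ (n : ℝ)} = Set.univ :=
    Set.eq_univ_of_forall fun ω => Set.mem_iUnion.2 (exists_nat_ge |X ω|)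
  rw [huniv, measure_univ] at hlim
  have hlim0 : Tendsto (fun n : ℕ => ENNReal.ofReal (C * Real.exp (-((n : ℝ) / c) ^ 2)))
      atTop (𝓝 0) := by
    have h1 : Tendsto (fun n : ℕ => ((n : ℝ) / c) ^ 2) atTop atTop :=
      (tendsto_pow_atTop two_ne_zero).comp (tendsto_natCast_atTop_atTop.atTop_div_const hc)
    have h2 := (Real.tendsto_exp_neg_atTop_nhds_zero.comp h1).const_mul C
    rw [mul_zero] at h2
    simpa using ENNReal.tendsto_ofReal h2
  have := le_of_tendsto_of_tendsto' ((tendsto_add_atTop_iff_nat 1).2 hlim)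
    ((tendsto_add_atTop_iff_nat 1).2 hlim0) hle
  simp at this

lemma convexlyConcentrated_of_quasiconvex {E : Type*} [NormedAddCommGroup E] [NormedSpace ℝ E]
    {X : Ω → E} {C c : ℝ} (hC : 0 ≤ C) (hc : 0 < c)
    (h : ∀ f : E → ℝ, (∀ u : ℝ, Convex ℝ {x | f x ≤ u}) → LipschitzWith 1 f →
      ∀ t : ℝ, 0 < t → μ {ω | t ≤ |f (X ω) - ∫ ω', f (X ω') ∂μ|} ≤
        ENNReal.ofReal (C * Real.exp (-(t / c) ^ 2))) :
    ConvexlyConcentrated μ X C c := by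
  intro f hf hlip
  have hconv : ∀ g : E → ℝ, ConvexOn ℝ Set.univ g → ∀ u : ℝ, Convex ℝ {x | g x ≤ u} :=
    fun g hg u => by simpa using hg.convex_le u
  refine ⟨integrable_of_gaussian_tail_add_const (C := C) hc fun a t ht => ?_, fun t ht =>
    ENNReal.toReal_le_of_le_ofReal (by positivity) (h f (hconv f hf) hlip t ht)⟩
  refine h (fun x => f x + a) (hconv _ (hf.add_const a)) ?_ t ht
  refine LipschitzWith.of_le_add_mul _ fun x y => ?_
  have := hlip.le_add_mul x y
  linarith

end QuasiConvex

/-- Hanson–Wright-type concentration of the bilinear form `ZᵀAW` under convex concentration of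
the pair `(Z, W)`, with constants depending only on `C`, `c` and `K`. -/
theorem stmt9 (C c K : ℝ) (hC : 1 ≤ C) (hc : 0 < c) (hK : 0 < K) :
    ∃ C' c' : ℝ, 1 ≤ C' ∧ 0 < c' ∧
      ∀ (Ω : Type u) [MeasurableSpace Ω] (μ : Measure Ω) [IsProbabilityMeasure μ]
        (p : ℕ), 2 ≤ p →
        ∀ A : Matrix (Fin p) (Fin p) ℝ, A ≠ 0 →
        ∀ Z W : Ω → EuclideanSpace ℝ (Fin p),
          ‖∫ ω, Z ω ∂μ‖ ≤ K * Real.sqrt (Real.log p) →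
          ‖∫ ω, W ω ∂μ‖ ≤ K * Real.sqrt (Real.log p) →
          -- convex concentration of the pair `(Z, W)` for the sup norm, with exponent 2
          (∀ f : EuclideanSpace ℝ (Fin p) × EuclideanSpace ℝ (Fin p) → ℝ,
            (∀ u : ℝ, Convex ℝ {x | f x ≤ u}) → LipschitzWith 1 f →
            ∀ t : ℝ, 0 < t →
              μ {ω | t ≤ |f (Z ω, W ω) - ∫ ω', f (Z ω', W ω') ∂μ|} ≤
                ENNReal.ofReal (C * Real.exp (-(t / c) ^ 2))) →
          ∀ t : ℝ, 0 < t →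
            μ {ω | t ≤ |(∑ i, ∑ j, Z ω i * A i j * W ω j)
                - ∫ ω', (∑ i, ∑ j, Z ω' i * A i j * W ω' j) ∂μ|} ≤
              ENNReal.ofReal
                (C' * Real.exp (-(t ^ 2 / (c' * (∑ i, ∑ j, A i j ^ 2) * Real.log p)))
                  + C' * Real.exp (-(t / (c' * Real.sqrt (∑ i, ∑ j, A i j ^ 2))))) := by
  obtain ⟨C', b, hC', hb, hdiag⟩ := exists_mixedTail_diagonal C (c * 2) (2 * K) hC (by positivity)
  refine ⟨2 * C', 4 * b, by linarith, by positivity, ?_⟩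
  intro Ω _ μ _ p hp A hA Z W hZ hW hconc t ht
  set L := Real.log p with hL
  have hL2 : 1 / 2 ≤ L := by
    have h1 : Real.log 2 ≤ Real.log p := Real.log_le_log two_pos (by exact_mod_cast hp)
    have := Real.log_two_gt_d9
    norm_num at this
    linarith
  have hL0 : 0 < L := by linarith
  set Q := ∑ i, ∑ j, A i j ^ 2 with hQ
  have hQ0 : 0 < Q := by
    obtain ⟨i, j, hij⟩ : ∃ i j, A i j ≠ 0 := by
      by_contra! hzero
      exact hA (Matrix.ext hzero)
    calc 0 < A i j ^ 2 := by positivity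
      _ ≤ ∑ j, A i j ^ 2 := Finset.single_le_sum (f := fun j => A i j ^ 2)
          (fun _ _ => sq_nonneg _) (Finset.mem_univ j)
      _ ≤ Q := Finset.single_le_sum (f := fun i => ∑ j, A i j ^ 2)
          (fun _ _ => Finset.sum_nonneg fun _ _ => sq_nonneg _) (Finset.mem_univ i)
  have hQs : √Q ^ 2 = Q := Real.sq_sqrt hQ0.le
  have hQs0 : 0 < √Q := Real.sqrt_pos.2 hQ0
  have hpair : ConvexlyConcentrated μ (fun ω => (Z ω, W ω)) C c :=
    convexlyConcentrated_of_quasiconvex (by linarith) hc hconc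
  obtain ⟨T, l, l', hT, hl, hl', hlQ, hlQ', hform⟩ := exists_bilin_eq_sub_inner_diagMap A
  have hY := hpair.comp_continuousLinearMap T two_pos hT
  have hZint : Integrable Z μ := Integrable.of_eval_piLp
    ((hpair.comp_continuousLinearMap (ContinuousLinearMap.fst ℝ _ _) one_pos fun x => by
      simpa using norm_fst_le x).apply · |>.1)
  have hWint : Integrable W μ := Integrable.of_eval_piLp
    ((hpair.comp_continuousLinearMap (ContinuousLinearMap.snd ℝ _ _) one_pos fun x => by
      simpa using norm_snd_le x).apply · |>.1)
  have hmean : ∑ k, (∫ ω, T (Z ω, W ω) k ∂μ) ^ 2 ≤ (2 * K) ^ 2 * L := by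
    have h1 : ∀ k, ∫ ω, T (Z ω, W ω) k ∂μ = T (∫ ω, Z ω ∂μ, ∫ ω, W ω ∂μ) k := fun k => by
      rw [← integral_pair hZint hWint]
      exact ((EuclideanSpace.proj k : _ →L[ℝ] ℝ) ∘L T).integral_comp_comm (hZint.prodMk hWint)
    have h2 := EuclideanSpace.norm_sq_eq (T (∫ ω, Z ω ∂μ, ∫ ω, W ω ∂μ))
    simp only [Real.norm_eq_abs, sq_abs] at h2
    simp_rw [h1]
    rw [← h2]
    have h3 : ‖T (∫ ω, Z ω ∂μ, ∫ ω, W ω ∂μ)‖ ≤ 2 * (K * √L) :=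
      (hT _).trans (by gcongr; exact norm_prod_le_iff.2 ⟨hZ, hW⟩)
    calc _ ≤ (2 * (K * √L)) ^ 2 := by gcongr
      _ = _ := by rw [← mul_assoc, mul_pow, Real.sq_sqrt hL0.le]
  obtain ⟨hi, htail⟩ := hdiag hY hl hQs0 (hlQ.trans hQs.ge) hL2 hmean
  obtain ⟨hi', htail'⟩ := hdiag hY hl' hQs0 (hlQ'.trans hQs.ge) hL2 hmean
  have hrw : ∀ ω, ∑ i, ∑ j, Z ω i * A i j * W ω j =
      inner ℝ (diagMap l (T (Z ω, W ω))) (T (Z ω, W ω)) -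
        inner ℝ (diagMap l' (T (Z ω, W ω))) (T (Z ω, W ω)) := fun ω => hform (Z ω, W ω)
  simp_rw [hrw]
  rw [integral_sub hi hi', ← ofReal_measureReal]
  refine ENNReal.ofReal_le_ofReal ?_
  have h1 := htail (t / 2) (by positivity)
  have h2 := htail' (t / 2) (by positivity)
  refine (measureReal_mono fun ω hω => ?_).trans
    ((measureReal_union_le _ _).trans ((add_le_add h1 h2).trans ?_))
  · by_contra hcon
    simp only [Set.mem_union, Set.mem_ofPred_eq, not_or, not_le, abs_lt] at hcon hω
    rw [le_abs] at hω
    rcases hω with hω | hω <;> linarith [hcon.1.1, hcon.1.2, hcon.2.1, hcon.2.2]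
  · have e1 : (t / 2) ^ 2 / (b * (√Q * √L) ^ 2) = t ^ 2 / (4 * b * Q * L) := by
      rw [mul_pow, hQs, Real.sq_sqrt hL0.le]
      field_simp
      norm_num
    have e2 : t / (4 * b * √Q) ≤ t / 2 / (b * √Q) := by
      rw [div_div]
      apply div_le_div_of_nonneg_left ht.le (by positivity)
      nlinarith [mul_pos hb hQs0]
    have e3 := Real.exp_le_exp.2 (neg_le_neg e2)
    unfold mixedTail
    rw [e1]
    nlinarith
end

section
/- Let p ≥ 1 and m ≥ 1 be integers, C ≥ 1, c > 0, q > 0, σ > 0, κ > 0. Let X be a random p×p real matrix such that: (i) for every quasi-convex function f : M_p(ℝ) → ℝ that is 1-Lipschitz for the Frobenius norm, and every t > 0, P(|f(X) − E[f(X)]| ≥ t) ≤ C·exp(−(t/(c·σ))^q); (ii) P(‖X‖ > κ) ≤ C·exp(−c·p), where ‖X‖ denotes the operator norm. Then there exist constants C′ ≥ 1 and c′ > 0 depending only on C, c and q, an event A with P(Aᶜ) ≤ C′·exp(−p/c′), and a deterministic matrix M̃ ∈ M_p(ℝ), such that for every matrix B ∈ M_p(ℝ) with operator norm ‖B‖ ≤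 1 and every t > 0, the conditional probability satisfies P(|tr(B·X^m) − tr(B·M̃)| ≥ t | A) ≤ C′·exp(−(t/(c′·√p·(2eκ)^{m−1}·σ))^q). -/
open MeasureTheory ProbabilityTheory ENNReal

universe u

theorem exists_convexOn_lipschitz_posPart_pow {n : ℕ} (hn : 2 ≤ n) {K : ℝ} (hK : 0 ≤ K) :
    ∃ h : ℝ → ℝ, ConvexOn ℝ Set.univ h ∧ (∀ x y, |h x - h y| ≤ n * K ^ (n - 1) * |x - y|) ∧
      (∀ x, 0 ≤ x → x ≤ K → h x = x ^ n) ∧ ∀ x ≤ 0, h x = 0 := by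
  set g : ℝ → ℝ := fun t => n * (max 0 (min t K)) ^ (n - 1) with hg
  have hgc : Continuous g := by fun_prop
  have hd : ∀ x, HasDerivAt (fun x => ∫ t in (0 : ℝ)..x, g t) (g x) x := fun x =>
    hgc.integral_hasStrictDerivAt 0 x |>.hasDerivAt
  have hderiv : deriv (fun x => ∫ t in (0 : ℝ)..x, g t) = g := funext fun x => (hd x).deriv
  refine ⟨fun x => ∫ t in (0 : ℝ)..x, g t, ?_, ?_, ?_, ?_⟩
  · refine Monotone.convexOn_univ_of_deriv (fun x => (hd x).differentiableAt) ?_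
    rw [hderiv]
    intro x y hxy
    exact mul_le_mul_of_nonneg_left (pow_le_pow_left₀ (le_max_left _ _)
      (max_le_max le_rfl (min_le_min hxy le_rfl)) _) (Nat.cast_nonneg n)
  · intro x y
    have := Convex.norm_image_sub_le_of_norm_hasDerivWithin_le
      (f := fun x => ∫ t in (0 : ℝ)..x, g t)
      (f' := g) (C := n * K ^ (n - 1)) (s := Set.univ) (x := y) (y := x)
      (fun x _ => (hd x).hasDerivWithinAt) (fun x _ => ?_) convex_univ trivial trivial
    · simpa only [Real.norm_eq_abs] using this
    · have h0 : 0 ≤ max 0 (min x K) := le_max_left _ _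
      rw [Real.norm_eq_abs, abs_of_nonneg (by positivity)]
      exact mul_le_mul_of_nonneg_left (pow_le_pow_left₀ h0 (max_le hK (min_le_right _ _)) _)
        (Nat.cast_nonneg n)
  · intro x hx hxK
    have : ∫ t in (0 : ℝ)..x, g t = ∫ t in (0 : ℝ)..x, n * t ^ (n - 1) := by
      refine intervalIntegral.integral_congr fun t ht => ?_
      rw [Set.uIcc_of_le hx] at ht
      simp only [hg]
      rw [min_eq_left (ht.2.trans hxK), max_eq_right ht.1]
    simp only [this]
    rw [intervalIntegral.integral_const_mul, integral_pow]
    obtain ⟨k, rfl⟩ : ∃ k, n = k + 1 := ⟨n - 1, by omega⟩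
    simp
    field_simp
  · intro x hx
    have : ∫ t in (0 : ℝ)..x, g t = ∫ t in (0 : ℝ)..x, (0 : ℝ) := by
      refine intervalIntegral.integral_congr fun t ht => ?_
      rw [Set.uIcc_of_ge hx] at ht
      simp only [hg]
      rw [max_eq_left ((min_le_left _ _).trans ht.2), zero_pow (by omega), mul_zero]
    simp only [this]
    simp

theorem coeff_zero_C_add_X_mul_C_pow {A : Type*} [Ring A] (P Q : A) (n : ℕ) :
    ((Polynomial.C P + Polynomial.X * Polynomial.C Q) ^ n).coeff 0 = P ^ n := by
  induction n with
  | zero => simp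
  | succ n ih =>
    rw [pow_succ', add_mul, mul_assoc, Polynomial.coeff_add, Polynomial.coeff_C_mul, ih,
      Polynomial.coeff_X_mul_zero, add_zero, pow_succ']

theorem coeff_one_C_add_X_mul_C_pow {A : Type*} [Ring A] (P Q : A) (n : ℕ) :
    ((Polynomial.C P + Polynomial.X * Polynomial.C Q) ^ n).coeff 1 =
      ∑ i ∈ Finset.range n, P ^ i * Q * P ^ (n - 1 - i) := by
  induction n with
  | zero => simp [Polynomial.coeff_one]
  | succ n ih =>
    rw [pow_succ', add_mul, mul_assoc, Polynomial.coeff_add, Polynomial.coeff_C_mul, ih,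
      Polynomial.coeff_X_mul, Polynomial.coeff_C_mul, coeff_zero_C_add_X_mul_C_pow,
      Finset.sum_range_succ', Finset.mul_sum]
    congr 1
    · refine Finset.sum_congr rfl fun i hi => ?_
      rw [pow_succ', show n + 1 - 1 - (i + 1) = n - 1 - i by omega]
      simp only [mul_assoc]
    · simp

theorem add_smul_pow_eq_sum_coeff {A : Type*} [Ring A] [Algebra ℂ A] (P Q : A) (n : ℕ) (t : ℂ) :
    (P + t • Q) ^ n = ∑ k ∈ Finset.range (n + 1),
      t ^ k • ((Polynomial.C P + Polynomial.X * Polynomial.C Q) ^ n).coeff k := by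
  have hdeg : ((Polynomial.C P + Polynomial.X * Polynomial.C Q) ^ n).natDegree < n + 1 := by
    refine Nat.lt_succ_of_le (Polynomial.natDegree_pow_le_of_le (m := 1) n ?_ |>.trans (by simp))
    compute_degree
  let φ := Polynomial.eval₂RingHom' (RingHom.id A) (algebraMap ℂ A t)
    (fun a => (Algebra.commutes t a).symm)
  have hφ : φ ((Polynomial.C P + Polynomial.X * Polynomial.C Q) ^ n) = (P + t • Q) ^ n := by
    have hX : φ Polynomial.X = algebraMap ℂ A t := Polynomial.eval₂_X ..
    have hC : ∀ a, φ (Polynomial.C a) = a := fun a => Polynomial.eval₂_C ..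
    rw [map_pow, map_add, map_mul, hX, hC, hC, Algebra.smul_def]
  rw [← hφ]
  change Polynomial.eval₂ _ _ _ = _
  rw [Polynomial.eval₂_eq_sum_range' _ hdeg]
  refine Finset.sum_congr rfl fun k _ => ?_
  rw [RingHom.id_apply, ← map_pow, ← Algebra.commutes, Algebra.smul_def]

theorem IsPrimitiveRoot.sum_pow_mul_inv_pow {η : ℂ} {N : ℕ} (hη : IsPrimitiveRoot η N) {k d : ℕ}
    (hk : k < N) (hd : d < N) :
    ∑ j ∈ Finset.range N, ((η ^ j) ^ d)⁻¹ * (η ^ j) ^ k = if k = d then (N : ℂ) else 0 := by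
  have h0 : η ≠ 0 := hη.ne_zero (by omega)
  have : ∀ j, ((η ^ j) ^ d)⁻¹ * (η ^ j) ^ k = (η ^ k / η ^ d) ^ j := fun j => by
    rw [div_pow, div_eq_inv_mul, ← pow_mul, ← pow_mul, ← pow_mul, ← pow_mul, mul_comm k,
      mul_comm d]
  simp only [this]
  split_ifs with h
  · subst h
    simp [div_self (pow_ne_zero k h0)]
  · rw [geom_sum_eq, div_pow, ← pow_mul, ← pow_mul, mul_comm k, mul_comm d, pow_mul, pow_mul,
      hη.pow_eq_one]
    · simp
    · intro h1
      rw [div_eq_one_iff_eq (pow_ne_zero d h0)] at h1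
      exact h (hη.pow_inj hk hd h1)

theorem IsPrimitiveRoot.sum_inv_smul_add_smul_pow {A : Type*} [Ring A] [Algebra ℂ A] {η : ℂ} {N : ℕ}
    (hη : IsPrimitiveRoot η N) (P Q : A) {n d : ℕ} (hn : n < N) (hd : d ≤ n) :
    ∑ j ∈ Finset.range N, ((η ^ j) ^ d)⁻¹ • (P + η ^ j • Q) ^ n =
      (N : ℂ) • ((Polynomial.C P + Polynomial.X * Polynomial.C Q) ^ n).coeff d := by
  simp only [add_smul_pow_eq_sum_coeff, Finset.smul_sum, smul_smul]
  rw [Finset.sum_comm]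
  simp only [← Finset.sum_smul]
  rw [Finset.sum_eq_single d]
  · rw [hη.sum_pow_mul_inv_pow (by omega) (by omega), if_pos rfl]
  · intro k hk hkd
    rw [Finset.mem_range] at hk
    rw [hη.sum_pow_mul_inv_pow (by omega) (by omega), if_neg hkd, zero_smul]
  · intro h
    simp at h
    omega

namespace Matrix

variable {ι : Type*} [Fintype ι] [DecidableEq ι]

/-- The trace of `φ (M + Mᴴ)`, where `φ` acts through the functional calculus. -/
noncomputable def traceFun (φ : ℝ → ℝ) (M : Matrix ι ι ℂ) : ℝ :=
  ∑ i, φ ((isHermitian_add_transpose_self M).eigenvalues i)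

theorem IsHermitian.inner_toEuclideanLin_eq_sum {H : Matrix ι ι ℂ} (hH : H.IsHermitian)
    (v : EuclideanSpace ℂ ι) :
    inner ℂ v (toEuclideanLin H v) =
      ((∑ k, ‖inner ℂ (hH.eigenvectorBasis k) v‖ ^ 2 * hH.eigenvalues k : ℝ) : ℂ) := by
  have hT : ∀ k, toEuclideanLin H (hH.eigenvectorBasis k) =
      (hH.eigenvalues k : ℂ) • hH.eigenvectorBasis k := fun k => by
    ext i
    simpa using congrFun (hH.mulVec_eigenvectorBasis k) i
  rw [← hH.eigenvectorBasis.sum_inner_mul_inner, Complex.ofReal_sum]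
  refine Finset.sum_congr rfl fun k _ => ?_
  rw [← (isSymmetric_toEuclideanLin_iff.mpr hH) (hH.eigenvectorBasis k) v, hT, inner_smul_left,
    Complex.conj_ofReal, ← inner_conj_symm v, mul_left_comm, Complex.conj_mul']
  push_cast
  ring

/-- The Peierls inequality. -/
theorem IsHermitian.sum_map_re_inner_le {H : Matrix ι ι ℂ} (hH : H.IsHermitian) {φ : ℝ → ℝ}
    (hφ : ConvexOn ℝ Set.univ φ) (b : OrthonormalBasis ι ℂ (EuclideanSpace ℂ ι)) :
    ∑ i, φ (inner ℂ (b i) (toEuclideanLin H (b i))).re ≤ ∑ k, φ (hH.eigenvalues k) := by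
  have key : ∀ i, φ (inner ℂ (b i) (toEuclideanLin H (b i))).re ≤
      ∑ k, ‖inner ℂ (hH.eigenvectorBasis k) (b i)‖ ^ 2 * φ (hH.eigenvalues k) := fun i => by
    rw [hH.inner_toEuclideanLin_eq_sum, Complex.ofReal_re]
    refine hφ.map_sum_le (fun _ _ => by positivity) ?_ (fun _ _ => trivial)
    rw [hH.eigenvectorBasis.sum_sq_norm_inner_right, b.norm_eq_one, one_pow]
  refine (Finset.sum_le_sum fun i _ => key i).trans_eq ?_
  rw [Finset.sum_comm]
  refine Finset.sum_congr rfl fun k _ => ?_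
  rw [← Finset.sum_mul, b.sum_sq_norm_inner_left, hH.eigenvectorBasis.norm_eq_one, one_pow, one_mul]

theorem re_inner_add_conjTranspose (M : Matrix ι ι ℂ) (v : EuclideanSpace ℂ ι) :
    (inner ℂ v (toEuclideanLin (M + Mᴴ) v)).re = 2 * (inner ℂ v (toEuclideanLin M v)).re := by
  rw [map_add, LinearMap.add_apply, inner_add_right, toEuclideanLin_conjTranspose_eq_adjoint,
    LinearMap.adjoint_inner_right, ← inner_conj_symm (toEuclideanLin M v) v, Complex.add_re,
    Complex.conj_re]
  ring

theorem sum_map_two_mul_re_inner_le_traceFun {φ : ℝ → ℝ} (hφ : ConvexOn ℝ Set.univ φ)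
    (M : Matrix ι ι ℂ) (b : OrthonormalBasis ι ℂ (EuclideanSpace ℂ ι)) :
    ∑ i, φ (2 * (inner ℂ (b i) (toEuclideanLin M (b i))).re) ≤ traceFun φ M := by
  simpa only [re_inner_add_conjTranspose, traceFun] using
    (isHermitian_add_transpose_self M).sum_map_re_inner_le hφ b

theorem eigenvalues_add_conjTranspose (M : Matrix ι ι ℂ) (i : ι) :
    (isHermitian_add_transpose_self M).eigenvalues i =
      2 * (inner ℂ ((isHermitian_add_transpose_self M).eigenvectorBasis i)
        (toEuclideanLin M ((isHermitian_add_transpose_self M).eigenvectorBasis i))).re := by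
  set hH := isHermitian_add_transpose_self M
  rw [← re_inner_add_conjTranspose, hH.inner_toEuclideanLin_eq_sum, Complex.ofReal_re,
    Finset.sum_eq_single i]
  · simp
  · intro k _ hk
    simp [hH.eigenvectorBasis.inner_eq_zero hk]
  · simp

theorem traceFun_eq_sum (φ : ℝ → ℝ) (M : Matrix ι ι ℂ) :
    traceFun φ M = ∑ i, φ (2 * (inner ℂ ((isHermitian_add_transpose_self M).eigenvectorBasis i)
      (toEuclideanLin M ((isHermitian_add_transpose_self M).eigenvectorBasis i))).re) :=
  Finset.sum_congr rfl fun i _ => by rw [← eigenvalues_add_conjTranspose]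

theorem convexOn_traceFun {φ : ℝ → ℝ} (hφ : ConvexOn ℝ Set.univ φ) :
    ConvexOn ℝ Set.univ (traceFun φ : Matrix ι ι ℂ → ℝ) := by
  refine ⟨convex_univ, fun M _ M' _ a b ha hb hab => ?_⟩
  rw [traceFun_eq_sum]
  set e := (isHermitian_add_transpose_self (a • M + b • M')).eigenvectorBasis
  refine le_trans ?_ (add_le_add
    (mul_le_mul_of_nonneg_left (sum_map_two_mul_re_inner_le_traceFun hφ M e) ha)
    (mul_le_mul_of_nonneg_left (sum_map_two_mul_re_inner_le_traceFun hφ M' e) hb))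
  rw [Finset.mul_sum, Finset.mul_sum, ← Finset.sum_add_distrib]
  refine Finset.sum_le_sum fun i _ => ?_
  refine le_of_eq_of_le ?_ (hφ.2 (Set.mem_univ _) (Set.mem_univ _) ha hb hab)
  congr 1
  rw [← Complex.coe_smul a M, ← Complex.coe_smul b M']
  simp only [map_add, map_smul, LinearMap.add_apply, LinearMap.smul_apply, inner_add_right,
    inner_smul_right, Complex.add_re, Complex.re_ofReal_mul, smul_eq_mul]
  ring

theorem sum_norm_sq_toEuclideanLin (D : Matrix ι ι ℂ)
    (b : OrthonormalBasis ι ℂ (EuclideanSpace ℂ ι)) :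
    ∑ i, ‖toEuclideanLin D (b i)‖ ^ 2 = ∑ i, ∑ j, ‖D i j‖ ^ 2 := by
  set e := EuclideanSpace.basisFun ι ℂ
  calc ∑ i, ‖toEuclideanLin D (b i)‖ ^ 2
      = ∑ i, ∑ k, ‖inner ℂ (toEuclideanLin Dᴴ (e k)) (b i)‖ ^ 2 := by
        refine Finset.sum_congr rfl fun i _ => ?_
        rw [← e.sum_sq_norm_inner_right]
        refine Finset.sum_congr rfl fun k _ => ?_
        rw [toEuclideanLin_conjTranspose_eq_adjoint, LinearMap.adjoint_inner_left]
    _ = ∑ k, ‖toEuclideanLin Dᴴ (e k)‖ ^ 2 := by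
        rw [Finset.sum_comm]
        exact Finset.sum_congr rfl fun k _ => b.sum_sq_norm_inner_left _
    _ = ∑ i, ∑ j, ‖D i j‖ ^ 2 := by
        refine Finset.sum_congr rfl fun k _ => ?_
        rw [EuclideanSpace.norm_sq_eq]
        refine Finset.sum_congr rfl fun j _ => ?_
        simp [e]

theorem traceFun_sub_le {φ : ℝ → ℝ} (hφ : ConvexOn ℝ Set.univ φ) {L : ℝ} (hL : 0 ≤ L)
    (hφL : ∀ x y, |φ x - φ y| ≤ L * |x - y|) (M M' : Matrix ι ι ℂ) :
    traceFun φ M - traceFun φ M' ≤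
      2 * L * √(Fintype.card ι) * √(∑ i, ∑ j, ‖M i j - M' i j‖ ^ 2) := by
  rw [traceFun_eq_sum]
  set e := (isHermitian_add_transpose_self M).eigenvectorBasis
  have h1 := sum_map_two_mul_re_inner_le_traceFun hφ M' e
  have h2 : ∀ i, φ (2 * (inner ℂ (e i) (toEuclideanLin M (e i))).re) -
      φ (2 * (inner ℂ (e i) (toEuclideanLin M' (e i))).re) ≤
        2 * L * (1 * ‖toEuclideanLin (M - M') (e i)‖) := fun i => by
    refine (le_abs_self _).trans ((hφL _ _).trans ?_)
    rw [← mul_sub, ← Complex.sub_re, ← inner_sub_right, ← LinearMap.sub_apply, ← map_sub, abs_mul,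
      abs_two, mul_left_comm, mul_assoc]
    gcongr
    refine (Complex.abs_re_le_norm _).trans ((norm_inner_le_norm _ _).trans_eq ?_)
    rw [e.norm_eq_one]
  have h3 : ∑ i, 1 * ‖toEuclideanLin (M - M') (e i)‖ ≤
      √(Fintype.card ι) * √(∑ i, ∑ j, ‖M i j - M' i j‖ ^ 2) := by
    refine (Real.sum_mul_le_sqrt_mul_sqrt _ _ _).trans_eq ?_
    rw [sum_norm_sq_toEuclideanLin]
    simp
  have h4 := Finset.sum_le_sum fun i (_ : i ∈ Finset.univ) => h2 i
  rw [Finset.sum_sub_distrib, ← Finset.mul_sum] at h4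
  have h5 := mul_le_mul_of_nonneg_left h3 (by positivity : 0 ≤ 2 * L)
  linarith

theorem abs_traceFun_sub_le {φ : ℝ → ℝ} (hφ : ConvexOn ℝ Set.univ φ) {L : ℝ} (hL : 0 ≤ L)
    (hφL : ∀ x y, |φ x - φ y| ≤ L * |x - y|) (M M' : Matrix ι ι ℂ) :
    |traceFun φ M - traceFun φ M'| ≤
      2 * L * √(Fintype.card ι) * √(∑ i, ∑ j, ‖M i j - M' i j‖ ^ 2) := by
  refine abs_sub_le_iff.mpr ⟨traceFun_sub_le hφ hL hφL M M', ?_⟩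
  simpa only [norm_sub_rev] using traceFun_sub_le hφ hL hφL M' M

theorem trace_add_conjTranspose_pow (M : Matrix ι ι ℂ) (n : ℕ) :
    ((M + Mᴴ) ^ n).trace = (traceFun (fun x => x ^ n) M : ℂ) := by
  have hH := isHermitian_add_transpose_self M
  rw [hH.spectral_theorem, ← map_pow, Unitary.conjStarAlgAut_apply, Matrix.trace_mul_cycle,
    Unitary.coe_star_mul_self, one_mul, diagonal_pow, trace_diagonal]
  simp [traceFun]

theorem traceFun_congr_of_abs_le {φ ψ : ℝ → ℝ} {M : Matrix ι ι ℂ} {K : ℝ}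
    (hM : ∀ v : EuclideanSpace ℂ ι, ‖v‖ = 1 → ‖inner ℂ v (toEuclideanLin M v)‖ ≤ K)
    (h : ∀ x, |x| ≤ 2 * K → φ x = ψ x) : traceFun φ M = traceFun ψ M := by
  refine Finset.sum_congr rfl fun i _ => h _ ?_
  rw [eigenvalues_add_conjTranspose, abs_mul, abs_two]
  gcongr
  exact (Complex.abs_re_le_norm _).trans (hM _ (OrthonormalBasis.norm_eq_one _ i))

end Matrix

/-- On `S`, `f` is a difference of two convex functions that are `Λ`-Lipschitz for `d`. -/
def IsLipschitzDC {E : Type*} [AddCommGroup E] [Module ℝ E] (d : E → E → ℝ) (Λ : ℝ) (S : Set E)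
    (f : E → ℝ) : Prop :=
  ∃ g₁ g₂ : E → ℝ, ConvexOn ℝ Set.univ g₁ ∧ ConvexOn ℝ Set.univ g₂ ∧
    (∀ x y, |g₁ x - g₁ y| ≤ Λ * d x y) ∧ (∀ x y, |g₂ x - g₂ y| ≤ Λ * d x y) ∧
    ∀ x ∈ S, f x = g₁ x - g₂ x

namespace IsLipschitzDC

variable {E : Type*} [AddCommGroup E] [Module ℝ E] {d : E → E → ℝ} {Λ Λ' : ℝ} {S : Set E}
  {f f' : E → ℝ}

theorem of_convexOn (hd : ∀ x y, 0 ≤ d x y) (hΛ : 0 ≤ Λ) (hf : ConvexOn ℝ Set.univ f)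
    (hfΛ : ∀ x y, |f x - f y| ≤ Λ * d x y) : IsLipschitzDC d Λ S f :=
  ⟨f, 0, hf, convexOn_const 0 convex_univ, hfΛ,
    fun x y => by simpa using mul_nonneg hΛ (hd x y), fun x _ => by simp⟩

theorem congr (hf : IsLipschitzDC d Λ S f) (h : ∀ x ∈ S, f' x = f x) : IsLipschitzDC d Λ S f' := by
  obtain ⟨g₁, g₂, h₁, h₂, h₃, h₄, h₅⟩ := hf
  exact ⟨g₁, g₂, h₁, h₂, h₃, h₄, fun x hx => (h x hx).trans (h₅ x hx)⟩

theorem mono (hd : ∀ x y, 0 ≤ d x y) (hf : IsLipschitzDC d Λ S f) (h : Λ ≤ Λ') :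
    IsLipschitzDC d Λ' S f := by
  obtain ⟨g₁, g₂, h₁, h₂, h₃, h₄, h₅⟩ := hf
  exact ⟨g₁, g₂, h₁, h₂, fun x y => (h₃ x y).trans (mul_le_mul_of_nonneg_right h (hd x y)),
    fun x y => (h₄ x y).trans (mul_le_mul_of_nonneg_right h (hd x y)), h₅⟩

theorem add (hf : IsLipschitzDC d Λ S f) (hf' : IsLipschitzDC d Λ' S f') :
    IsLipschitzDC d (Λ + Λ') S (fun x => f x + f' x) := by
  obtain ⟨g₁, g₂, h₁, h₂, h₃, h₄, h₅⟩ := hf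
  obtain ⟨g₁', g₂', h₁', h₂', h₃', h₄', h₅'⟩ := hf'
  refine ⟨g₁ + g₁', g₂ + g₂', h₁.add h₁', h₂.add h₂', fun x y => ?_, fun x y => ?_, fun x hx => ?_⟩
  · rw [Pi.add_apply, Pi.add_apply, add_sub_add_comm, add_mul]
    exact (abs_add_le _ _).trans (add_le_add (h₃ x y) (h₃' x y))
  · rw [Pi.add_apply, Pi.add_apply, add_sub_add_comm, add_mul]
    exact (abs_add_le _ _).trans (add_le_add (h₄ x y) (h₄' x y))
  · simp only [h₅ x hx, h₅' x hx, Pi.add_apply, add_sub_add_comm]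

theorem neg (hf : IsLipschitzDC d Λ S f) : IsLipschitzDC d Λ S (fun x => -f x) := by
  obtain ⟨g₁, g₂, h₁, h₂, h₃, h₄, h₅⟩ := hf
  exact ⟨g₂, g₁, h₂, h₁, h₄, h₃, fun x hx => by simp only [h₅ x hx, neg_sub]⟩

theorem const_mul_of_nonneg (hf : IsLipschitzDC d Λ S f) {a : ℝ} (ha : 0 ≤ a) :
    IsLipschitzDC d (a * Λ) S (fun x => a * f x) := by
  obtain ⟨g₁, g₂, h₁, h₂, h₃, h₄, h₅⟩ := hf
  refine ⟨fun x => a * g₁ x, fun x => a * g₂ x, h₁.smul ha, h₂.smul ha, fun x y => ?_,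
    fun x y => ?_, fun x hx => by simp only [h₅ x hx, mul_sub]⟩
  · rw [← mul_sub, abs_mul, abs_of_nonneg ha, mul_assoc]
    exact mul_le_mul_of_nonneg_left (h₃ x y) ha
  · rw [← mul_sub, abs_mul, abs_of_nonneg ha, mul_assoc]
    exact mul_le_mul_of_nonneg_left (h₄ x y) ha

theorem const_mul (hf : IsLipschitzDC d Λ S f) (a : ℝ) :
    IsLipschitzDC d (|a| * Λ) S (fun x => a * f x) := by
  rcases le_total 0 a with ha | ha
  · simpa [abs_of_nonneg ha] using hf.const_mul_of_nonneg ha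
  · simpa [abs_of_nonpos ha] using (hf.const_mul_of_nonneg (neg_nonneg.mpr ha)).neg

theorem sum {J : Type*} {s : Finset J} {Λ : J → ℝ} {f : J → E → ℝ}
    (hf : ∀ j ∈ s, IsLipschitzDC d (Λ j) S (f j)) :
    IsLipschitzDC d (∑ j ∈ s, Λ j) S (fun x => ∑ j ∈ s, f j x) := by
  classical
  induction s using Finset.induction_on with
  | empty =>
    exact ⟨0, 0, convexOn_const 0 convex_univ, convexOn_const 0 convex_univ, by simp, by simp,
      by simp⟩
  | insert j s hj ih =>
    simp only [Finset.sum_insert hj]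
    exact (hf j (Finset.mem_insert_self j s)).add
      (ih fun i hi => hf i (Finset.mem_insert_of_mem hi))

end IsLipschitzDC

namespace Matrix

variable {ι : Type*} [Fintype ι]

/-- The distance associated with the Frobenius norm. -/
noncomputable def frobDist (X Y : Matrix ι ι ℝ) : ℝ := √(∑ i, ∑ j, (X i j - Y i j) ^ 2)

theorem frobDist_nonneg (X Y : Matrix ι ι ℝ) : 0 ≤ frobDist X Y := Real.sqrt_nonneg _

variable [DecidableEq ι]

theorem trace_sum_pow_mul_mul_pow (P Q : Matrix ι ι ℂ) (n : ℕ) :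
    (∑ i ∈ Finset.range n, P ^ i * Q * P ^ (n - 1 - i)).trace = n * (Q * P ^ (n - 1)).trace := by
  rw [trace_sum, Finset.sum_congr rfl (g := fun _ => (Q * P ^ (n - 1)).trace)]
  · simp
  · intro i hi
    rw [Finset.mem_range] at hi
    rw [mul_assoc, trace_mul_comm, mul_assoc, ← pow_add, show n - 1 - i + i = n - 1 by omega]

theorem sum_trace_add_conjTranspose_pow (X B : Matrix ι ι ℂ) {ζ : ℂ} {N n : ℕ}
    (hζ : IsPrimitiveRoot ζ (2 * N)) (hn : 1 ≤ n) (hnN : n < N) :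
    ∑ k ∈ Finset.range N, ∑ j ∈ Finset.range N, (((ζ ^ 2) ^ k)⁻¹ * ((ζ ^ j) ^ n)⁻¹) *
      ((ζ ^ j • (X + (ζ ^ 2) ^ k • B) + (ζ ^ j • (X + (ζ ^ 2) ^ k • B))ᴴ) ^ n).trace =
      N * (N * (n * (B * X ^ (n - 1)).trace)) := by
  have hη : IsPrimitiveRoot (ζ ^ 2) N := hζ.pow (by omega) rfl
  have hζ0 : ζ ≠ 0 := hζ.ne_zero (by omega)
  have hconj : star ζ = ζ⁻¹ :=
    (Complex.inv_eq_conj (hζ.norm'_eq_one (by omega))).symm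
  have hinner : ∀ P : Matrix ι ι ℂ, ∑ j ∈ Finset.range N, ((ζ ^ j) ^ n)⁻¹ *
      ((ζ ^ j • P + (ζ ^ j • P)ᴴ) ^ n).trace = N * (P ^ n).trace := fun P => by
    have h := congrArg Matrix.trace (hη.inv.sum_inv_smul_add_smul_pow P Pᴴ hnN (Nat.zero_le n))
    rw [coeff_zero_C_add_X_mul_C_pow, trace_sum, trace_smul, smul_eq_mul] at h
    rw [← h]
    refine Finset.sum_congr rfl fun j _ => ?_
    have : ζ ^ j • P + (ζ ^ j • P)ᴴ = ζ ^ j • (P + ((ζ ^ 2)⁻¹) ^ j • Pᴴ) := by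
      rw [conjTranspose_smul, star_pow, hconj, smul_add, smul_smul]
      rw [← mul_pow, sq, mul_inv, mul_inv_cancel_left₀ hζ0]
    rw [this, smul_pow, trace_smul, smul_eq_mul, ← mul_assoc,
      inv_mul_cancel₀ (pow_ne_zero _ (pow_ne_zero _ hζ0))]
    simp
  have h := congrArg Matrix.trace (hη.sum_inv_smul_add_smul_pow X B hnN hn)
  rw [coeff_one_C_add_X_mul_C_pow, trace_sum, trace_smul, smul_eq_mul,
    trace_sum_pow_mul_mul_pow] at h
  rw [← h, Finset.mul_sum]
  refine Finset.sum_congr rfl fun k _ => ?_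
  simp only [mul_assoc]
  rw [← Finset.mul_sum, hinner, trace_smul, smul_eq_mul, pow_one]
  ring

theorem norm_toEuclideanLin_map_ofReal_le {X : Matrix ι ι ℝ} {κ : ℝ} (hκ : 0 ≤ κ)
    (hX : ∀ v : ι → ℝ, ∑ i, (X *ᵥ v) i ^ 2 ≤ κ ^ 2 * ∑ i, v i ^ 2) (u : EuclideanSpace ℂ ι) :
    ‖toEuclideanLin (X.map Complex.ofReal) u‖ ≤ κ * ‖u‖ := by
  refine le_of_sq_le_sq ?_ (by positivity)
  have hre : ∀ i, ((X.map Complex.ofReal *ᵥ u) i).re = (X *ᵥ fun j => (u j).re) i := fun i => by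
    simp [mulVec, dotProduct]
  have him : ∀ i, ((X.map Complex.ofReal *ᵥ u) i).im = (X *ᵥ fun j => (u j).im) i := fun i => by
    simp [mulVec, dotProduct]
  rw [mul_pow, EuclideanSpace.norm_sq_eq, EuclideanSpace.norm_sq_eq]
  simp only [toLpLin_apply, Complex.sq_norm, Complex.normSq_apply, hre, him, ← sq,
    Finset.sum_add_distrib, mul_add]
  exact add_le_add (hX _) (hX _)

theorem norm_inner_toEuclideanLin_smul_add_le {X B : Matrix ι ι ℝ} {κ : ℝ} (hκ : 0 ≤ κ)
    (hX : ∀ v : ι → ℝ, ∑ i, (X *ᵥ v) i ^ 2 ≤ κ ^ 2 * ∑ i, v i ^ 2)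
    (hB : ∀ v : ι → ℝ, ∑ i, (B *ᵥ v) i ^ 2 ≤ 1 ^ 2 * ∑ i, v i ^ 2) {z s : ℂ} (hz : ‖z‖ = 1)
    {u : EuclideanSpace ℂ ι} (hu : ‖u‖ = 1) :
    ‖inner ℂ u (toEuclideanLin (z • (X.map Complex.ofReal + s • B.map Complex.ofReal)) u)‖ ≤
      κ + ‖s‖ := by
  refine (norm_inner_le_norm _ _).trans ?_
  have h1 := norm_toEuclideanLin_map_ofReal_le hκ hX u
  have h2 := norm_toEuclideanLin_map_ofReal_le zero_le_one hB u
  rw [hu, one_mul, map_smul, map_add, map_smul, LinearMap.smul_apply, norm_smul, hz, one_mul,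
    LinearMap.add_apply, LinearMap.smul_apply]
  refine (norm_add_le _ _).trans (add_le_add (by simpa [hu] using h1) ?_)
  rw [norm_smul]
  exact mul_le_of_le_one_right (norm_nonneg _) (by simpa [hu] using h2)

theorem isLipschitzDC_traceFun {φ : ℝ → ℝ} (hφ : ConvexOn ℝ Set.univ φ) {L : ℝ} (hL : 0 ≤ L)
    (hφL : ∀ x y, |φ x - φ y| ≤ L * |x - y|) (S : Set (Matrix ι ι ℝ)) {z : ℂ} (hz : ‖z‖ = 1)
    (W : Matrix ι ι ℂ) :
    IsLipschitzDC frobDist (2 * L * √(Fintype.card ι)) S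
      (fun X => traceFun φ (z • (X.map Complex.ofReal + W))) := by
  refine .of_convexOn frobDist_nonneg (by positivity) ⟨convex_univ, fun X _ Y _ a b ha hb hab => ?_⟩
    fun X Y => ?_
  · have hXY : z • ((a • X + b • Y).map Complex.ofReal + W) =
        a • (z • (X.map Complex.ofReal + W)) + b • (z • (Y.map Complex.ofReal + W)) := by
      have hab' : (a : ℂ) + b = 1 := by exact_mod_cast hab
      ext i j
      simp only [map_apply, add_apply, smul_apply, smul_eq_mul, Complex.real_smul,
        Complex.ofReal_add, Complex.ofReal_mul]
      linear_combination (-(z * W i j)) * hab'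
    beta_reduce
    rw [hXY]
    exact (convexOn_traceFun hφ).2 (Set.mem_univ _) (Set.mem_univ _) ha hb hab
  · refine (abs_traceFun_sub_le hφ hL hφL _ _).trans_eq ?_
    have hD : ∀ i j, ‖(z • (X.map Complex.ofReal + W)) i j -
        (z • (Y.map Complex.ofReal + W)) i j‖ ^ 2 = (X i j - Y i j) ^ 2 := fun i j => by
      simp only [map_apply, add_apply, smul_apply, smul_eq_mul]
      rw [← mul_sub, norm_mul, hz, one_mul, add_sub_add_right_eq_sub, ← Complex.ofReal_sub,
        Complex.norm_real, Real.norm_eq_abs, sq_abs]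
    simp only [hD, frobDist]

theorem isLipschitzDC_traceFun_pow {B : Matrix ι ι ℝ}
    (hB : ∀ v : ι → ℝ, ∑ i, (B *ᵥ v) i ^ 2 ≤ 1 ^ 2 * ∑ i, v i ^ 2) {κ : ℝ} (hκ : 0 ≤ κ) {n : ℕ}
    (hn : 2 ≤ n) {z : ℂ} (hz : ‖z‖ = 1) (s : ℂ) :
    IsLipschitzDC frobDist (4 * (n * (2 * (κ + ‖s‖)) ^ (n - 1)) * √(Fintype.card ι))
      {X : Matrix ι ι ℝ | ∀ v : ι → ℝ, ∑ i, (X *ᵥ v) i ^ 2 ≤ κ ^ 2 * ∑ i, v i ^ 2}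
      (fun X => traceFun (fun x => x ^ n)
        (z • (X.map Complex.ofReal + s • B.map Complex.ofReal))) := by
  set K := 2 * (κ + ‖s‖) with hK
  have hK0 : 0 ≤ K := by positivity
  set L := n * K ^ (n - 1)
  have hL0 : 0 ≤ L := by positivity
  obtain ⟨h, hconv, hlip, hpow, hzero⟩ := exists_convexOn_lipschitz_posPart_pow hn hK0
  have h₁ := isLipschitzDC_traceFun hconv hL0 hlip
    {X : Matrix ι ι ℝ | ∀ v : ι → ℝ, ∑ i, (X *ᵥ v) i ^ 2 ≤ κ ^ 2 * ∑ i, v i ^ 2} hz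
    (s • B.map Complex.ofReal)
  have h₂ := (isLipschitzDC_traceFun (φ := fun x => h (-x)) ?_ hL0 ?_
    {X : Matrix ι ι ℝ | ∀ v : ι → ℝ, ∑ i, (X *ᵥ v) i ^ 2 ≤ κ ^ 2 * ∑ i, v i ^ 2} hz
    (s • B.map Complex.ofReal)).const_mul ((-1) ^ n)
  · refine ((h₁.add h₂).mono frobDist_nonneg (le_of_eq ?_)).congr fun X hX => ?_
    · rw [abs_pow, abs_neg, abs_one, one_pow]
      ring
    · rw [traceFun_congr_of_abs_le (ψ := fun x => h x + (-1) ^ n * h (-x))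
        (fun v hv => norm_inner_toEuclideanLin_smul_add_le hκ hX hB hz hv)]
      · simp only [traceFun, Finset.sum_add_distrib, Finset.mul_sum]
      · intro x hx
        rw [← hK, abs_le] at hx
        rcases le_total 0 x with h0 | h0
        · rw [hpow x h0 hx.2, hzero (-x) (by linarith), mul_zero, add_zero]
        · rw [hzero x h0, hpow (-x) (by linarith) (by linarith), ← mul_pow]
          simp
  · exact hconv.comp_linearMap (-LinearMap.id)
  · intro x y
    refine (hlip _ _).trans_eq ?_
    rw [neg_sub_neg, abs_sub_comm]

theorem isLipschitzDC_trace_mul_pow {B : Matrix ι ι ℝ}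
    (hB : ∀ v : ι → ℝ, ∑ i, (B *ᵥ v) i ^ 2 ≤ 1 ^ 2 * ∑ i, v i ^ 2) {κ : ℝ} (hκ : 0 < κ) {m : ℕ}
    (hm : 1 ≤ m) :
    IsLipschitzDC frobDist
      (8 * Real.exp 1 * √(Fintype.card ι) * (2 * Real.exp 1 * κ) ^ (m - 1))
      {X : Matrix ι ι ℝ | ∀ v : ι → ℝ, ∑ i, (X *ᵥ v) i ^ 2 ≤ κ ^ 2 * ∑ i, v i ^ 2}
      (fun X => (B * X ^ m).trace) := by
  have hm0 : (0 : ℝ) < m := by exact_mod_cast hm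
  set n := m + 1 with hn
  set N := n + 1 with hN
  have hN0 : (0 : ℝ) < N := by positivity
  have hn0 : (0 : ℝ) < n := by positivity
  have hζ := Complex.isPrimitiveRoot_exp (2 * N) (by omega)
  set ζ := Complex.exp (2 * Real.pi * Complex.I / ((2 * N : ℕ) : ℂ))
  have hζ1 : ‖ζ‖ = 1 := hζ.norm'_eq_one (by omega)
  set r := κ / m with hr
  have hr0 : 0 < r := by positivity
  set a : ℕ → ℕ → ℝ := fun k j =>
    (((ζ ^ 2) ^ k)⁻¹ * ((ζ ^ j) ^ n)⁻¹).re * (N * (N * (n * r)))⁻¹ with ha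
  have ha1 : ∀ k j, |a k j| ≤ (N * (N * (n * r)))⁻¹ := fun k j => by
    rw [ha, abs_mul, abs_of_nonneg (by positivity : 0 ≤ ((N : ℝ) * (N * (n * r)))⁻¹)]
    refine mul_le_of_le_one_left (by positivity) ((Complex.abs_re_le_norm _).trans ?_)
    simp [hζ1]
  have hs : ∀ k, ‖(ζ ^ 2) ^ k * (r : ℂ)‖ = r := fun k => by simp [hζ1, hr0.le]
  have hsum := IsLipschitzDC.sum (s := Finset.range N) fun k _ =>
    IsLipschitzDC.sum (s := Finset.range N) fun j _ =>
      (isLipschitzDC_traceFun_pow hB hκ.le (by omega : 2 ≤ n) (z := ζ ^ j) (by simp [hζ1])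
        ((ζ ^ 2) ^ k * (r : ℂ))).const_mul (a k j)
  refine (hsum.mono frobDist_nonneg ?_).congr fun X _ => ?_
  · simp only [hs]
    have hle : ∑ k ∈ Finset.range N, ∑ j ∈ Finset.range N,
        |a k j| * (4 * (n * (2 * (κ + r)) ^ (n - 1)) * √(Fintype.card ι)) ≤
        ∑ k ∈ Finset.range N, ∑ j ∈ Finset.range N, ((N : ℝ) * (N * (n * r)))⁻¹ *
          (4 * (n * (2 * (κ + r)) ^ (n - 1)) * √(Fintype.card ι)) :=
      Finset.sum_le_sum fun k _ => Finset.sum_le_sum fun j _ =>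
        mul_le_mul_of_nonneg_right (ha1 k j) (by positivity)
    refine hle.trans ?_
    obtain ⟨l, rfl⟩ : ∃ l, m = l + 1 := ⟨m - 1, by omega⟩
    have h1 : (1 + 1 / ((l + 1 : ℕ) : ℝ)) ^ (l + 1) ≤ Real.exp 1 := by
      refine (pow_le_pow_left₀ (by positivity)
        ((add_comm _ _).trans_le (Real.add_one_le_exp _)) _).trans_eq ?_
      rw [← Real.exp_nat_mul, mul_one_div_cancel hm0.ne']
    have h2 : ((l + 1 : ℕ) : ℝ) ≤ Real.exp 1 ^ l := by
      rw [← Real.exp_nat_mul, mul_one, Nat.cast_succ]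
      exact Real.add_one_le_exp _
    have h3 : 2 * (κ + r) = 2 * κ * (1 + 1 / ((l + 1 : ℕ) : ℝ)) := by
      rw [hr]
      ring
    calc _ = 4 * √(Fintype.card ι) * (2 * (κ + r)) ^ (l + 1) / r := by
          simp only [Finset.sum_const, Finset.card_range, nsmul_eq_mul, hn, Nat.add_sub_cancel]
          rw [← hn]
          field_simp
      _ = 8 * √(Fintype.card ι) * (2 * κ) ^ l * (((l + 1 : ℕ) : ℝ) *
          (1 + 1 / ((l + 1 : ℕ) : ℝ)) ^ (l + 1)) := by
          rw [h3, mul_pow, hr, pow_succ (2 * κ)]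
          field_simp
          ring
      _ ≤ 8 * √(Fintype.card ι) * (2 * κ) ^ l * (Real.exp 1 ^ l * Real.exp 1) := by gcongr
      _ = _ := by
          rw [Nat.add_sub_cancel, mul_assoc 2, mul_left_comm 2, mul_pow]
          ring
  · have key := sum_trace_add_conjTranspose_pow (X.map Complex.ofReal)
      ((r : ℂ) • B.map Complex.ofReal) hζ (by omega : 1 ≤ n) (by omega : n < N)
    have htr : (((r : ℂ) • B.map Complex.ofReal) * X.map Complex.ofReal ^ (n - 1)).trace =
        ((r * (B * X ^ m).trace : ℝ) : ℂ) := by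
      have hmap : (B * X ^ m).map Complex.ofReal =
          B.map Complex.ofReal * X.map Complex.ofReal ^ m := by
        change Complex.ofRealHom.mapMatrix _ = Complex.ofRealHom.mapMatrix B *
          Complex.ofRealHom.mapMatrix X ^ m
        rw [map_mul, map_pow]
      rw [hn, Nat.add_sub_cancel, smul_mul_assoc, trace_smul, ← hmap, Complex.ofReal_mul,
        smul_eq_mul]
      simp [trace]
    rw [htr] at key
    simp only [trace_add_conjTranspose_pow, smul_smul] at key
    have key' := congrArg Complex.re key
    rw [Complex.re_sum] at key'
    simp only [Complex.re_sum, Complex.re_mul_ofReal] at key'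
    rw [show (N : ℂ) * (N * (n * ((r * (B * X ^ m).trace : ℝ) : ℂ))) =
      ((N * (N * (n * (r * (B * X ^ m).trace))) : ℝ) : ℂ) by push_cast; ring,
      Complex.ofReal_re] at key'
    simp only [ha, mul_right_comm _ ((N : ℝ) * (N * (n * r)))⁻¹]
    simp only [← Finset.sum_mul]
    rw [key']
    field_simp

end Matrix

section Concentration

variable {Ω : Type*} [MeasurableSpace Ω] {μ : Measure Ω}

/-- If the Bochner integral, possibly a junk value, is a good center for all translates of `Z`,
then `Z` is integrable. -/
theorem integrable_of_forall_measure_abs_add_sub_integral_le [IsProbabilityMeasure μ]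
    {Z : Ω → ℝ} {t : ℝ} {δ : ℝ≥0∞}
    (hδ : 2 * δ < 1) (h : ∀ a : ℝ, μ {ω | t ≤ |Z ω + a - ∫ ω', (Z ω' + a) ∂μ|} ≤ δ) :
    Integrable Z μ := by
  by_contra hZ
  have hint : ∀ a : ℝ, ∫ ω', (Z ω' + a) ∂μ = 0 := fun a =>
    integral_undef fun hi => hZ <| by simpa [Pi.sub_def] using hi.sub (integrable_const a)
  simp only [hint, sub_zero] at h
  have hcover : (Set.univ : Set Ω) ⊆ {ω | t ≤ |Z ω + 0|} ∪ {ω | t ≤ |Z ω + 2 * t|} := by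
    intro ω _
    simp only [Set.mem_union, Set.mem_ofPred_eq]
    by_contra! hcon
    rw [abs_lt, abs_lt] at hcon
    linarith [hcon.1.1, hcon.2.2]
  have := calc (1 : ℝ≥0∞) = μ Set.univ := measure_univ.symm
    _ ≤ δ + δ := (measure_mono hcover).trans ((measure_union_le _ _).trans
        (add_le_add (h 0) (h (2 * t))))
    _ = 2 * δ := (two_mul δ).symm
  exact absurd hδ this.not_gt

theorem exists_pos_two_mul_ofReal_exp_neg_rpow_lt_one (C : ℝ) {s q : ℝ} (hs : 0 < s) (hq : 0 < q) :
    ∃ t : ℝ, 0 < t ∧ 2 * ENNReal.ofReal (C * Real.exp (-(t / s) ^ q)) < 1 := by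
  have h1 : Filter.Tendsto (fun t : ℝ => 2 * ENNReal.ofReal (C * Real.exp (-(t / s) ^ q)))
      Filter.atTop (nhds (2 * ENNReal.ofReal (C * 0))) := by
    refine ENNReal.Tendsto.const_mul (ENNReal.tendsto_ofReal (Filter.Tendsto.const_mul C ?_))
      (Or.inr ENNReal.ofNat_ne_top)
    exact Real.tendsto_exp_neg_atTop_nhds_zero.comp
      ((tendsto_rpow_atTop hq).comp (Filter.tendsto_id.atTop_div_const hs))
  obtain ⟨t, h⟩ := ((h1.eventually_lt_const (u := 1) (by simp)).and
    (Filter.eventually_gt_atTop 0)).exists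
  exact ⟨t, h.2, h.1⟩

theorem lintegral_Ioi_ofReal_exp_neg_rpow {D s q : ℝ} (hD : 0 ≤ D) (hs : 0 < s) (hq : 0 < q) :
    ∫⁻ t in Set.Ioi (0 : ℝ), ENNReal.ofReal (D * Real.exp (-(t / s) ^ q)) =
      ENNReal.ofReal (D * (s * Real.Gamma (1 / q + 1))) := by
  have hb : 0 < s ^ (-q) := Real.rpow_pos_of_pos hs _
  have hcongr : ∀ t ∈ Set.Ioi (0 : ℝ), D * Real.exp (-(t / s) ^ q) =
      D * Real.exp (-s ^ (-q) * t ^ q) := fun t ht => by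
    rw [Real.div_rpow (le_of_lt ht) hs.le, Real.rpow_neg hs.le, div_eq_inv_mul, neg_mul]
  have hint : IntegrableOn (fun t : ℝ => D * Real.exp (-s ^ (-q) * t ^ q)) (Set.Ioi 0) := by
    simpa using! (integrableOn_rpow_mul_exp_neg_mul_rpow neg_one_lt_zero hq hb).const_mul D
  rw [setLIntegral_congr_fun measurableSet_Ioi fun t ht => congrArg ENNReal.ofReal (hcongr t ht),
    ← ofReal_integral_eq_lintegral_ofReal hint (Filter.Eventually.of_forall fun t => by positivity),
    integral_const_mul, integral_exp_neg_mul_rpow hq hb, ← Real.rpow_mul hs.le]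
  congr 4
  rw [neg_mul, mul_div_assoc', mul_neg_one, neg_div, neg_neg, div_self hq.ne', Real.rpow_one]

theorem integrable_and_abs_integral_sub_le_of_tail [IsProbabilityMeasure μ]
    {Y : Ω → ℝ} (hY : AEStronglyMeasurable Y μ)
    {a D s q : ℝ} (hD : 0 ≤ D) (hs : 0 < s) (hq : 0 < q)
    (h : ∀ t : ℝ, 0 < t →
      μ {ω | t ≤ |Y ω - a|} ≤ ENNReal.ofReal (D * Real.exp (-(t / s) ^ q))) :
    Integrable Y μ ∧ |∫ ω, Y ω ∂μ - a| ≤ D * (s * Real.Gamma (1 / q + 1)) := by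
  have hΓ : 0 ≤ D * (s * Real.Gamma (1 / q + 1)) :=
    mul_nonneg hD (mul_nonneg hs.le (Real.Gamma_nonneg_of_nonneg (by positivity)))
  have hYa : AEStronglyMeasurable (fun ω => Y ω - a) μ := hY.sub aestronglyMeasurable_const
  have hle : ∫⁻ ω, ENNReal.ofReal |Y ω - a| ∂μ ≤
      ENNReal.ofReal (D * (s * Real.Gamma (1 / q + 1))) := by
    rw [lintegral_eq_lintegral_meas_le μ (Filter.Eventually.of_forall fun ω => abs_nonneg _)
      hYa.norm.aemeasurable, ← lintegral_Ioi_ofReal_exp_neg_rpow hD hs hq]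
    exact setLIntegral_mono' measurableSet_Ioi fun t ht => h t ht
  have hint : Integrable (fun ω => Y ω - a) μ :=
    ⟨hYa, (hasFiniteIntegral_iff_norm _).mpr (lt_of_le_of_lt hle ENNReal.ofReal_lt_top)⟩
  have hYi : Integrable Y μ := by simpa [Pi.add_def] using hint.add (integrable_const a)
  refine ⟨hYi, ?_⟩
  have heq : ∫ ω, Y ω ∂μ - a = ∫ ω, (Y ω - a) ∂μ := by
    rw [integral_sub hYi (integrable_const a)]
    simp
  rw [heq]
  refine (abs_integral_le_integral_abs).trans ?_
  rw [integral_eq_lintegral_of_nonneg_ae (Filter.Eventually.of_forall fun ω => abs_nonneg _)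
    hYa.norm]
  exact ENNReal.toReal_le_of_le_ofReal hΓ hle

theorem measure_abs_sub_integral_le_of_tail [IsProbabilityMeasure μ]
    {Y : Ω → ℝ} (hY : AEStronglyMeasurable Y μ)
    {a D s q : ℝ} (hD : 1 ≤ D) (hs : 0 < s) (hq : 0 < q)
    (h : ∀ t : ℝ, 0 < t →
      μ {ω | t ≤ |Y ω - a|} ≤ ENNReal.ofReal (D * Real.exp (-(t / s) ^ q))) {t : ℝ} (ht : 0 < t) :
    μ {ω | t ≤ |Y ω - ∫ ω', Y ω' ∂μ|} ≤ ENNReal.ofReal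
      (D * Real.exp ((D * Real.Gamma (1 / q + 1)) ^ q) * Real.exp (-(t / (2 * s)) ^ q)) := by
  have hb := (integrable_and_abs_integral_sub_le_of_tail hY (by linarith) hs hq h).2
  set G := Real.Gamma (1 / q + 1)
  have hG : 0 ≤ G := Real.Gamma_nonneg_of_nonneg (by positivity)
  rcases le_total (2 * (D * (s * G))) t with hcase | hcase
  · have hsub : {ω | t ≤ |Y ω - ∫ ω', Y ω' ∂μ|} ⊆ {ω | t / 2 ≤ |Y ω - a|} := by
      intro ω hω
      simp only [Set.mem_ofPred_eq] at hω ⊢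
      have := abs_sub_le (Y ω) a (∫ ω', Y ω' ∂μ)
      rw [abs_sub_comm a] at this
      linarith
    refine (measure_mono hsub).trans ((h _ (half_pos ht)).trans (ENNReal.ofReal_le_ofReal ?_))
    rw [div_div]
    refine mul_le_mul_of_nonneg_right ?_ (Real.exp_pos _).le
    exact le_mul_of_one_le_right (by linarith)
      (Real.one_le_exp (Real.rpow_nonneg (by positivity) _))
  · refine prob_le_one.trans (ENNReal.one_le_ofReal.mpr ?_)
    rw [mul_assoc, ← Real.exp_add]
    refine one_le_mul_of_one_le_of_one_le hD (Real.one_le_exp ?_)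
    have : (t / (2 * s)) ^ q ≤ (D * G) ^ q := by
      refine Real.rpow_le_rpow (by positivity) ?_ hq.le
      rw [div_le_iff₀ (by positivity)]
      linarith
    linarith

/-- Quasi-convex concentration of a random matrix, with respect to the Frobenius norm. -/
def IsConvexlyConcentrated {p : ℕ} (μ : Measure Ω) (X : Ω → Matrix (Fin p) (Fin p) ℝ)
    (C s q : ℝ) : Prop :=
  ∀ f : Matrix (Fin p) (Fin p) ℝ → ℝ, (∀ u : ℝ, Convex ℝ {M | f M ≤ u}) →
    (∀ M N, |f M - f N| ≤ Matrix.frobDist M N) → ∀ t : ℝ, 0 < t →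
      μ {ω | t ≤ |f (X ω) - ∫ ω', f (X ω') ∂μ|} ≤ ENNReal.ofReal (C * Real.exp (-(t / s) ^ q))

namespace IsConvexlyConcentrated

variable {p : ℕ} {X : Ω → Matrix (Fin p) (Fin p) ℝ} {C s q : ℝ}

theorem measure_convexOn_le (hX : IsConvexlyConcentrated μ X C s q)
    {g : Matrix (Fin p) (Fin p) ℝ → ℝ} (hg : ConvexOn ℝ Set.univ g) {Λ : ℝ} (hΛ : 0 < Λ)
    (hgΛ : ∀ M N, |g M - g N| ≤ Λ * Matrix.frobDist M N) {t : ℝ} (ht : 0 < t) :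
    μ {ω | t ≤ |g (X ω) - ∫ ω', g (X ω') ∂μ|} ≤
      ENNReal.ofReal (C * Real.exp (-(t / (Λ * s)) ^ q)) := by
  have h := hX (fun M => Λ⁻¹ * g M) (fun u => ?_) (fun M N => ?_) (Λ⁻¹ * t) (by positivity)
  · refine (measure_mono fun ω hω => ?_).trans (h.trans_eq ?_)
    · rw [Set.mem_ofPred_eq] at hω ⊢
      rw [integral_const_mul, ← mul_sub, abs_mul, abs_of_pos (inv_pos.mpr hΛ)]
      exact mul_le_mul_of_nonneg_left hω (inv_pos.mpr hΛ).le
    · rw [← div_eq_inv_mul, div_div]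
  · have := (hg.smul (inv_pos.mpr hΛ).le).convex_le u
    simpa using this
  · rw [← mul_sub, abs_mul, abs_of_pos (inv_pos.mpr hΛ), inv_mul_le_iff₀ hΛ]
    exact hgΛ M N

theorem aestronglyMeasurable_apply [IsProbabilityMeasure μ]
    (hX : IsConvexlyConcentrated μ X C s q) (hs : 0 < s)
    (hq : 0 < q) (i j : Fin p) : AEStronglyMeasurable (fun ω => X ω i j) μ := by
  obtain ⟨t, ht, hlt⟩ := exists_pos_two_mul_ofReal_exp_neg_rpow_lt_one C hs hq
  refine (integrable_of_forall_measure_abs_add_sub_integral_le (t := t) hlt fun a =>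
    hX (fun M => M i j + a) (fun u => ?_) (fun M N => ?_) t ht).aestronglyMeasurable
  · have : ConvexOn ℝ Set.univ (fun M : Matrix (Fin p) (Fin p) ℝ => M i j + a) :=
      ((Matrix.entryLinearMap ℝ ℝ i j).convexOn convex_univ).add_const a
    simpa using this.convex_le u
  · rw [add_sub_add_right_eq_sub, ← Real.sqrt_sq_eq_abs]
    refine Real.sqrt_le_sqrt ?_
    refine (Finset.single_le_sum (f := fun j => (M i j - N i j) ^ 2)
      (fun _ _ => sq_nonneg _) (Finset.mem_univ j)).trans ?_
    exact Finset.single_le_sum (f := fun i => ∑ j, (M i j - N i j) ^ 2)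
      (fun _ _ => Finset.sum_nonneg fun _ _ => sq_nonneg _) (Finset.mem_univ i)

theorem aestronglyMeasurable_pow_apply [IsProbabilityMeasure μ]
    (hX : IsConvexlyConcentrated μ X C s q) (hs : 0 < s)
    (hq : 0 < q) (m : ℕ) (i j : Fin p) : AEStronglyMeasurable (fun ω => (X ω ^ m) i j) μ := by
  induction m generalizing i j with
  | zero => exact aestronglyMeasurable_const
  | succ m ih =>
    simp only [pow_succ, Matrix.mul_apply]
    exact Finset.aestronglyMeasurable_fun_sum _ fun k _ =>
      (ih i k).mul (hX.aestronglyMeasurable_apply hs hq k j)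

theorem exists_measure_inter_isLipschitzDC_le (hX : IsConvexlyConcentrated μ X C s q) (hC : 0 ≤ C)
    {Λ : ℝ} (hΛ : 0 < Λ) {S : Set (Matrix (Fin p) (Fin p) ℝ)} {f : Matrix (Fin p) (Fin p) ℝ → ℝ}
    (hf : IsLipschitzDC Matrix.frobDist Λ S f) {A : Set Ω} (hA : ∀ ω ∈ A, X ω ∈ S) :
    ∃ a : ℝ, ∀ t : ℝ, 0 < t → μ (A ∩ {ω | t ≤ |f (X ω) - a|}) ≤
      ENNReal.ofReal (2 * C * Real.exp (-(t / (2 * (Λ * s))) ^ q)) := by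
  obtain ⟨g₁, g₂, h₁, h₂, h₃, h₄, h₅⟩ := hf
  refine ⟨∫ ω, g₁ (X ω) ∂μ - ∫ ω, g₂ (X ω) ∂μ, fun t ht => ?_⟩
  have hsub : A ∩ {ω | t ≤ |f (X ω) - (∫ ω, g₁ (X ω) ∂μ - ∫ ω, g₂ (X ω) ∂μ)|} ⊆
      {ω | t / 2 ≤ |g₁ (X ω) - ∫ ω', g₁ (X ω') ∂μ|} ∪
        {ω | t / 2 ≤ |g₂ (X ω) - ∫ ω', g₂ (X ω') ∂μ|} := by
    rintro ω ⟨hωA, hω⟩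
    simp only [Set.mem_union, Set.mem_ofPred_eq] at hω ⊢
    rw [h₅ _ (hA ω hωA), sub_sub_sub_comm] at hω
    by_contra! hcon
    linarith [abs_sub (g₁ (X ω) - ∫ ω', g₁ (X ω') ∂μ) (g₂ (X ω) - ∫ ω', g₂ (X ω') ∂μ), hcon.1,
      hcon.2]
  refine (measure_mono hsub).trans ((measure_union_le _ _).trans ((add_le_add
    (hX.measure_convexOn_le h₁ hΛ h₃ (half_pos ht))
    (hX.measure_convexOn_le h₂ hΛ h₄ (half_pos ht))).trans_eq ?_))
  rw [← ENNReal.ofReal_add (by positivity) (by positivity), div_div]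
  ring_nf

end IsConvexlyConcentrated

theorem cond_le_ofReal_two_mul [IsProbabilityMeasure μ]
    {A T : Set Ω} (hA : MeasurableSet A) (hA2 : 1 ≤ 2 * μ A) {x : ℝ}
    (h : μ (A ∩ T) ≤ ENNReal.ofReal x) : ProbabilityTheory.cond μ A T ≤ ENNReal.ofReal (2 * x) := by
  have hinv : (μ A)⁻¹ ≤ 2 := by
    rw [ENNReal.inv_le_iff_le_mul (by simp) (by simp [measure_ne_top])]
    exact hA2.trans_eq (mul_comm _ _)
  rw [cond_apply hA, ENNReal.ofReal_mul zero_le_two, ENNReal.ofReal_ofNat]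
  exact mul_le_mul' hinv h

end Concentration

namespace Matrix

variable {ι : Type*} [Fintype ι]

theorem sum_mulVec_sq_le_of_not_exists {X : Matrix ι ι ℝ} {κ : ℝ} (hκ : 0 ≤ κ)
    (h : ¬∃ v : ι → ℝ, √(∑ i, v i ^ 2) ≤ 1 ∧ κ < √(∑ i, (X *ᵥ v) i ^ 2)) (v : ι → ℝ) :
    ∑ i, (X *ᵥ v) i ^ 2 ≤ κ ^ 2 * ∑ i, v i ^ 2 := by
  push Not at h
  have hv0 : 0 ≤ ∑ i, v i ^ 2 := Finset.sum_nonneg fun _ _ => sq_nonneg _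
  rcases hv0.eq_or_lt with h0 | hpos
  · have hv : v = 0 := by
      ext i
      simpa using (Finset.sum_eq_zero_iff_of_nonneg fun _ _ => sq_nonneg _).mp h0.symm i
        (Finset.mem_univ i)
    simp [hv]
  · have hr : 0 < √(∑ i, v i ^ 2) := Real.sqrt_pos.mpr hpos
    have hr2 := Real.sq_sqrt hv0
    set r := √(∑ i, v i ^ 2)
    have h1 := h (r⁻¹ • v) (Real.sqrt_le_one.mpr ?_)
    · rw [Real.sqrt_le_left hκ, mulVec_smul] at h1
      simp only [Pi.smul_apply, smul_eq_mul, mul_pow, ← Finset.mul_sum] at h1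
      rw [inv_pow, inv_mul_le_iff₀ (by positivity), hr2] at h1
      linarith
    · simp only [Pi.smul_apply, smul_eq_mul, mul_pow, ← Finset.mul_sum]
      rw [inv_pow, ← hr2, inv_mul_cancel₀ (by positivity)]

theorem sum_single_mulVec_sq_le [DecidableEq ι] (i j : ι) (v : ι → ℝ) :
    ∑ k, (single i j (1 : ℝ) *ᵥ v) k ^ 2 ≤ 1 ^ 2 * ∑ k, v k ^ 2 := by
  rw [Finset.sum_eq_single i]
  · simpa [single_mulVec] using
      Finset.single_le_sum (f := fun k => v k ^ 2) (fun _ _ => sq_nonneg _) (Finset.mem_univ j)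
  · intro k _ hk
    simp [single_mulVec, hk]
  · simp

end Matrix

open scoped Matrix in
theorem IsConvexlyConcentrated.exists_cond_trace_mul_pow_le {Ω : Type*} [MeasurableSpace Ω]
    {μ : Measure Ω} [IsProbabilityMeasure μ] {p m : ℕ} (hp : 1 ≤ p) (hm : 1 ≤ m)
    {X : Ω → Matrix (Fin p) (Fin p) ℝ} {C s q κ : ℝ} (hX : IsConvexlyConcentrated μ X C s q)
    (hC : 1 ≤ C) (hs : 0 < s) (hq : 0 < q) (hκ : 0 < κ) {A : Set Ω} (hA : MeasurableSet A)
    (hA2 : 1 ≤ 2 * μ A)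
    (hXA : ∀ ω ∈ A, ∀ v : Fin p → ℝ, ∑ i, (X ω *ᵥ v) i ^ 2 ≤ κ ^ 2 * ∑ i, v i ^ 2) :
    ∃ Mt : Matrix (Fin p) (Fin p) ℝ, ∀ B : Matrix (Fin p) (Fin p) ℝ,
      (∀ v : Fin p → ℝ, ∑ i, (B *ᵥ v) i ^ 2 ≤ 1 ^ 2 * ∑ i, v i ^ 2) → ∀ t : ℝ, 0 < t →
        ProbabilityTheory.cond μ A {ω | t ≤ |(B * X ω ^ m).trace - (B * Mt).trace|} ≤
          ENNReal.ofReal (4 * C * Real.exp ((4 * C * Real.Gamma (1 / q + 1)) ^ q) *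
            Real.exp (-(t / (2 * (2 *
              (8 * Real.exp 1 * √p * (2 * Real.exp 1 * κ) ^ (m - 1) * s)))) ^ q)) := by
  have hA0 : μ A ≠ 0 := fun h0 => by simp [h0] at hA2
  have := cond_isProbabilityMeasure hA0
  set ν := ProbabilityTheory.cond μ A
  have hp0 : (0 : ℝ) < p := by exact_mod_cast hp
  set Λ := 8 * Real.exp 1 * √p * (2 * Real.exp 1 * κ) ^ (m - 1) with hΛ
  have hΛ0 : 0 < Λ := by positivity
  have htail : ∀ B : Matrix (Fin p) (Fin p) ℝ,
      (∀ v : Fin p → ℝ, ∑ i, (B *ᵥ v) i ^ 2 ≤ 1 ^ 2 * ∑ i, v i ^ 2) →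
      ∃ a : ℝ, ∀ t : ℝ, 0 < t → ν {ω | t ≤ |(B * X ω ^ m).trace - a|} ≤
        ENNReal.ofReal (4 * C * Real.exp (-(t / (2 * (Λ * s))) ^ q)) := fun B hB => by
    have hDC := Matrix.isLipschitzDC_trace_mul_pow hB hκ hm
    rw [Fintype.card_fin] at hDC
    obtain ⟨a, ha⟩ := hX.exists_measure_inter_isLipschitzDC_le (by linarith) hΛ0 hDC hXA
    refine ⟨a, fun t ht => (cond_le_ofReal_two_mul hA hA2 (ha t ht)).trans_eq ?_⟩
    ring_nf
  have hmeas : ∀ i j, AEStronglyMeasurable (fun ω => (X ω ^ m) i j) ν := fun i j =>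
    (hX.aestronglyMeasurable_pow_apply hs hq m i j).mono_ac cond_absolutelyContinuous
  have hint : ∀ i j, Integrable (fun ω => (X ω ^ m) i j) ν := fun i j => by
    obtain ⟨a, ha⟩ := htail _ (Matrix.sum_single_mulVec_sq_le j i)
    simp only [Matrix.trace_single_mul, one_smul] at ha
    exact (integrable_and_abs_integral_sub_le_of_tail (hmeas i j) (by positivity) (by positivity)
      hq ha).1
  refine ⟨Matrix.of fun i j => ∫ ω, (X ω ^ m) i j ∂ν, fun B hB t ht => ?_⟩
  obtain ⟨a, ha⟩ := htail B hB
  have hsum : ∀ M : Matrix (Fin p) (Fin p) ℝ, (B * M).trace = ∑ i, ∑ j, B i j * M j i :=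
    fun M => by simp [Matrix.trace, Matrix.mul_apply]
  have hmean : (B * Matrix.of fun i j => ∫ ω, (X ω ^ m) i j ∂ν).trace =
      ∫ ω, (B * X ω ^ m).trace ∂ν := by
    simp only [hsum, Matrix.of_apply]
    rw [integral_finsetSum _ fun i _ => integrable_finsetSum _ fun j _ =>
      (hint j i).const_mul (B i j)]
    refine Finset.sum_congr rfl fun i _ => ?_
    rw [integral_finsetSum _ fun j _ => (hint j i).const_mul (B i j)]
    exact Finset.sum_congr rfl fun j _ => (integral_const_mul _ _).symm
  have hmeasB : AEStronglyMeasurable (fun ω => (B * X ω ^ m).trace) ν := by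
    simp only [hsum]
    exact Finset.aestronglyMeasurable_fun_sum _ fun i _ =>
      Finset.aestronglyMeasurable_fun_sum _ fun j _ => (hmeas j i).const_mul (B i j)
  rw [hmean]
  exact measure_abs_sub_integral_le_of_tail hmeasB (by linarith) (by positivity) hq ha ht

/-- Linear concentration (in nuclear norm, expressed through traces against matrices of unit
operator norm) of the powers `X^m` of a convexly concentrated random matrix whose operator norm
is bounded by `κ` with high probability; the constants depend only on `C`, `c` and `q`. -/
theorem stmt11 (C c q : ℝ) (hC : 1 ≤ C) (hc : 0 < c) (hq : 0 < q) :
    ∃ C' c' : ℝ, 1 ≤ C' ∧ 0 < c' ∧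
      ∀ (Ω : Type u) [MeasurableSpace Ω] (μ : Measure Ω) [IsProbabilityMeasure μ]
        (p m : ℕ), 1 ≤ p → 1 ≤ m →
        ∀ (σ κ : ℝ), 0 < σ → 0 < κ →
        ∀ X : Ω → Matrix (Fin p) (Fin p) ℝ,
          -- (i) convex concentration of `X` for the Frobenius norm
          (∀ f : Matrix (Fin p) (Fin p) ℝ → ℝ,
            (∀ u : ℝ, Convex ℝ {M | f M ≤ u}) →
            (∀ M N : Matrix (Fin p) (Fin p) ℝ,
              |f M - f N| ≤ Real.sqrt (∑ i, ∑ j, (M i j - N i j) ^ 2)) →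
            ∀ t : ℝ, 0 < t →
              μ {ω | t ≤ |f (X ω) - ∫ ω', f (X ω') ∂μ|} ≤
                ENNReal.ofReal (C * Real.exp (-(t / (c * σ)) ^ q))) →
          -- (ii) the operator norm of `X` exceeds `κ` with exponentially small probability
          μ {ω | ∃ v : Fin p → ℝ, Real.sqrt (∑ i, v i ^ 2) ≤ 1 ∧
              κ < Real.sqrt (∑ i, ((X ω).mulVec v i) ^ 2)} ≤
            ENNReal.ofReal (C * Real.exp (-(c * p))) →
          ∃ (A : Set Ω) (Mt : Matrix (Fin p) (Fin p) ℝ),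
            μ Aᶜ ≤ ENNReal.ofReal (C' * Real.exp (-(p / c'))) ∧
            ∀ B : Matrix (Fin p) (Fin p) ℝ,
              (∀ v : Fin p → ℝ,
                Real.sqrt (∑ i, (B.mulVec v i) ^ 2) ≤ Real.sqrt (∑ i, v i ^ 2)) →
              ∀ t : ℝ, 0 < t →
                ProbabilityTheory.cond μ A
                    {ω | t ≤ |Matrix.trace (B * X ω ^ m) - Matrix.trace (B * Mt)|} ≤
                  ENNReal.ofReal (C' * Real.exp
                    (-(t / (c' * Real.sqrt p * (2 * Real.exp 1 * κ) ^ (m - 1) * σ)) ^ q)) := by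
  set D := 4 * C * Real.exp ((4 * C * Real.Gamma (1 / q + 1)) ^ q) with hD
  set K := 1 / c + 32 * Real.exp 1 * c with hK
  have hΓ : 0 ≤ Real.Gamma (1 / q + 1) := Real.Gamma_nonneg_of_nonneg (by positivity)
  have hDC : 4 * C ≤ D := le_mul_of_one_le_right (by positivity)
    (Real.one_le_exp (Real.rpow_nonneg (by positivity) _))
  have hK0 : 0 < K := by positivity
  refine ⟨D, K, by linarith, hK0, ?_⟩
  intro Ω _ μ _ p m hp hm σ κ hσ hκ X hX hbad
  have hconc : IsConvexlyConcentrated μ X C (c * σ) q := hX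
  set bad := {ω | ∃ v : Fin p → ℝ, Real.sqrt (∑ i, v i ^ 2) ≤ 1 ∧
    κ < Real.sqrt (∑ i, ((X ω).mulVec v i) ^ 2)}
  have hexp : 2 * (C * Real.exp (-(c * p))) ≤ D * Real.exp (-(p / K)) := by
    rw [← mul_assoc]
    refine mul_le_mul (by linarith) (Real.exp_le_exp.mpr (neg_le_neg ?_)) (Real.exp_pos _).le
      (by linarith)
    rw [div_le_iff₀ hK0, mul_right_comm]
    refine le_mul_of_one_le_left (Nat.cast_nonneg p) ?_
    rw [hK, mul_add, mul_one_div_cancel hc.ne']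
    exact le_add_of_nonneg_right (by positivity)
  have hAm : MeasurableSet (toMeasurable μ bad)ᶜ := (measurableSet_toMeasurable μ bad).compl
  by_cases hA2 : 1 ≤ 2 * μ (toMeasurable μ bad)ᶜ
  · obtain ⟨Mt, hMt⟩ := hconc.exists_cond_trace_mul_pow_le hp hm hC (mul_pos hc hσ) hq hκ hAm hA2
      fun ω hω => Matrix.sum_mulVec_sq_le_of_not_exists hκ.le
        fun h => hω (subset_toMeasurable μ bad h)
    refine ⟨_, Mt, ?_, fun B hB t ht => (hMt B (fun v => ?_) t ht).trans
      (ENNReal.ofReal_le_ofReal ?_)⟩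
    · rw [compl_compl, measure_toMeasurable]
      refine hbad.trans (ENNReal.ofReal_le_ofReal (le_trans ?_ hexp))
      linarith [mul_pos (by linarith : 0 < C) (Real.exp_pos (-(c * p)))]
    · rw [one_pow, one_mul]
      exact (Real.sqrt_le_sqrt_iff (Finset.sum_nonneg fun _ _ => sq_nonneg _)).mp (hB v)
    · have hp0 : (0 : ℝ) < p := by exact_mod_cast hp
      refine mul_le_mul_of_nonneg_left (Real.exp_le_exp.mpr (neg_le_neg ?_)) (by linarith)
      refine Real.rpow_le_rpow (by positivity) ?_ hq.le
      refine div_le_div_of_nonneg_left ht.le (by positivity) ?_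
      rw [show 2 * (2 * (8 * Real.exp 1 * √p * (2 * Real.exp 1 * κ) ^ (m - 1) * (c * σ))) =
        32 * Real.exp 1 * c * √p * (2 * Real.exp 1 * κ) ^ (m - 1) * σ by ring]
      gcongr
      exact le_add_of_nonneg_left (by positivity)
  · refine ⟨∅, 0, ?_, fun B _ t _ => by simp⟩
    rw [Set.compl_empty, measure_univ]
    refine le_trans ?_ (ENNReal.ofReal_le_ofReal hexp)
    rw [ENNReal.ofReal_mul zero_le_two, ENNReal.ofReal_ofNat]
    refine le_trans ?_ (mul_le_mul' le_rfl hbad)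
    have htwo : (1 : ℝ≥0∞) + 1 =
        2 * μ (toMeasurable μ bad)ᶜ + 2 * μ (toMeasurable μ bad) := by
      rw [← mul_add, add_comm (μ _), measure_add_measure_compl (measurableSet_toMeasurable μ bad),
        measure_univ, mul_one, one_add_one_eq_two]
    rw [← measure_toMeasurable bad]
    by_contra! hlt
    exact absurd htwo (ENNReal.add_lt_add (not_le.mp hA2) hlt).ne'
end

section
/- Let R be a (possibly non-commutative) ring, let m ≥ 1 be an integer and let a_1, …, a_m ∈ R. Then (−1)^m · Σ_{σ ∈ S_m} a_{σ(1)}·a_{σ(2)}·⋯·a_{σ(m)} = Σ_{I ⊆ {1,…,m}} (−1)^{|I|} · (Σ_{i ∈ I} a_i)^m, where S_m is the group of permutations of {1,…,m}, the product a_{σ(1)}⋯a_{σ(m)} is taken in this order, the outer sum ranges over all subsets I of {1,…,m} (including the empty set, an empty sum being 0), and |I| is the cardinality of I. -/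
/-- The alternating sum of `(-1) ^ |I|` over the supersets `I` of `S` vanishes unless `S` is
everything. -/
theorem sum_superset_neg_one_pow_card {ι R : Type*} [Fintype ι] [DecidableEq ι] [Ring R]
    (S : Finset ι) :
    ∑ I : Finset ι, (if S ⊆ I then (-1 : R) ^ I.card else 0) =
      if S = Finset.univ then (-1) ^ Fintype.card ι else 0 := by
  have h_int : ∑ I : Finset ι, (if S ⊆ I then (-1 : ℤ) ^ I.card else 0) =
      if S = Finset.univ then (-1) ^ Fintype.card ι else 0 := by
    have h := Finset.prod_add (fun _ => (-1 : ℤ)) (fun i => if i ∈ S then 0 else 1) Finset.univ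
    have h_prod : ∏ i, ((-1 : ℤ) + if i ∈ S then 0 else 1) =
        if S = Finset.univ then (-1) ^ Fintype.card ι else 0 := by
      split_ifs with hS
      · simp [hS]
      · obtain ⟨i, hi⟩ : ∃ i, i ∉ S := by simpa [Finset.eq_univ_iff_forall] using hS
        exact Finset.prod_eq_zero (Finset.mem_univ i) (by simp [hi])
    rw [← h_prod, h, Finset.powerset_univ]
    refine Finset.sum_congr rfl fun I _ => ?_
    split_ifs with hSI
    · rw [Finset.prod_const, Finset.prod_eq_one, mul_one]
      intro i hi
      exact if_neg fun hiS => (Finset.mem_sdiff.mp hi).2 (hSI hiS)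
    · obtain ⟨i, hiS, hiI⟩ := Finset.not_subset.mp hSI
      have hi : i ∈ Finset.univ \ I := by simp [hiI]
      rw [Finset.prod_eq_zero hi (by simp [hiS]), mul_zero]
  exact_mod_cast congrArg (Int.cast : ℤ → R) h_int

/-- Expansion of a power of a finite sum in a non-commutative ring as a sum over words. -/
theorem Finset.sum_pow_eq_sum_list_prod {ι R : Type*} [Fintype ι] [DecidableEq ι] [Ring R] (m : ℕ)
    (a : ι → R) (I : Finset ι) :
    (∑ i ∈ I, a i) ^ m =
      ∑ r : Fin m → ι,
        if Finset.univ.image r ⊆ I then (List.ofFn fun k => a (r k)).prod else 0 := by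
  have h := (MultilinearMap.mkPiAlgebraFin ℤ m R).map_sum_finset (fun _ => a) (fun _ => I)
  simp only [MultilinearMap.mkPiAlgebraFin_apply, List.ofFn_const, List.prod_replicate] at h
  rw [h, ← Finset.sum_filter]
  refine Finset.sum_congr ?_ fun _ _ => rfl
  ext r
  simp [Finset.image_subset_iff]

/-- Non-commutative inversion identity: the symmetrized product of `a_1, …, a_m` equals an
inclusion–exclusion sum of `m`-th powers of partial sums. -/
theorem stmt12 {R : Type*} [Ring R] (m : ℕ) (hm : 1 ≤ m) (a : Fin m → R) :
    (-1 : R) ^ m * ∑ σ : Equiv.Perm (Fin m), (List.ofFn fun i => a (σ i)).prod =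
      ∑ I : Finset (Fin m), (-1 : R) ^ I.card * (∑ i ∈ I, a i) ^ m := by
  calc
    _ = ∑ r : Fin m → Fin m, (if Finset.univ.image r = Finset.univ then (-1 : R) ^ m else 0) *
          (List.ofFn fun k => a (r k)).prod := by
      rw [Finset.mul_sum]
      refine Finset.sum_of_injOn (fun σ => ⇑σ) DFunLike.coe_injective.injOn (by simp) ?_ ?_
      · intro r _ hr
        rw [if_neg, zero_mul]
        intro h
        have hb : Function.Bijective r :=
          Finite.surjective_iff_bijective.mp (by simpa [Finset.eq_univ_iff_forall, Function.Surjective] using h)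
        exact hr ⟨Equiv.ofBijective r hb, by simp, rfl⟩
      · intro σ _
        rw [if_pos (Finset.image_univ_of_surjective σ.surjective)]
    _ = ∑ r : Fin m → Fin m, ∑ I : Finset (Fin m),
          (if Finset.univ.image r ⊆ I then (-1 : R) ^ I.card else 0) *
            (List.ofFn fun k => a (r k)).prod := by
      refine Finset.sum_congr rfl fun r _ => ?_
      rw [← Finset.sum_mul, sum_superset_neg_one_pow_card, Fintype.card_fin]
    _ = _ := by
      rw [Finset.sum_comm]
      refine Finset.sum_congr rfl fun I _ => ?_
      rw [Finset.sum_pow_eq_sum_list_prod, Finset.mul_sum]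
      exact Finset.sum_congr rfl fun r _ => by rw [ite_mul, mul_ite, zero_mul, mul_zero]
end

section
/- Let n, p ≥ 1 be integers and let Σ_1, …, Σ_n be real symmetric positive semidefinite p×p matrices with tr(Σ_i) > 0 for every i. For D ∈ ℂ^n set Σ_D = (1/n)·Σ_{j=1}^n D_j·Σ_j, and whenever z·I_p − Σ_D is invertible set I^z(D)_i = (1/n)·tr(Σ_i·(z·I_p − Σ_D)^{−1}). Then: (a) if Im(z) < 0 and Im(D_j) > 0 for all j, the matrix z·I_p − Σ_D is invertible and Im(I^z(D)_i) > 0 for every i; (b) if in addition Re(z) < 0 and Re(D_j) < 0 for all j, then, with χ(w) = 1/(1−w) applied entrywise to D, the matrix z·I_p − Σ_{χ(D)} is invertible and, for every i, Im(I^z(χ(D))_i) > 0 and Re(I^z(χ(D))_i) < 0. -/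
/-- `Σ_D = (1/n)·Σ_j D_j·Σ_j`, as a complex matrix. -/
noncomputable def sigCMat {n p : ℕ} (S : Fin n → Matrix (Fin p) (Fin p) ℝ)
    (D : Fin n → ℂ) : Matrix (Fin p) (Fin p) ℂ :=
  ((n : ℂ))⁻¹ • ∑ j, D j • (S j).map (fun x => (x : ℂ))

/-- `I^z(D)_i = (1/n)·tr(Σ_i·(z·I_p − Σ_D)⁻¹)`. -/
noncomputable def traceIz {n p : ℕ} (S : Fin n → Matrix (Fin p) (Fin p) ℝ)
    (z : ℂ) (D : Fin n → ℂ) (i : Fin n) : ℂ :=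
  ((n : ℂ))⁻¹ *
    ((S i).map (fun x => (x : ℂ)) *
      (z • (1 : Matrix (Fin p) (Fin p) ℂ) - sigCMat S D)⁻¹).trace

open scoped ComplexOrder MatrixOrder in
/-- A real positive semidefinite matrix is a complex Gram matrix. -/
lemma Matrix.PosSemidef.exists_map_ofReal_eq {ι : Type*} [Fintype ι] {A : Matrix ι ι ℝ}
    (hA : A.PosSemidef) :
    ∃ B : Matrix ι ι ℂ, A.map (fun x => (x : ℂ)) = B.conjTranspose * B := by
  classical
  obtain ⟨B, rfl⟩ := CStarAlgebra.nonneg_iff_eq_star_mul_self.mp hA.nonneg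
  refine ⟨B.map (fun x => (x : ℂ)), ?_⟩
  ext i j
  simp [Matrix.mul_apply, Matrix.star_eq_conjTranspose]

open scoped ComplexOrder in
/-- The quadratic form of a real positive semidefinite matrix takes nonnegative real values on
complex vectors. -/
lemma Matrix.PosSemidef.exists_nonneg_dotProduct_mulVec {ι : Type*} [Fintype ι]
    {A : Matrix ι ι ℝ} (hA : A.PosSemidef) (x : ι → ℂ) :
    ∃ r : ℝ, 0 ≤ r ∧ star x ⬝ᵥ (A.map (fun x => (x : ℂ))).mulVec x = (r : ℂ) := by
  obtain ⟨B, hB⟩ := hA.exists_map_ofReal_eq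
  have h := (Matrix.posSemidef_conjTranspose_mul_self B).dotProduct_mulVec_nonneg x
  rw [← hB] at h
  obtain ⟨r, hr, h⟩ := RCLike.nonneg_iff_exists_ofReal.mp h
  exact ⟨r, hr, h.symm⟩

/-- If the conjugate of the numerical range of `M` lies in an open half plane `f > 0`, then `M` is
invertible. -/
lemma Matrix.isUnit_of_pos_star_quadForm {ι : Type*} [Fintype ι] [DecidableEq ι]
    {M : Matrix ι ι ℂ} (f : ℂ →ₗ[ℝ] ℝ)
    (hM : ∀ x : ι → ℂ, x ≠ 0 → 0 < f (star (star x ⬝ᵥ M.mulVec x))) : IsUnit M := by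
  rw [← Matrix.mulVec_injective_iff_isUnit]
  refine (injective_iff_map_eq_zero M.mulVecLin).mpr fun x hx => ?_
  by_contra h0
  have h := hM x h0
  rw [Matrix.mulVecLin_apply] at hx
  simp [hx] at h

/-- If the conjugate of the numerical range of `M` lies in an open half plane `f > 0`, then the
numerical range of `M⁻¹` away from zero lies in that half plane. -/
lemma Matrix.pos_quadForm_inv {ι : Type*} [Fintype ι] [DecidableEq ι]
    {M : Matrix ι ι ℂ} (f : ℂ →ₗ[ℝ] ℝ)
    (hM : ∀ x : ι → ℂ, x ≠ 0 → 0 < f (star (star x ⬝ᵥ M.mulVec x)))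
    {x : ι → ℂ} (hx : x ≠ 0) : 0 < f (star x ⬝ᵥ M⁻¹.mulVec x) := by
  have hu := (Matrix.isUnit_iff_isUnit_det M).mp (Matrix.isUnit_of_pos_star_quadForm f hM)
  have hxy : M.mulVec (M⁻¹.mulVec x) = x := by
    rw [Matrix.mulVec_mulVec, Matrix.mul_nonsing_inv M hu, Matrix.one_mulVec]
  have hy : M⁻¹.mulVec x ≠ 0 := fun h => hx (by rw [← hxy, h, Matrix.mulVec_zero])
  have h := hM _ hy
  rwa [hxy, Matrix.star_dotProduct, star_star] at h

/-- The trace of a nonzero Gram matrix times `Q` lies in every open half plane containing the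
numerical range of `Q` away from zero. -/
lemma Matrix.pos_trace_conjTranspose_mul_self_mul {ι : Type*} [Fintype ι]
    {Q B : Matrix ι ι ℂ} (f : ℂ →ₗ[ℝ] ℝ)
    (hQ : ∀ x : ι → ℂ, x ≠ 0 → 0 < f (star x ⬝ᵥ Q.mulVec x)) (hB : B ≠ 0) :
    0 < f (B.conjTranspose * B * Q).trace := by
  have key : (B.conjTranspose * B * Q).trace
      = ∑ k, star (star (B k)) ⬝ᵥ Q.mulVec (star (B k)) := by
    rw [Matrix.mul_assoc, Matrix.trace_mul_comm, Matrix.mul_assoc]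
    simp only [star_star]
    rfl
  have hQ' : ∀ x : ι → ℂ, 0 ≤ f (star x ⬝ᵥ Q.mulVec x) := fun x => by
    rcases eq_or_ne x 0 with rfl | h
    · simp
    · exact (hQ x h).le
  obtain ⟨k, hk⟩ : ∃ k, B k ≠ 0 := Function.ne_iff.mp hB
  rw [key, map_sum]
  exact Finset.sum_pos' (fun k _ => hQ' _)
    ⟨k, Finset.mem_univ k, hQ _ (by simpa using hk)⟩

/-- Half-plane stability of the resolvent: if `conj z` lies in the open half plane `f > 0` and
every `conj (D j)` in the complementary closed half plane, then `z • 1 - sigCMat S D` has its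
conjugate numerical range in `f > 0`. -/
lemma pos_star_quadForm_resolvent {n p : ℕ} {S : Fin n → Matrix (Fin p) (Fin p) ℝ}
    (hpsd : ∀ i, (S i).PosSemidef) (f : ℂ →ₗ[ℝ] ℝ) {z : ℂ} (hz : 0 < f (star z))
    {D : Fin n → ℂ} (hD : ∀ j, f (star (D j)) ≤ 0) {x : Fin p → ℂ} (hx : x ≠ 0) :
    0 < f (star (star x ⬝ᵥ
      (z • (1 : Matrix (Fin p) (Fin p) ℂ) - sigCMat S D).mulVec x)) := by
  choose r hr hrx using fun j => (hpsd j).exists_nonneg_dotProduct_mulVec x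
  have hxx : star x ⬝ᵥ x = ((∑ k, ‖x k‖ ^ 2 : ℝ) : ℂ) := by
    simp [dotProduct, Complex.conj_mul']
  have hpos : 0 < ∑ k, ‖x k‖ ^ 2 := by
    obtain ⟨k, hk⟩ := Function.ne_iff.mp hx
    exact Finset.sum_pos' (fun _ _ => by positivity)
      ⟨k, Finset.mem_univ k, pow_pos (norm_pos_iff.mpr hk) 2⟩
  have hform : star (star x ⬝ᵥ
      (z • (1 : Matrix (Fin p) (Fin p) ℂ) - sigCMat S D).mulVec x)
      = (∑ k, ‖x k‖ ^ 2) • star z - (n : ℝ)⁻¹ • ∑ j, r j • star (D j) := by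
    simp only [sigCMat, Matrix.sub_mulVec, Matrix.smul_mulVec, Matrix.one_mulVec,
      Matrix.sum_mulVec, dotProduct_sub, dotProduct_smul, dotProduct_sum, hxx, hrx]
    simp [mul_comm]
  rw [hform, map_sub, map_smul, map_smul, map_sum, smul_eq_mul, smul_eq_mul]
  have h1 : ∑ j, f (r j • star (D j)) ≤ 0 := Finset.sum_nonpos fun j _ => by
    rw [map_smul, smul_eq_mul]
    exact mul_nonpos_of_nonneg_of_nonpos (hr j) (hD j)
  have h2 : (n : ℝ)⁻¹ * ∑ j, f (r j • star (D j)) ≤ 0 :=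
    mul_nonpos_of_nonneg_of_nonpos (by positivity) h1
  have h3 := mul_pos hpos hz
  linarith

/-- Under the same half-plane conditions, `traceIz S z D i` lies in the half plane `f > 0`. -/
lemma pos_traceIz {n p : ℕ} (hn : 1 ≤ n) {S : Fin n → Matrix (Fin p) (Fin p) ℝ}
    (hpsd : ∀ i, (S i).PosSemidef) (htr : ∀ i, 0 < (S i).trace) (f : ℂ →ₗ[ℝ] ℝ) {z : ℂ}
    (hz : 0 < f (star z)) {D : Fin n → ℂ} (hD : ∀ j, f (star (D j)) ≤ 0) (i : Fin n) :
    0 < f (traceIz S z D i) := by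
  obtain ⟨B, hB⟩ := (hpsd i).exists_map_ofReal_eq
  have hB0 : B ≠ 0 := by
    rintro rfl
    have h0 : S i = 0 := by
      ext a b
      simpa using congrFun (congrFun hB a) b
    simpa [h0] using htr i
  have h := Matrix.pos_trace_conjTranspose_mul_self_mul f
    (fun x hx => Matrix.pos_quadForm_inv f
      (fun y hy => pos_star_quadForm_resolvent hpsd f hz hD hy) hx) hB0
  have hsmul : traceIz S z D i = (n : ℝ)⁻¹ • (B.conjTranspose * B *
      (z • (1 : Matrix (Fin p) (Fin p) ℂ) - sigCMat S D)⁻¹).trace := by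
    simp [traceIz, hB]
  rw [hsmul, map_smul, smul_eq_mul]
  exact mul_pos (inv_pos.mpr (by exact_mod_cast hn)) h

/-- Stability properties of the map `D ↦ I^z(D)`: (a) for `Im z < 0` it maps the upper half
space into itself; (b) for `Re z < 0` and `Im z < 0`, composed with `χ(w) = 1/(1-w)` applied
entrywise, it is stable on `{Im > 0, Re < 0}`. -/
theorem stmt16 {n p : ℕ} (hn : 1 ≤ n) (hp : 1 ≤ p)
    (S : Fin n → Matrix (Fin p) (Fin p) ℝ)
    (hpsd : ∀ i, (S i).PosSemidef) (htr : ∀ i, 0 < (S i).trace)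
    (z : ℂ) (hzim : z.im < 0) :
    (∀ D : Fin n → ℂ, (∀ j, 0 < (D j).im) →
      IsUnit (z • (1 : Matrix (Fin p) (Fin p) ℂ) - sigCMat S D) ∧
        ∀ i, 0 < (traceIz S z D i).im) ∧
    (z.re < 0 → ∀ D : Fin n → ℂ, (∀ j, 0 < (D j).im) → (∀ j, (D j).re < 0) →
      IsUnit (z • (1 : Matrix (Fin p) (Fin p) ℂ) - sigCMat S (fun j => 1 / (1 - D j))) ∧
        ∀ i, 0 < (traceIz S z (fun j => 1 / (1 - D j)) i).im ∧
          (traceIz S z (fun j => 1 / (1 - D j)) i).re < 0) := by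
  have hz : 0 < Complex.imLm (star z) := by simpa using hzim
  have upper : ∀ D : Fin n → ℂ, (∀ j, 0 < (D j).im) →
      IsUnit (z • (1 : Matrix (Fin p) (Fin p) ℂ) - sigCMat S D) ∧
        ∀ i, 0 < (traceIz S z D i).im := fun D hD => by
    have hD' : ∀ j, Complex.imLm (star (D j)) ≤ 0 := fun j => by simpa using (hD j).le
    exact ⟨Matrix.isUnit_of_pos_star_quadForm Complex.imLm
      fun x hx => pos_star_quadForm_resolvent hpsd _ hz hD' hx,
      fun i => pos_traceIz hn hpsd htr Complex.imLm hz hD' i⟩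
  refine ⟨upper, fun hzre D hDim hDre => ?_⟩
  have hnorm : ∀ j, 0 < Complex.normSq (1 - D j) := fun j => Complex.normSq_pos.mpr fun h => by
    have := congrArg Complex.im h
    simp only [Complex.sub_im, Complex.one_im, Complex.zero_im] at this
    linarith [hDim j]
  have him : ∀ j, 0 < (1 / (1 - D j)).im := fun j => by
    simpa [Complex.inv_im] using div_pos (hDim j) (hnorm j)
  have hre : ∀ j, 0 < (1 / (1 - D j)).re := fun j => by
    rw [one_div, Complex.inv_re, Complex.sub_re, Complex.one_re]
    exact div_pos (by linarith [hDre j]) (hnorm j)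
  obtain ⟨hunit, hpos⟩ := upper _ him
  refine ⟨hunit, fun i => ⟨hpos i, ?_⟩⟩
  have h := pos_traceIz hn hpsd htr (-Complex.reLm) (z := z) (by simpa using hzre)
    (D := fun j => 1 / (1 - D j)) (fun j => by
      have := (hre j).le
      simp only [LinearMap.neg_apply, Complex.reLm_coe, Complex.star_def, Complex.conj_re]
      linarith) i
  simpa using h
end

section
/- Let n, p ≥ 1 be integers, 0 < ε < 1/2, and let Σ_1, …, Σ_n be real symmetric positive semidefinite p×p matrices with tr(Σ_i) > 0 for every i and ‖(1/n)·Σ_{j=1}^n Σ_j‖ ≤ 1 − 2ε, where ‖·‖ is the operator norm. Let z ∈ ℂ with Re(z) < 0 and Im(z) < 0, and set χ(w) = 1/(1−w). Then there exists a unique Λ ∈ ℂ^n with Im(Λ_i) > 0 and Re(Λ_i) < 0 for every i such that the matrix z·I_p − (1/n)·Σ_{j=1}^n χ(Λ_j)·Σ_j is invertible and, for every i, Λ_i = (1/n)·tr(Σ_i·(z·I_p − (1/n)·Σ_{j=1}^n χ(Λ_j)·Σ_j)^{−1}). -/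
open Matrix

/-- The squared Frobenius norm of a complex matrix. -/
noncomputable def frobSq {m k : Type*} [Fintype m] [Fintype k] (X : Matrix m k ℂ) : ℝ :=
  ∑ b, ∑ a, ‖X a b‖ ^ 2

section frobSq

variable {m k : Type*} [Fintype m] [Fintype k]

lemma frobSq_nonneg (X : Matrix m k ℂ) : 0 ≤ frobSq X := by
  unfold frobSq; positivity

lemma frobSq_eq_zero_iff {X : Matrix m k ℂ} : frobSq X = 0 ↔ X = 0 := by
  unfold frobSq
  constructor
  · intro h
    rw [Finset.sum_eq_zero_iff_of_nonneg (fun _ _ => by positivity)] at h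
    ext a b
    have h2 := h b (Finset.mem_univ _)
    rw [Finset.sum_eq_zero_iff_of_nonneg (fun _ _ => by positivity)] at h2
    simpa using h2 a (Finset.mem_univ _)
  · rintro rfl; simp

lemma frobSq_pos {X : Matrix m k ℂ} (hX : X ≠ 0) : 0 < frobSq X :=
  lt_of_le_of_ne (frobSq_nonneg X) fun h => hX (frobSq_eq_zero_iff.1 h.symm)

lemma trace_conjTranspose_mul_self_eq_frobSq (X : Matrix m k ℂ) :
    (Xᴴ * X).trace = (frobSq X : ℂ) := by
  simp [frobSq, Matrix.trace, Matrix.mul_apply, Complex.conj_mul']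

lemma norm_trace_conjTranspose_mul_sq_le (P Q : Matrix m k ℂ) :
    ‖(Pᴴ * Q).trace‖ ^ 2 ≤ frobSq P * frobSq Q := by
  have h : ‖(Pᴴ * Q).trace‖ ≤ ∑ x : k × m, ‖P x.2 x.1‖ * ‖Q x.2 x.1‖ := by
    rw [Fintype.sum_prod_type]
    refine (norm_sum_le _ _).trans (Finset.sum_le_sum fun b _ => ?_)
    refine (norm_sum_le _ _).trans (Finset.sum_le_sum fun a _ => ?_)
    simp
  calc ‖(Pᴴ * Q).trace‖ ^ 2
      ≤ (∑ x : k × m, ‖P x.2 x.1‖ * ‖Q x.2 x.1‖) ^ 2 := by gcongr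
    _ ≤ (∑ x : k × m, ‖P x.2 x.1‖ ^ 2) * ∑ x : k × m, ‖Q x.2 x.1‖ ^ 2 :=
        Finset.sum_mul_sq_le_sq_mul_sq _ _ _
    _ = frobSq P * frobSq Q := by simp [frobSq, Fintype.sum_prod_type]

end frobSq

open scoped MatrixOrder Matrix.Norms.L2Operator in
lemma exists_map_ofReal_eq_conjTranspose_mul_self {p : ℕ} {A : Matrix (Fin p) (Fin p) ℝ}
    (hA : A.PosSemidef) :
    ∃ C : Matrix (Fin p) (Fin p) ℂ, A.map (fun x => (x : ℂ)) = Cᴴ * C := by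
  obtain ⟨B, rfl⟩ := CStarAlgebra.nonneg_iff_eq_star_mul_self.mp hA.nonneg
  refine ⟨B.map (fun x => (x : ℂ)), ?_⟩
  ext a b
  simp [Matrix.mul_apply, Matrix.star_eq_conjTranspose]

section Resolvent

variable {n p : ℕ} {S : Fin n → Matrix (Fin p) (Fin p) ℝ}
  {C : Fin n → Matrix (Fin p) (Fin p) ℂ} {z : ℂ} {D D' : Fin n → ℂ}

/-- The quadratic form of `z·I_p − Σ_D`, summed over the columns of `X`. -/
lemma trace_conjTranspose_mul_sub_sigCMat_mul
    (hC : ∀ j, (S j).map (fun x => (x : ℂ)) = (C j)ᴴ * C j) {k : Type*} [Fintype k]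
    (X : Matrix (Fin p) k ℂ) :
    (Xᴴ * (z • (1 : Matrix (Fin p) (Fin p) ℂ) - sigCMat S D) * X).trace =
      z * frobSq X - (n : ℂ)⁻¹ * ∑ j, D j * frobSq (C j * X) := by
  simp only [sigCMat, hC, ← trace_conjTranspose_mul_self_eq_frobSq, Matrix.mul_sub,
    Matrix.sub_mul, Matrix.trace_sub, Matrix.mul_smul, Matrix.smul_mul, Matrix.trace_smul,
    Matrix.mul_sum, Matrix.sum_mul, Matrix.trace_sum, smul_eq_mul, Matrix.mul_one,
    Matrix.conjTranspose_mul, Matrix.mul_assoc]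

lemma isUnit_sub_sigCMat (hC : ∀ j, (S j).map (fun x => (x : ℂ)) = (C j)ᴴ * C j)
    (hz : z.im < 0) (hD : ∀ j, 0 ≤ (D j).im) :
    IsUnit (z • (1 : Matrix (Fin p) (Fin p) ℂ) - sigCMat S D) := by
  rw [Matrix.isUnit_iff_isUnit_det, isUnit_iff_ne_zero]
  intro hdet
  obtain ⟨v, hv, hv0⟩ := Matrix.exists_mulVec_eq_zero_iff.2 hdet
  have hX : Matrix.replicateCol Unit v ≠ 0 := by
    intro h
    apply hv
    ext a
    simpa using congrFun (congrFun h a) ()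
  have h := trace_conjTranspose_mul_sub_sigCMat_mul (z := z) (D := D) hC
    (Matrix.replicateCol Unit v)
  rw [Matrix.mul_assoc, ← Matrix.replicateCol_mulVec, hv0] at h
  have h2 := congrArg Complex.im h
  have h3 : 0 ≤ (n : ℝ)⁻¹ * ∑ j, (D j).im * frobSq (C j * Matrix.replicateCol Unit v) :=
    mul_nonneg (by positivity)
      (Finset.sum_nonneg fun j _ => mul_nonneg (hD j) (frobSq_nonneg _))
  have h4 := mul_neg_of_neg_of_pos hz (frobSq_pos hX)
  rw [← Complex.ofReal_natCast, ← Complex.ofReal_inv] at h2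
  simp at h2
  linarith

/-- The left factor `R*·C_i*` and the right factor `R·C_i*`, with `R = (z·I_p − Σ_D)⁻¹`,
give the same quadratic expression for the conjugate of `I^z(D)_i`. -/
lemma conj_traceIz (hC : ∀ j, (S j).map (fun x => (x : ℂ)) = (C j)ᴴ * C j)
    (hU : IsUnit (z • (1 : Matrix (Fin p) (Fin p) ℂ) - sigCMat S D)) (i : Fin n)
    {X : Matrix (Fin p) (Fin p) ℂ}
    (hX : X = ((z • (1 : Matrix (Fin p) (Fin p) ℂ) - sigCMat S D)⁻¹)ᴴ * (C i)ᴴ ∨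
      X = (z • (1 : Matrix (Fin p) (Fin p) ℂ) - sigCMat S D)⁻¹ * (C i)ᴴ) :
    star (traceIz S z D i) =
      (n : ℂ)⁻¹ * (z * frobSq X - (n : ℂ)⁻¹ * ∑ j, D j * frobSq (C j * X)) := by
  have hdet := (Matrix.isUnit_iff_isUnit_det _).1 hU
  rw [← trace_conjTranspose_mul_sub_sigCMat_mul hC, traceIz, hC]
  set M := z • (1 : Matrix (Fin p) (Fin p) ℂ) - sigCMat S D
  have key : (Xᴴ * M * X).trace = star (((C i)ᴴ * C i * M⁻¹).trace) := by
    rw [← Matrix.trace_conjTranspose]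
    rcases hX with rfl | rfl
    · have : (M⁻¹ᴴ * (C i)ᴴ)ᴴ * M * (M⁻¹ᴴ * (C i)ᴴ) = C i * (M⁻¹ * M) * M⁻¹ᴴ * (C i)ᴴ := by
        simp [Matrix.mul_assoc]
      rw [this, Matrix.nonsing_inv_mul _ hdet, Matrix.mul_one, Matrix.trace_mul_comm]
      simp only [Matrix.conjTranspose_mul, Matrix.conjTranspose_conjTranspose]
      rw [← Matrix.mul_assoc, Matrix.trace_mul_comm]
    · have : (M⁻¹ * (C i)ᴴ)ᴴ * M * (M⁻¹ * (C i)ᴴ) = C i * M⁻¹ᴴ * (M * M⁻¹) * (C i)ᴴ := by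
        simp [Matrix.mul_assoc]
      rw [this, Matrix.mul_nonsing_inv _ hdet, Matrix.mul_one, Matrix.trace_mul_comm]
      simp only [Matrix.conjTranspose_mul, Matrix.conjTranspose_conjTranspose]
      rw [← Matrix.mul_assoc, Matrix.trace_mul_comm]
  rw [key]
  simp

lemma frobSq_mul_conjTranspose_pos
    (hC : ∀ j, (S j).map (fun x => (x : ℂ)) = (C j)ᴴ * C j) (htr : ∀ i, 0 < (S i).trace)
    (i : Fin n) {R : Matrix (Fin p) (Fin p) ℂ} (hR : IsUnit R) :
    0 < frobSq (R * (C i)ᴴ) := by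
  refine frobSq_pos fun h => ?_
  have h0 : (C i)ᴴ = 0 := hR.mul_left_cancel (by simpa using h)
  have h1 := hC i
  rw [h0, Matrix.zero_mul] at h1
  have h2 : S i = 0 := by
    ext a b
    simpa using congrFun (congrFun h1 a) b
  simpa [h2] using htr i

lemma traceIz_re_im (hC : ∀ j, (S j).map (fun x => (x : ℂ)) = (C j)ᴴ * C j)
    (hU : IsUnit (z • (1 : Matrix (Fin p) (Fin p) ℂ) - sigCMat S D)) (i : Fin n)
    {X : Matrix (Fin p) (Fin p) ℂ}
    (hX : X = ((z • (1 : Matrix (Fin p) (Fin p) ℂ) - sigCMat S D)⁻¹)ᴴ * (C i)ᴴ ∨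
      X = (z • (1 : Matrix (Fin p) (Fin p) ℂ) - sigCMat S D)⁻¹ * (C i)ᴴ) :
    (traceIz S z D i).re =
        (n : ℝ)⁻¹ * (z.re * frobSq X - (n : ℝ)⁻¹ * ∑ j, (D j).re * frobSq (C j * X)) ∧
      (traceIz S z D i).im =
        (n : ℝ)⁻¹ * (-z.im * frobSq X + (n : ℝ)⁻¹ * ∑ j, (D j).im * frobSq (C j * X)) := by
  have h := conj_traceIz hC hU i hX
  rw [← Complex.ofReal_natCast, ← Complex.ofReal_inv] at h
  have hre := congrArg Complex.re h
  have him := congrArg Complex.im h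
  simp only [Complex.star_def, Complex.conj_re, Complex.conj_im, Complex.re_ofReal_mul,
    Complex.im_ofReal_mul, Complex.sub_re, Complex.sub_im, Complex.re_mul_ofReal,
    Complex.im_mul_ofReal, Complex.re_sum, Complex.im_sum] at hre him
  exact ⟨hre, by linarith⟩

lemma traceIz_im_pos_re_neg (hC : ∀ j, (S j).map (fun x => (x : ℂ)) = (C j)ᴴ * C j)
    (htr : ∀ i, 0 < (S i).trace) (hre : z.re < 0) (him : z.im < 0)
    (hD : ∀ j, 0 ≤ (D j).re ∧ 0 ≤ (D j).im) (i : Fin n) :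
    0 < (traceIz S z D i).im ∧ (traceIz S z D i).re < 0 := by
  have hn : (0 : ℝ) < n := by exact_mod_cast i.pos
  have hU := isUnit_sub_sigCMat hC him (fun j => (hD j).2)
  obtain ⟨h1, h2⟩ := traceIz_re_im hC hU i (Or.inr rfl)
  have hpos := frobSq_mul_conjTranspose_pos hC htr i ((Matrix.isUnit_nonsing_inv_iff).2 hU)
  set X := (z • (1 : Matrix (Fin p) (Fin p) ℂ) - sigCMat S D)⁻¹ * (C i)ᴴ
  have h3 : 0 ≤ (n : ℝ)⁻¹ * ∑ j, (D j).re * frobSq (C j * X) :=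
    mul_nonneg (by positivity)
      (Finset.sum_nonneg fun j _ => mul_nonneg (hD j).1 (frobSq_nonneg _))
  have h4 : 0 ≤ (n : ℝ)⁻¹ * ∑ j, (D j).im * frobSq (C j * X) :=
    mul_nonneg (by positivity)
      (Finset.sum_nonneg fun j _ => mul_nonneg (hD j).2 (frobSq_nonneg _))
  have h5 := mul_neg_of_neg_of_pos hre hpos
  have h6 := mul_neg_of_neg_of_pos him hpos
  rw [h1, h2]
  exact ⟨mul_pos (by positivity) (by linarith),
    mul_neg_of_pos_of_neg (by positivity) (by linarith)⟩

lemma traceIz_sub_traceIz (hC : ∀ j, (S j).map (fun x => (x : ℂ)) = (C j)ᴴ * C j)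
    (hU : IsUnit (z • (1 : Matrix (Fin p) (Fin p) ℂ) - sigCMat S D))
    (hU' : IsUnit (z • (1 : Matrix (Fin p) (Fin p) ℂ) - sigCMat S D')) (i : Fin n) :
    traceIz S z D i - traceIz S z D' i =
      (n : ℂ)⁻¹ * ((n : ℂ)⁻¹ * ∑ j, (D j - D' j) *
        ((C j * (((z • (1 : Matrix (Fin p) (Fin p) ℂ) - sigCMat S D)⁻¹)ᴴ * (C i)ᴴ))ᴴ *
          (C j * ((z • (1 : Matrix (Fin p) (Fin p) ℂ) - sigCMat S D')⁻¹ * (C i)ᴴ))).trace) := by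
  have hsub : (z • (1 : Matrix (Fin p) (Fin p) ℂ) - sigCMat S D') -
      (z • (1 : Matrix (Fin p) (Fin p) ℂ) - sigCMat S D) =
      (n : ℂ)⁻¹ • ∑ j, (D j - D' j) • ((C j)ᴴ * C j) := by
    simp only [sigCMat, hC, sub_smul, Finset.sum_sub_distrib, smul_sub]
    abel
  have hres := Matrix.inv_sub_inv (iff_of_true hU hU')
  rw [hsub] at hres
  rw [traceIz, traceIz, hC, ← mul_sub, ← Matrix.trace_sub, ← Matrix.mul_sub, hres]
  generalize (z • (1 : Matrix (Fin p) (Fin p) ℂ) - sigCMat S D)⁻¹ = R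
  generalize (z • (1 : Matrix (Fin p) (Fin p) ℂ) - sigCMat S D')⁻¹ = R'
  simp only [Matrix.mul_smul, Matrix.smul_mul, Matrix.trace_smul, Matrix.mul_sum,
    Matrix.sum_mul, Matrix.trace_sum, smul_eq_mul]
  have htrace : ∀ j, ((C i)ᴴ * C i * (R * ((C j)ᴴ * C j) * R')).trace =
      ((C j * (Rᴴ * (C i)ᴴ))ᴴ * (C j * (R' * (C i)ᴴ))).trace := fun j => by
    rw [Matrix.mul_assoc (C i)ᴴ, Matrix.trace_mul_comm]
    simp only [Matrix.conjTranspose_mul, Matrix.conjTranspose_conjTranspose, Matrix.mul_assoc]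
  simp only [htrace]

/-- `I^z` strictly contracts the semi-metric `max_j |D_j − D'_j|² / (Im D_j · Im D'_j)`. -/
lemma norm_traceIz_sub_sq_lt (hC : ∀ j, (S j).map (fun x => (x : ℂ)) = (C j)ᴴ * C j)
    (htr : ∀ i, 0 < (S i).trace) (him : z.im < 0)
    (hD : ∀ j, 0 ≤ (D j).im) (hD' : ∀ j, 0 ≤ (D' j).im) {δ : ℝ} (hδ : 0 < δ)
    (hle : ∀ j, ‖D j - D' j‖ ^ 2 ≤ δ * ((D j).im * (D' j).im)) (i : Fin n) :
    ‖traceIz S z D i - traceIz S z D' i‖ ^ 2 <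
      δ * ((traceIz S z D i).im * (traceIz S z D' i).im) := by
  have hn : (0 : ℝ) < n := by exact_mod_cast i.pos
  have hU := isUnit_sub_sigCMat hC him hD
  have hU' := isUnit_sub_sigCMat hC him hD'
  rw [traceIz_sub_traceIz hC hU hU' i, (traceIz_re_im hC hU i (Or.inl rfl)).2,
    (traceIz_re_im hC hU' i (Or.inr rfl)).2]
  have hpos := frobSq_mul_conjTranspose_pos hC htr i ((Matrix.isUnit_nonsing_inv_iff).2 hU).star
  have hpos' := frobSq_mul_conjTranspose_pos hC htr i ((Matrix.isUnit_nonsing_inv_iff).2 hU')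
  rw [Matrix.star_eq_conjTranspose] at hpos
  set X := ((z • (1 : Matrix (Fin p) (Fin p) ℂ) - sigCMat S D)⁻¹)ᴴ * (C i)ᴴ
  set X' := (z • (1 : Matrix (Fin p) (Fin p) ℂ) - sigCMat S D')⁻¹ * (C i)ᴴ
  set s := ∑ j, (D j).im * frobSq (C j * X) with hs
  set s' := ∑ j, (D' j).im * frobSq (C j * X') with hs'
  have hs0 : 0 ≤ s := Finset.sum_nonneg fun j _ => mul_nonneg (hD j) (frobSq_nonneg _)
  have hs0' : 0 ≤ s' := Finset.sum_nonneg fun j _ => mul_nonneg (hD' j) (frobSq_nonneg _)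
  set T := ∑ j, (D j - D' j) * ((C j * X)ᴴ * (C j * X')).trace
  have hT : ‖T‖ ^ 2 ≤ δ * s * s' := by
    have h1 : ‖T‖ ≤ ∑ j, ‖(D j - D' j) * ((C j * X)ᴴ * (C j * X')).trace‖ := norm_sum_le _ _
    calc ‖T‖ ^ 2 ≤ (∑ j, ‖(D j - D' j) * ((C j * X)ᴴ * (C j * X')).trace‖) ^ 2 := by gcongr
      _ ≤ (∑ j, δ * ((D j).im * frobSq (C j * X))) * s' := by
        refine Finset.sum_sq_le_sum_mul_sum_of_sq_le_mul _
          (fun j _ => mul_nonneg hδ.le (mul_nonneg (hD j) (frobSq_nonneg _)))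
          (fun j _ => mul_nonneg (hD' j) (frobSq_nonneg _)) fun j _ => ?_
        rw [norm_mul, mul_pow]
        calc _ ≤ (δ * ((D j).im * (D' j).im)) * (frobSq (C j * X) * frobSq (C j * X')) :=
              mul_le_mul (hle j) (norm_trace_conjTranspose_mul_sq_le _ _) (by positivity)
                ((sq_nonneg _).trans (hle j))
          _ = _ := by ring
      _ = δ * s * s' := by rw [← Finset.mul_sum]
  have hx := mul_pos (neg_pos.2 him) hpos
  have hx' := mul_pos (neg_pos.2 him) hpos'
  have hm : (n : ℝ)⁻¹ * s * ((n : ℝ)⁻¹ * s') <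
      (-z.im * frobSq X + (n : ℝ)⁻¹ * s) * (-z.im * frobSq X' + (n : ℝ)⁻¹ * s') :=
    mul_lt_mul'' (by linarith) (by linarith) (by positivity) (by positivity)
  simp only [norm_mul, norm_inv, Complex.norm_natCast]
  have hn2 : 0 < ((n : ℝ)⁻¹) ^ 2 := by positivity
  calc ((n : ℝ)⁻¹ * ((n : ℝ)⁻¹ * ‖T‖)) ^ 2 = ((n : ℝ)⁻¹) ^ 2 * ((n : ℝ)⁻¹) ^ 2 * ‖T‖ ^ 2 := by ring
    _ ≤ ((n : ℝ)⁻¹) ^ 2 * ((n : ℝ)⁻¹) ^ 2 * (δ * s * s') := by gcongr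
    _ = δ * ((n : ℝ)⁻¹) ^ 2 * ((n : ℝ)⁻¹ * s * ((n : ℝ)⁻¹ * s')) := by ring
    _ < δ * ((n : ℝ)⁻¹) ^ 2 *
        ((-z.im * frobSq X + (n : ℝ)⁻¹ * s) * (-z.im * frobSq X' + (n : ℝ)⁻¹ * s')) := by
      gcongr
    _ = _ := by ring

lemma continuousOn_traceIz {K : Set (Fin n → ℂ)}
    (hK : ∀ D ∈ K, IsUnit (z • (1 : Matrix (Fin p) (Fin p) ℂ) - sigCMat S D)) :
    ContinuousOn (traceIz S z) K := by
  have hM : Continuous fun D => z • (1 : Matrix (Fin p) (Fin p) ℂ) - sigCMat S D := by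
    unfold sigCMat
    fun_prop
  refine continuousOn_pi.2 fun i => ?_
  simp only [traceIz, Matrix.inv_def, Ring.inverse_eq_inv', Matrix.mul_smul,
    Matrix.trace_smul, smul_eq_mul]
  refine continuousOn_const.mul (ContinuousOn.mul (hM.matrix_det.continuousOn.inv₀ ?_) ?_)
  · intro D hD
    exact ((Matrix.isUnit_iff_isUnit_det _).1 (hK D hD)).ne_zero
  · exact (continuous_const.matrix_mul hM.matrix_adjugate).matrix_trace.continuousOn

end Resolvent

section OneDivOneSub

variable {w w' : ℂ}

lemma one_sub_ne_zero_of_im_pos (hw : 0 < w.im) : 1 - w ≠ 0 := fun h => by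
  have := congrArg Complex.im h
  simp at this
  exact hw.ne' this

lemma im_one_div_one_sub (w : ℂ) : (1 / (1 - w)).im = w.im / Complex.normSq (1 - w) := by
  simp [Complex.inv_im]

lemma re_one_div_one_sub (w : ℂ) : (1 / (1 - w)).re = (1 - w.re) / Complex.normSq (1 - w) := by
  simp [Complex.inv_re]

lemma norm_one_div_one_sub_le_one (hw : w.re < 0) : ‖1 / (1 - w)‖ ≤ 1 := by
  have h : 1 ≤ ‖1 - w‖ := by
    have := Complex.re_le_norm (1 - w)
    simp at this
    linarith
  rw [norm_div, norm_one]
  exact div_le_one_of_le₀ h (norm_nonneg _)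

/-- `w ↦ 1/(1-w)` preserves `|w − w'|² / (Im w · Im w')`. -/
lemma norm_one_div_one_sub_sub_sq_le {δ : ℝ} (hw : 0 < w.im) (hw' : 0 < w'.im)
    (h : ‖w - w'‖ ^ 2 ≤ δ * (w.im * w'.im)) :
    ‖1 / (1 - w) - 1 / (1 - w')‖ ^ 2 ≤ δ * ((1 / (1 - w)).im * (1 / (1 - w')).im) := by
  have h1 := one_sub_ne_zero_of_im_pos hw
  have h2 := one_sub_ne_zero_of_im_pos hw'
  have e : 1 / (1 - w) - 1 / (1 - w') = (w - w') / ((1 - w) * (1 - w')) := by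
    field_simp
    ring
  have p1 := Complex.normSq_pos.2 h1
  have p2 := Complex.normSq_pos.2 h2
  rw [e, im_one_div_one_sub, im_one_div_one_sub, norm_div, div_pow, norm_mul, mul_pow,
    ← Complex.normSq_eq_norm_sq (1 - w), ← Complex.normSq_eq_norm_sq (1 - w')]
  calc _ ≤ δ * (w.im * w'.im) / (Complex.normSq (1 - w) * Complex.normSq (1 - w')) := by gcongr
    _ = _ := by field_simp

end OneDivOneSub

/-- A continuous map of a subset `Ω` of a product of upper half-planes into a nonempty compact
subset of `Ω` has exactly one fixed point in `Ω` if it strictly contracts the semi-metric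
`max_j |w_j − w'_j|² / (Im w_j · Im w'_j)`. -/
lemma existsUnique_fixed_of_strict_contraction {ι : Type*} [Fintype ι] [Nonempty ι]
    {Ω L : Set (ι → ℂ)} {H : (ι → ℂ) → ι → ℂ} (hΩ : ∀ w ∈ Ω, ∀ i, 0 < (w i).im)
    (hL : IsCompact L) (hL0 : L.Nonempty) (hLΩ : L ⊆ Ω) (hH : Set.MapsTo H Ω L)
    (hcont : ContinuousOn H Ω)
    (hlt : ∀ w ∈ Ω, ∀ w' ∈ Ω, ∀ δ : ℝ, 0 < δ →
      (∀ j, ‖w j - w' j‖ ^ 2 ≤ δ * ((w j).im * (w' j).im)) →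
      ∀ i, ‖H w i - H w' i‖ ^ 2 < δ * ((H w i).im * (H w' i).im)) :
    ∃! w, w ∈ Ω ∧ w = H w := by
  let d : (ι → ℂ) → (ι → ℂ) → ℝ := fun w w' =>
    Finset.univ.sup' Finset.univ_nonempty fun i => ‖w i - w' i‖ ^ 2 / ((w i).im * (w' i).im)
  have hdlt : ∀ w ∈ Ω, ∀ w' ∈ Ω, w ≠ w' → d (H w) (H w') < d w w' := by
    intro w hw w' hw' hne
    have hle : ∀ j, ‖w j - w' j‖ ^ 2 / ((w j).im * (w' j).im) ≤ d w w' := fun j =>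
      Finset.le_sup' (fun i => ‖w i - w' i‖ ^ 2 / ((w i).im * (w' i).im)) (Finset.mem_univ j)
    obtain ⟨j, hj⟩ := Function.ne_iff.1 hne
    have hpos : 0 < d w w' := by
      refine lt_of_lt_of_le ?_ (hle j)
      have := norm_pos_iff.2 (sub_ne_zero.2 hj)
      have := hΩ w hw j
      have := hΩ w' hw' j
      positivity
    have key := hlt w hw w' hw' _ hpos fun j =>
      (div_le_iff₀ (mul_pos (hΩ w hw j) (hΩ w' hw' j))).1 (hle j)
    refine (Finset.sup'_lt_iff _).2 fun i _ => ?_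
    exact (div_lt_iff₀ (mul_pos (hΩ _ (hLΩ (hH hw)) i) (hΩ _ (hLΩ (hH hw')) i))).2 (key i)
  have hdc : ContinuousOn (fun w => d w (H w)) L := by
    refine ContinuousOn.finset_sup'_apply _ fun i _ => ?_
    have hHi : ContinuousOn (fun w => H w i) L :=
      (continuous_apply i).comp_continuousOn (hcont.mono hLΩ)
    have hwi : ContinuousOn (fun w : ι → ℂ => w i) L := (continuous_apply i).continuousOn
    refine ((hwi.sub hHi).norm.pow 2).div
      ((Complex.continuous_im.comp_continuousOn hwi).mul
        (Complex.continuous_im.comp_continuousOn hHi)) fun w hw => ?_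
    exact (mul_pos (hΩ _ (hLΩ hw) i) (hΩ _ (hLΩ (hH (hLΩ hw))) i)).ne'
  obtain ⟨w, hw, hmin⟩ := hL.exists_isMinOn hL0 hdc
  have hfix : w = H w := by
    by_contra hne
    have hHw := hH (hLΩ hw)
    exact absurd (hdlt w (hLΩ hw) _ (hLΩ hHw) hne) (not_lt.2 (hmin hHw))
  refine ⟨w, ⟨hLΩ hw, hfix⟩, ?_⟩
  rintro w' ⟨hw', hfix'⟩
  by_contra hne
  have := hdlt w' hw' w (hLΩ hw) hne
  rw [← hfix, ← hfix'] at this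
  exact lt_irrefl _ this

/-- Existence and uniqueness of the solution `Λ` to the fixed point system
`Λ_i = (1/n)·tr(Σ_i·(z·I_p − Σ_{χ(Λ)})⁻¹)`, with `χ(w) = 1/(1-w)`, for `Re z < 0, Im z < 0`. -/
theorem stmt18 {n p : ℕ} (hn : 1 ≤ n) (hp : 1 ≤ p)
    (ε : ℝ) (hε0 : 0 < ε) (hε1 : ε < 1 / 2)
    (S : Fin n → Matrix (Fin p) (Fin p) ℝ)
    (hpsd : ∀ i, (S i).PosSemidef) (htr : ∀ i, 0 < (S i).trace)
    (hop : ∀ v : Fin p → ℝ,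
      Real.sqrt (∑ i, (((n : ℝ)⁻¹ • ∑ j, S j).mulVec v i) ^ 2) ≤
        (1 - 2 * ε) * Real.sqrt (∑ i, v i ^ 2))
    (z : ℂ) (hre : z.re < 0) (him : z.im < 0) :
    ∃! Λ : Fin n → ℂ,
      (∀ i, 0 < (Λ i).im ∧ (Λ i).re < 0) ∧
      IsUnit (z • (1 : Matrix (Fin p) (Fin p) ℂ) - sigCMat S (fun j => 1 / (1 - Λ j))) ∧
      ∀ i, Λ i = traceIz S z (fun j => 1 / (1 - Λ j)) i := by
  have : Nonempty (Fin n) := ⟨⟨0, hn⟩⟩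
  choose C hC using fun j => exists_map_ofReal_eq_conjTranspose_mul_self (hpsd j)
  let Q : Set ℂ := {w | 0 ≤ w.re ∧ 0 ≤ w.im} ∩ Metric.closedBall 0 1
  have hQ : IsCompact Q := (isCompact_closedBall _ _).inter_left
    ((isClosed_le continuous_const Complex.continuous_re).inter
      (isClosed_le continuous_const Complex.continuous_im))
  let K : Set (Fin n → ℂ) := Set.univ.pi fun _ => Q
  have hK : IsCompact K := isCompact_univ_pi fun _ => hQ
  let Ω : Set (Fin n → ℂ) := {Λ | ∀ i, 0 < (Λ i).im ∧ (Λ i).re < 0}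
  let χ : (Fin n → ℂ) → Fin n → ℂ := fun Λ j => 1 / (1 - Λ j)
  have hKD : ∀ D ∈ K, ∀ j, 0 ≤ (D j).re ∧ 0 ≤ (D j).im := fun D hD j => (hD j trivial).1
  have hχ : Set.MapsTo χ Ω K := fun Λ hΛ j _ => by
    refine ⟨⟨?_, ?_⟩, ?_⟩
    · rw [re_one_div_one_sub]
      exact div_nonneg (by linarith [(hΛ j).2]) (Complex.normSq_nonneg _)
    · rw [im_one_div_one_sub]
      exact div_nonneg (hΛ j).1.le (Complex.normSq_nonneg _)
    · simpa only [mem_closedBall_zero_iff] using norm_one_div_one_sub_le_one (hΛ j).2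
  have hχc : ContinuousOn χ Ω := continuousOn_pi.2 fun j =>
    continuousOn_const.div (continuousOn_const.sub (continuous_apply j).continuousOn)
      fun Λ hΛ => one_sub_ne_zero_of_im_pos (hΛ j).1
  have hunit : ∀ D ∈ K, IsUnit (z • (1 : Matrix (Fin p) (Fin p) ℂ) - sigCMat S D) :=
    fun D hD => isUnit_sub_sigCMat hC him fun j => (hKD D hD j).2
  have hG : ContinuousOn (traceIz S z) K := continuousOn_traceIz hunit
  have h := existsUnique_fixed_of_strict_contraction (Ω := Ω) (L := traceIz S z '' K)
    (H := fun Λ => traceIz S z (χ Λ)) (fun Λ hΛ i => (hΛ i).1) (hK.image_of_continuousOn hG)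
    ⟨_, 0, fun _ _ => by simp [Q], rfl⟩
    (Set.image_subset_iff.2 fun D hD =>
      traceIz_im_pos_re_neg hC htr hre him (hKD D hD))
    (fun Λ hΛ => Set.mem_image_of_mem _ (hχ hΛ)) (hG.comp hχc hχ)
    fun Λ hΛ Λ' hΛ' δ hδ hle => norm_traceIz_sub_sq_lt hC htr him
      (fun j => (hKD _ (hχ hΛ) j).2) (fun j => (hKD _ (hχ hΛ') j).2) hδ
      fun j => norm_one_div_one_sub_sub_sq_le (hΛ j).1 (hΛ' j).1 (hle j)
  obtain ⟨Λ, ⟨hΛ, hfix⟩, huniq⟩ := h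
  exact ⟨Λ, ⟨hΛ, hunit _ (hχ hΛ), fun i => congrFun hfix i⟩,
    fun Λ' h' => huniq Λ' ⟨h'.1, funext h'.2.2⟩⟩
end

section
/- Let f : ℝ → ℝ be twice differentiable with |f′(t)| ≤ λ and |f″(t)| ≤ M for all t ∈ ℝ, where λ ≥ 0 and M ≥ 0, and let Δ ≥ 0 satisfy Δ·λ < 1. Then: (a) for every x ∈ ℝ there exists a unique real number ζ(x) satisfying ζ(x) = x + Δ·f(ζ(x)); (b) the resulting function ζ : ℝ → ℝ is differentiable and, for every x ∈ ℝ, ζ′(x) = 1/(1 − Δ·f′(ζ(x))). -/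
theorem abs_sub_le_of_hasDerivAt_of_abs_le {f f' : ℝ → ℝ} {C : ℝ}
    (hd : ∀ x, HasDerivAt f (f' x) x) (hb : ∀ x, |f' x| ≤ C) (a b : ℝ) :
    |f a - f b| ≤ C * |a - b| := by
  simpa only [Real.norm_eq_abs] using
    Convex.norm_image_sub_le_of_norm_hasDerivWithin_le
      (fun x _ => (hd x).hasDerivWithinAt) (fun x _ => hb x) convex_univ
      (Set.mem_univ b) (Set.mem_univ a)

/-- For `f` twice differentiable with `|f'| ≤ λ`, `|f''| ≤ M` and `Δ·λ < 1`, the equation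
`ζ(x) = x + Δ·f(ζ(x))` has a unique solution for every `x`, and the resulting function `ζ` is
differentiable with `ζ'(x) = 1/(1 − Δ·f'(ζ(x)))`. -/
theorem stmt19 (f f' f'' : ℝ → ℝ) (lam M Δ : ℝ)
    (hlam : 0 ≤ lam) (hM : 0 ≤ M) (hΔ : 0 ≤ Δ) (hcontr : Δ * lam < 1)
    (hd1 : ∀ x, HasDerivAt f (f' x) x) (hd2 : ∀ x, HasDerivAt f' (f'' x) x)
    (hb1 : ∀ x, |f' x| ≤ lam) (hb2 : ∀ x, |f'' x| ≤ M) :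
    (∀ x : ℝ, ∃! y : ℝ, y = x + Δ * f y) ∧
      ∀ ζ : ℝ → ℝ, (∀ x, ζ x = x + Δ * f (ζ x)) →
        ∀ x, HasDerivAt ζ (1 / (1 - Δ * f' (ζ x))) x := by
  have hlip (a b : ℝ) : |Δ * f a - Δ * f b| ≤ Δ * lam * |a - b| := by
    rw [← mul_sub, abs_mul, abs_of_nonneg hΔ, mul_assoc]
    exact mul_le_mul_of_nonneg_left (abs_sub_le_of_hasDerivAt_of_abs_le hd1 hb1 a b) hΔ
  constructor
  · intro x
    have hc : ContractingWith ⟨Δ * lam, mul_nonneg hΔ hlam⟩ (fun y => x + Δ * f y) := by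
      refine ⟨by exact_mod_cast hcontr, LipschitzWith.of_dist_le_mul fun a b => ?_⟩
      rw [Real.dist_eq, Real.dist_eq, add_sub_add_left_eq_sub]
      exact hlip a b
    exact ⟨hc.fixedPoint _, hc.fixedPoint_isFixedPt.symm,
      fun y hy => hc.fixedPoint_unique hy.symm⟩
  · intro ζ hζ x
    have hpos : 0 < 1 - Δ * lam := sub_pos.2 hcontr
    have hcont : Continuous ζ := by
      refine (LipschitzWith.of_dist_le' (K := (1 - Δ * lam)⁻¹) fun a b => ?_).continuous
      rw [Real.dist_eq, Real.dist_eq, inv_mul_eq_div, le_div_iff₀ hpos]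
      have h : ζ a - ζ b = (a - b) + (Δ * f (ζ a) - Δ * f (ζ b)) := by
        linear_combination hζ a - hζ b
      have h' : |ζ a - ζ b| ≤ |a - b| + |Δ * f (ζ a) - Δ * f (ζ b)| := by
        conv_lhs => rw [h]
        exact abs_add_le _ _
      linarith [hlip (ζ a) (ζ b)]
    have hne : 1 - Δ * f' (ζ x) ≠ 0 := by
      have := mul_le_mul_of_nonneg_left ((le_abs_self _).trans (hb1 (ζ x))) hΔ
      linarith
    rw [one_div]
    refine HasDerivAt.of_local_left_inverse hcont.continuousAt
      ((hasDerivAt_id (ζ x)).sub ((hd1 (ζ x)).const_mul Δ)) hne (.of_forall fun y => ?_)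
    simp only [Pi.sub_apply, id]
    linarith [hζ y]
end
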